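/- arXiv:1809.06829 — 3 statements merged into one kernel-verified Lean document; each statement's English description precedes it below -/
import Mathlib

section
/- Let X be a metric space, A ⊂ ℝ^{n+m} a measurable set of positive Lebesgue measure, and f : A → X a Lipschitz map such that Θ^{*n}(f,x) > 0 on a subset of A of positive Lebesgue measure. Then there exist a set K ⊂ A of positive Lebesgue measure, an open set U ⊃ K, a bi-Lipschitz C¹-diffeomorphism G : U → G(U) ⊂ ℝ^{n+m}, and a map π : X → ℝ^n that is √n-Lipschitz into Euclidean ℝ^n (and 1-Lipschitz into ℝ^n with the max norm), such that π(f(G⁻¹(x₁,…,x_n,y₁,…,y_m))) = (x₁,…,x_n) for all (x,y) ∈ G(K). -/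
open MeasureTheory Metric Set Filter
open scoped ENNReal NNReal Topology

noncomputable section

abbrev EucSp (k : ℕ) := EuclideanSpace ℝ (Fin k)

/-- The volume of the unit ball in `ℝ^n`. -/
def unitBallVol (n : ℕ) : ℝ≥0∞ := volume (Metric.ball (0 : EucSp n) 1)

/-- The `n`-dimensional Hausdorff content. -/
def hContent {X : Type*} [PseudoEMetricSpace X] (n : ℕ) (E : Set X) : ℝ≥0∞ :=
  ⨅ (A : ℕ → Set X) (_ : E ⊆ ⋃ i, A i),
    unitBallVol n / 2 ^ n * ∑' i, EMetric.diam (A i) ^ n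

/-- Upper n-density. -/
def upperDensity {k : ℕ} {X : Type*} [PseudoEMetricSpace X] (n : ℕ)
    (f : EucSp k → X) (A : Set (EucSp k)) (x : EucSp k) : ℝ≥0∞ :=
  Filter.limsup
    (fun r : ℝ => hContent n (f '' (Metric.ball x r ∩ A)) /
      (unitBallVol n * ENNReal.ofReal r ^ n)) (𝓝[>] (0:ℝ))

def lowerDensity {k : ℕ} {X : Type*} [PseudoEMetricSpace X] (n : ℕ)
    (f : EucSp k → X) (A : Set (EucSp k)) (x : EucSp k) : ℝ≥0∞ :=
  Filter.liminf
    (fun r : ℝ => hContent n (f '' (Metric.ball x r ∩ A)) /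
      (unitBallVol n * ENNReal.ofReal r ^ n)) (𝓝[>] (0:ℝ))

def IsDensityPoint {k : ℕ} (E : Set (EucSp k)) (x : EucSp k) : Prop :=
  Filter.Tendsto (fun r : ℝ => volume (E ∩ Metric.ball x r) / volume (Metric.ball x r))
    (𝓝[>] (0:ℝ)) (𝓝 1)

def HasApproxDerivWithinAt {k : ℕ} (A : Set (EucSp k)) (f : EucSp k → ℝ)
    (L : EucSp k →ₗ[ℝ] ℝ) (x : EucSp k) : Prop :=
  ∃ Ax : Set (EucSp k), Ax ⊆ A ∧ MeasurableSet Ax ∧ IsDensityPoint Ax x ∧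
    Filter.Tendsto (fun y => |f y - f x - L (y - x)| / ‖y - x‖) (𝓝[Ax] x) (𝓝 0)

abbrev LpInfty := lp (fun _ : ℕ => ℝ) ∞

def HasCompApproxDerivWithinAt {k : ℕ} (A : Set (EucSp k)) (f : EucSp k → LpInfty)
    (D : EucSp k →ₗ[ℝ] (ℕ → ℝ)) (x : EucSp k) : Prop :=
  ∀ i : ℕ, HasApproxDerivWithinAt A (fun y => f y i) ((LinearMap.proj i).comp D) x

def IsBiLipC1DiffeoOn {k : ℕ} (G Ginv : EucSp k → EucSp k) (U : Set (EucSp k)) : Prop :=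
  IsOpen U ∧ IsOpen (G '' U) ∧ (∀ x ∈ U, Ginv (G x) = x) ∧ (∀ y ∈ G '' U, G (Ginv y) = y) ∧
    ContDiffOn ℝ 1 G U ∧ ContDiffOn ℝ 1 Ginv (G '' U) ∧
    ∃ Λ : ℝ≥0, LipschitzOnWith Λ G U ∧ LipschitzOnWith Λ Ginv (G '' U)

def IsFinCoordPerm (Ψ : LpInfty → LpInfty) : Prop :=
  ∃ σ : Equiv.Perm ℕ, {i | σ i ≠ i}.Finite ∧ ∀ (x : LpInfty) (i : ℕ), Ψ x i = x (σ i)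

def openCube {k : ℕ} (c : EucSp k) (d : ℝ) : Set (EucSp k) := {x | ∀ i, |x i - c i| < d / 2}

def closedCube {k : ℕ} (c : EucSp k) (d : ℝ) : Set (EucSp k) := {x | ∀ i, |x i - c i| ≤ d / 2}

def hnmContent {N : ℕ} {X : Type*} [PseudoEMetricSpace X] (n m : ℕ)
    (f : EucSp N → X) (Q : Set (EucSp N)) : ℝ≥0∞ :=
  ⨅ (c : ℕ → EucSp N) (d : ℕ → ℝ) (_ : ∀ j, 0 ≤ d j) (_ : ∀ j, openCube (c j) (d j) ⊆ Q)
    (_ : Pairwise (Function.onFun Disjoint fun j => openCube (c j) (d j)))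
    (_ : volume (Q \ ⋃ j, openCube (c j) (d j)) = 0),
    ∑' j, hContent n (f '' openCube (c j) (d j)) * ENNReal.ofReal (d j) ^ m

def matrixRow {n k : ℕ} (D : Matrix (Fin n) (Fin k) ℝ) (i : Fin n) : EucSp k →ₗ[ℝ] ℝ :=
  (EuclideanSpace.proj i).toLinearMap.comp (Matrix.toEuclideanLin D)

def jacDet {n k : ℕ} (D : Matrix (Fin n) (Fin k) ℝ) : ℝ := Real.sqrt ((D * D.transpose).det)

def upperLintegral {Y : Type*} [MeasurableSpace Y] (μ : Measure Y) (g : Y → ℝ≥0∞) : ℝ≥0∞ :=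
  ⨅ (h : Y → ℝ≥0∞) (_ : Measurable h) (_ : ∀ y, g y ≤ h y), ∫⁻ y, h y ∂μ



lemma avg_ineq {N : ℕ} {h : EucSp N → ℝ} {L : ℝ≥0} (hL : LipschitzWith L h)
    {S : Set (EucSp N)} (hS : MeasurableSet S) (u : EucSp N) {τ : ℝ} (hτ : 0 ≤ τ)
    (hSτ : ∀ x ∈ S, |fderiv ℝ h x u| ≤ τ)
    (x y : EucSp N) {ρ r R κ : ℝ} (hρ : 0 < ρ) (hr : 0 ≤ r)
    (hsub : ∀ t ∈ Icc (0:ℝ) r, ∀ w ∈ closedBall y ρ, w + t • u ∈ closedBall x R)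
    (hκ : volume.real (closedBall x R \ S) ≤ κ * volume.real (closedBall y ρ)) :
    |h (y + r • u) - h y| ≤ r * (τ + L * ‖u‖ * κ) + 2 * L * ρ := by
  set B := closedBall y ρ with hB
  have hBm : MeasurableSet B := isClosed_closedBall.measurableSet
  have hBfin : volume B ≠ ∞ := measure_closedBall_lt_top.ne
  have hBpos : 0 < volume.real B :=
    ENNReal.toReal_pos (measure_closedBall_pos volume y hρ).ne' hBfin
  have hcont : Continuous h := hL.continuous
  have hic : ∀ c : ℝ, Integrable (fun _ : EucSp N => c) (volume.restrict B) := fun c =>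
    integrableOn_const hBfin
  set Φ : ℝ → ℝ := fun t => ∫ w in B, h (w + t • u) with hΦ
  have hcomp : IsCompact B := isCompact_closedBall y ρ
  have hIntg : ∀ t : ℝ, IntegrableOn (fun w => h (w + t • u)) B := fun t =>
    (hcont.comp (continuous_id.add continuous_const)).continuousOn.integrableOn_compact hcomp
  have hdm : ∀ t : ℝ, Measurable (fun w => fderiv ℝ h (w + t • u) u) := fun t =>
    (measurable_fderiv_apply_const ℝ h u).comp (measurable_id.add_const _)
  have hfd : ∀ z, |fderiv ℝ h z u| ≤ L * ‖u‖ := fun z =>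
    ((fderiv ℝ h z).le_opNorm u).trans
      (mul_le_mul_of_nonneg_right (norm_fderiv_le_of_lipschitz ℝ hL) (norm_nonneg _))
  have hderiv : ∀ t : ℝ, HasDerivAt Φ (∫ w in B, fderiv ℝ h (w + t • u) u) t := by
    intro t
    have := hasDerivAt_integral_of_dominated_loc_of_lip (μ := volume.restrict B) (𝕜 := ℝ)
      (F := fun (t : ℝ) w => h (w + t • u)) (F' := fun w => fderiv ℝ h (w + t • u) u)
      (x₀ := t) (s := univ) (bound := fun _ => (L:ℝ) * ‖u‖) univ_mem
      (Eventually.of_forall fun t => (hIntg t).aestronglyMeasurable) (hIntg t)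
      (hdm t).aestronglyMeasurable ?_ ?_ ?_
    · exact this.2
    · refine Eventually.of_forall fun w => ?_
      refine LipschitzOnWith.of_dist_le_mul fun a _ b _ => ?_
      have := hL.dist_le_mul (w + a • u) (w + b • u)
      rw [dist_add_left, dist_eq_norm (a • u), ← sub_smul, norm_smul] at this
      rw [Real.coe_nnabs, abs_of_nonneg (by positivity), Real.dist_eq a b]
      calc _ ≤ _ := this
        _ = _ := by rw [Real.norm_eq_abs]; ring
    · exact hic _
    · have hae : ∀ᵐ w : EucSp N, DifferentiableAt ℝ h (w + t • u) :=
        (measurePreserving_add_right volume (t • u)).quasiMeasurePreserving.ae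
          (hL.ae_differentiableAt (μ := volume))
      refine ae_restrict_of_ae (hae.mono fun w hw => ?_)
      have h1 : HasDerivAt (fun s : ℝ => w + s • u) u t := by
        simpa using ((hasDerivAt_id t).smul_const u).const_add w
      exact hw.hasFDerivAt.comp_hasDerivAt t h1
  have hbound : ∀ t ∈ Ico (0:ℝ) r, ‖∫ w in B, fderiv ℝ h (w + t • u) u‖ ≤
      (τ + L * ‖u‖ * κ) * volume.real B := by
    intro t ht
    set T : Set (EucSp N) := (fun w => w + t • u) ⁻¹' Sᶜ with hT
    have hTm : MeasurableSet T := (measurable_id.add_const (t • u)) hS.compl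
    have hle : ‖∫ w in B, fderiv ℝ h (w + t • u) u‖ ≤
        ∫ w in B, (τ + T.indicator (fun _ => (L:ℝ) * ‖u‖) w) := by
      apply norm_integral_le_of_norm_le
      · exact (hic _).add ((hic _).indicator hTm)
      · refine Eventually.of_forall fun w => ?_
        by_cases hw : w ∈ T
        · rw [indicator_of_mem hw]
          exact (hfd _).trans (by linarith)
        · rw [indicator_of_notMem hw, add_zero]
          exact hSτ _ (by simpa [T] using hw)
    refine hle.trans ?_
    rw [integral_add (hic _) ((hic _).indicator hTm),
      setIntegral_const, setIntegral_indicator hTm, setIntegral_const, smul_eq_mul, smul_eq_mul]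
    have h2 : volume.real (B ∩ T) ≤ κ * volume.real B := by
      refine le_trans ?_ hκ
      have : volume (B ∩ T) ≤ volume (closedBall x R \ S) := by
        rw [← measure_preimage_add_right volume (t • u) (closedBall x R \ S)]
        refine measure_mono fun w hw => ⟨hsub t ⟨ht.1, ht.2.le⟩ w hw.1, hw.2⟩
      exact ENNReal.toReal_mono
        ((measure_mono sdiff_subset).trans_lt measure_closedBall_lt_top).ne this
    have : volume.real (B ∩ T) * (L * ‖u‖) ≤ κ * volume.real B * (L * ‖u‖) := by gcongr
    linarith
  have hmv := norm_image_sub_le_of_norm_deriv_le_segment' (f := Φ) (a := 0) (b := r)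
    (fun t _ => (hderiv t).hasDerivWithinAt) hbound r ⟨hr, le_rfl⟩
  rw [sub_zero, Real.norm_eq_abs] at hmv
  -- compare with averages
  have hcmp : ∀ t : ℝ, |Φ t - volume.real B * h (y + t • u)| ≤ L * ρ * volume.real B := by
    intro t
    have : Φ t - volume.real B * h (y + t • u) =
        ∫ w in B, (h (w + t • u) - h (y + t • u)) := by
      rw [integral_sub (hIntg t) (hic _), setIntegral_const, smul_eq_mul]
    rw [this, ← Real.norm_eq_abs]
    refine norm_setIntegral_le_of_norm_le_const hBfin.lt_top fun w hw => ?_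
    have := hL.dist_le_mul (w + t • u) (y + t • u)
    rw [dist_add_right] at this
    exact this.trans (mul_le_mul_of_nonneg_left hw L.2)
  have h1 := hcmp r
  have h0 := hcmp 0
  rw [zero_smul, add_zero] at h0
  have : volume.real B * |h (y + r • u) - h y| ≤
      volume.real B * (r * (τ + L * ‖u‖ * κ) + 2 * L * ρ) := by
    rw [← abs_of_pos hBpos, ← abs_mul, abs_of_pos hBpos]
    have e : volume.real B * (h (y + r • u) - h y) = (Φ r - Φ 0)
      - (Φ r - volume.real B * h (y + r • u)) + (Φ 0 - volume.real B * h y) := by ring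
    rw [e]
    calc _ ≤ |Φ r - Φ 0| + |Φ r - volume.real B * h (y + r • u)| + |Φ 0 - volume.real B * h y| :=
          (abs_add_le _ _).trans (add_le_add (abs_sub _ _) le_rfl)
      _ ≤ _ := by linarith
  exact le_of_mul_le_mul_left this hBpos


lemma dens_ev {N : ℕ} {S : Set (EucSp N)} (hS : MeasurableSet S) {x : EucSp N}
    (hx : Tendsto (fun r => volume (S ∩ closedBall x r) / volume (closedBall x r))
      (𝓝[>] (0:ℝ)) (𝓝 1)) {κ c : ℝ} (hκ : 0 < κ) (hc : 0 < c) :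
    ∀ᶠ r in 𝓝[>] (0:ℝ), volume.real (closedBall x (c * r) \ S) ≤
      κ * volume.real (closedBall x (c * r)) := by
  have h1 : Tendsto (fun r : ℝ => c * r) (𝓝[>] (0:ℝ)) (𝓝[>] (0:ℝ)) := by
    refine tendsto_nhdsWithin_iff.2 ⟨?_, ?_⟩
    · have : Tendsto (fun r : ℝ => c * r) (𝓝 0) (𝓝 (c * 0)) := (continuous_const_mul c).tendsto 0
      rw [mul_zero] at this
      exact this.mono_left nhdsWithin_le_nhds
    · filter_upwards [self_mem_nhdsWithin] with r hr
      exact mul_pos hc hr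
  have h2 := (ENNReal.tendsto_toReal ENNReal.one_ne_top).comp (hx.comp h1)
  have h3 : ∀ᶠ r in 𝓝[>] (0:ℝ), 1 - κ <
      (volume (S ∩ closedBall x (c * r)) / volume (closedBall x (c * r))).toReal :=
    h2.eventually (lt_mem_nhds (by simp [hκ]))
  filter_upwards [h3, self_mem_nhdsWithin] with r hr hr0
  have hr0' : 0 < c * r := mul_pos hc hr0
  have hfin : volume (closedBall x (c * r)) ≠ ∞ := measure_closedBall_lt_top.ne
  have hpos : 0 < volume.real (closedBall x (c * r)) :=
    ENNReal.toReal_pos (measure_closedBall_pos volume x hr0').ne' hfin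
  rw [ENNReal.toReal_div] at hr
  change 1 - κ < volume.real _ / volume.real _ at hr
  rw [lt_div_iff₀ hpos] at hr
  have := measureReal_sdiff_add_inter (μ := volume) (s := closedBall x (c * r)) hS hfin
  rw [inter_comm] at this
  nlinarith

def smallSet {N : ℕ} (h : ℕ → EucSp N → ℝ) (u : EucSp N) (τ : ℝ) : Set (EucSp N) :=
  {x | ∀ i, |fderiv ℝ (h i) x u| ≤ τ}

lemma measurableSet_smallSet {N : ℕ} (h : ℕ → EucSp N → ℝ) (u : EucSp N) (τ : ℝ) :
    MeasurableSet (smallSet h u τ) := by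
  have : smallSet h u τ = ⋂ i, {x | |fderiv ℝ (h i) x u| ≤ τ} := by
    ext; simp [smallSet]
  rw [this]
  refine MeasurableSet.iInter fun i => measurableSet_le ?_ measurable_const
  exact (measurable_fderiv_apply_const ℝ (h i) u).norm

lemma near_kernel {N : ℕ} {h : ℕ → EucSp N → ℝ} {L : ℝ≥0} (hL : ∀ i, LipschitzWith L (h i))
    (d : ℕ → EucSp N) (hd : DenseRange d) (x : EucSp N)
    (hx : ∀ j k : ℕ, x ∈ smallSet h (d j) (2 * L / (k + 1)) →
      Tendsto (fun r => volume (smallSet h (d j) (2 * L / (k + 1)) ∩ closedBall x r) /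
        volume (closedBall x r)) (𝓝[>] (0:ℝ)) (𝓝 1))
    (W : Submodule ℝ (EucSp N)) (hW : ∀ i, ∀ u ∈ Wᗮ, fderiv ℝ (h i) x u = 0) (k : ℕ) :
    ∀ᶠ r in 𝓝[>] (0:ℝ), ∀ y ∈ ball x r, ∀ z ∈ ball x r,
      ‖W.starProjection (z - y)‖ ≤ r / (k + 1) → ∀ i, |h i z - h i y| ≤ 8 * L * r / (k + 1) := by
  obtain ⟨ε, hε⟩ : ∃ ε : ℝ, ε = 1 / ((k:ℝ) + 1) := ⟨_, rfl⟩
  have hε0 : 0 < ε := by rw [hε]; positivity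
  have hε1 : ε ≤ 1 := by
    rw [hε, div_le_one (by positivity)]; linarith [Nat.cast_nonneg (α := ℝ) k]
  have hL0 : (0:ℝ) ≤ L := L.2
  obtain ⟨t, ht⟩ : ∃ t : Finset ℕ, closedBall (0 : EucSp N) 2 ⊆ ⋃ j ∈ t, ball (d j) ε := by
    refine (isCompact_closedBall (0 : EucSp N) 2).elim_finite_subcover _ (fun _ => isOpen_ball) ?_
    intro u _
    obtain ⟨j, hj⟩ := hd.exists_dist_lt u hε0
    exact mem_iUnion.2 ⟨j, hj⟩
  have key : ∀ᶠ r in 𝓝[>] (0:ℝ), ∀ j ∈ t, x ∈ smallSet h (d j) (2 * L / (k + 1)) →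
      volume.real (closedBall x (5 * r) \ smallSet h (d j) (2 * L / (k + 1))) ≤
      (ε * (ε / 5) ^ N) * volume.real (closedBall x (5 * r)) := by
    refine (Filter.eventually_all_finset t).2 fun j _ => ?_
    by_cases hj : x ∈ smallSet h (d j) (2 * L / (k + 1))
    · filter_upwards [dens_ev (measurableSet_smallSet _ _ _) (hx j k hj)
        (κ := ε * (ε / 5) ^ N) (by positivity) (by norm_num : (0:ℝ) < 5)] with r hr _ using hr
    · exact Eventually.of_forall fun r h => absurd h hj
  filter_upwards [key, self_mem_nhdsWithin] with r hr hr0 y hy z hz hP i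
  have hr0 : 0 < r := hr0
  obtain ⟨u, hu⟩ : ∃ u : EucSp N, u = r⁻¹ • (z - y) := ⟨_, rfl⟩
  have hzu : z = y + r • u := by
    rw [hu, smul_smul, mul_inv_cancel₀ hr0.ne', one_smul]; abel
  have hzy : ‖z - y‖ ≤ 2 * r := by
    rw [← dist_eq_norm]
    have := dist_triangle_right z y x
    rw [mem_ball] at hy hz
    linarith
  have hu2 : ‖u‖ ≤ 2 := by
    rw [hu, norm_smul, norm_inv, Real.norm_of_nonneg hr0.le, inv_mul_le_iff₀ hr0]; linarith
  have hPu : ‖W.starProjection u‖ ≤ ε := by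
    rw [hu, map_smul, norm_smul, norm_inv, Real.norm_of_nonneg hr0.le, inv_mul_le_iff₀ hr0, hε]
    calc _ ≤ _ := hP
      _ = _ := by ring
  obtain ⟨j, hjt, hj⟩ : ∃ j ∈ t, ‖u - d j‖ < ε := by
    have := ht (show u ∈ closedBall (0 : EucSp N) 2 by simpa using hu2)
    simpa [dist_eq_norm] using this
  have hdj : ‖d j‖ ≤ 3 := by
    have := norm_sub_norm_le (d j) u
    rw [norm_sub_rev] at this
    linarith
  have hmem : x ∈ smallSet h (d j) (2 * L / (k + 1)) := by
    intro i
    have e : fderiv ℝ (h i) x (d j) =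
        fderiv ℝ (h i) x (d j - u + W.starProjection u) := by
      have := hW i _ (W.sub_starProjection_mem_orthogonal u)
      rw [map_sub] at this
      rw [map_add, map_sub]
      linarith
    rw [e]
    calc _ ≤ ‖fderiv ℝ (h i) x‖ * ‖d j - u + W.starProjection u‖ :=
          (fderiv ℝ (h i) x).le_opNorm _
      _ ≤ L * (ε + ε) := by
          refine mul_le_mul (norm_fderiv_le_of_lipschitz ℝ (hL i)) ?_ (norm_nonneg _) hL0
          refine (norm_add_le _ _).trans (add_le_add ?_ hPu)
          rw [norm_sub_rev]; exact hj.le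
      _ = _ := by rw [hε]; ring
  have hvol := hr j hjt hmem
  have havg := avg_ineq (hL i) (measurableSet_smallSet h (d j) (2 * L / (k + 1))) (d j)
    (τ := 2 * L / (k + 1)) (by positivity) (fun x hx => hx i) x y (ρ := ε * r) (r := r)
    (R := 5 * r) (κ := ε) (by positivity) hr0.le ?_ ?_
  · have h2 : |h i z - h i (y + r • d j)| ≤ L * (r * ε) := by
      have := (hL i).dist_le_mul z (y + r • d j)
      rw [Real.dist_eq] at this
      refine this.trans (mul_le_mul_of_nonneg_left ?_ hL0)
      rw [hzu, dist_add_left, dist_eq_norm, ← smul_sub, norm_smul, Real.norm_of_nonneg hr0.le]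
      exact mul_le_mul_of_nonneg_left hj.le hr0.le
    have h3 := abs_sub_le (h i z) (h i (y + r • d j)) (h i y)
    have h4 : (L:ℝ) * ‖d j‖ * ε ≤ L * 3 * ε := by gcongr
    have h5 : r * (2 * L / (k + 1) + L * ‖d j‖ * ε) ≤ r * (2 * L / (k + 1) + L * 3 * ε) := by
      gcongr
    calc _ ≤ L * (r * ε) + (r * (2 * L / (k + 1) + L * 3 * ε) + 2 * L * (ε * r)) := by linarith
      _ = _ := by rw [hε]; ring
  · intro s hs w hw
    rw [mem_closedBall] at hw ⊢
    have h1 : dist (w + s • d j) w ≤ 3 * r := by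
      rw [dist_self_add_left, norm_smul, Real.norm_of_nonneg hs.1]
      calc _ ≤ r * 3 := mul_le_mul hs.2 hdj (norm_nonneg _) hr0.le
        _ = _ := by ring
    have h2 := dist_triangle4 (w + s • d j) w y x
    rw [mem_ball] at hy
    have : ε * r ≤ 1 * r := by gcongr
    linarith
  · refine hvol.trans (le_of_eq ?_)
    rw [Measure.addHaar_real_closedBall _ _ (by positivity),
      Measure.addHaar_real_closedBall _ _ (by positivity), finrank_euclideanSpace_fin]
    rw [div_pow, mul_pow, mul_pow]
    field_simp


lemma hContent_le_fintype {X : Type*} [PseudoEMetricSpace X] {ι : Type*} [Fintype ι] {n : ℕ}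
    (hn : n ≠ 0) (E : Set X) (C : ι → Set X) (hE : E ⊆ ⋃ i, C i) (δ : ℝ≥0∞)
    (hδ : ∀ i, Metric.ediam (C i) ≤ δ) :
    hContent n E ≤ unitBallVol n / 2 ^ n * (Fintype.card ι * δ ^ n) := by
  classical
  let e := Fintype.equivFin ι
  let C' : ℕ → Set X := fun k => if h : k < Fintype.card ι then C (e.symm ⟨k, h⟩) else ∅
  have hE' : E ⊆ ⋃ i, C' i := by
    refine hE.trans (iUnion_subset fun i => ?_)
    refine subset_iUnion_of_subset (e i) ?_
    simp [C']
  refine (iInf₂_le C' hE').trans ?_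
  refine mul_le_mul_right ?_ _
  rw [tsum_eq_sum (s := Finset.range (Fintype.card ι))]
  · calc _ ≤ ∑ i ∈ Finset.range (Fintype.card ι), δ ^ n := by
          refine Finset.sum_le_sum fun i hi => ?_
          have hi : i < Fintype.card ι := Finset.mem_range.1 hi
          refine pow_le_pow_left₀ zero_le ?_ _
          simp only [C', hi, dif_pos]
          exact hδ _
      _ = _ := by simp
  · intro b hb
    have hb : ¬ b < Fintype.card ι := fun h => hb (Finset.mem_range.2 h)
    simp only [C', hb, dif_neg, not_false_eq_true]
    change Metric.ediam (∅ : Set X) ^ n = 0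
    rw [Metric.ediam_empty, zero_pow hn]

lemma density_zero {N n : ℕ} {X : Type*} [MetricSpace X] (f : EucSp N → X) (A : Set (EucSp N))
    (x : EucSp N) (W : Submodule ℝ (EucSp N)) (hW : Module.finrank ℝ W < n) {C : ℝ} (hC : 0 ≤ C)
    (hx : ∀ k : ℕ, ∀ᶠ r in 𝓝[>] (0:ℝ), ∀ y ∈ ball x r ∩ A, ∀ z ∈ ball x r ∩ A,
      ‖W.starProjection (z - y)‖ ≤ r / (k + 1) → dist (f z) (f y) ≤ C * r / (k + 1)) :
    upperDensity n f A x = 0 := by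
  have hn : n ≠ 0 := by omega
  have hn1 : (1:ℝ) ≤ n := by exact_mod_cast Nat.one_le_iff_ne_zero.2 hn
  have hω0 : unitBallVol n ≠ 0 := (measure_ball_pos volume _ one_pos).ne'
  have hω1 : unitBallVol n ≠ ∞ := measure_ball_lt_top.ne
  obtain ⟨D, hD⟩ : ∃ D : ℝ, D = (3 * n) ^ (n - 1) * C ^ n := ⟨_, rfl⟩
  have hD0 : 0 ≤ D := by rw [hD]; positivity
  have main : ∀ k : ℕ, upperDensity n f A x ≤ ENNReal.ofReal (D / (k + 1)) := by
    intro k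
    refine Filter.limsup_le_of_le (by isBoundedDefault) ?_
    filter_upwards [hx k, self_mem_nhdsWithin] with r hr hr0
    have hr0 : 0 < r := hr0
    refine ENNReal.div_le_of_le_mul ?_
    set M : ℕ := n * (k + 1) with hM
    have hM1 : 1 ≤ M := Nat.mul_pos (Nat.pos_of_ne_zero hn) (Nat.succ_pos k)
    have hM0 : (0:ℝ) < M := by exact_mod_cast hM1
    let b := stdOrthonormalBasis ℝ W
    set d := Module.finrank ℝ W with hd
    let c : Fin d → EucSp N → ℝ := fun j v => inner ℝ (b j : EucSp N) v
    have hb : ∀ j, ‖(b j : EucSp N)‖ = 1 := fun j => by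
      exact b.orthonormal.1 j
    let ι := Fin d → ↥(Finset.Icc (-(M:ℤ)) M)
    let cell : ι → Set X := fun q =>
      f '' {y | y ∈ ball x r ∩ A ∧ ∀ j, ⌊c j (y - x) * M / r⌋ = (q j : ℤ)}
    have hcov : f '' (ball x r ∩ A) ⊆ ⋃ q, cell q := by
      rintro _ ⟨y, hy, rfl⟩
      have hmem : ∀ j, ⌊c j (y - x) * M / r⌋ ∈ Finset.Icc (-(M:ℤ)) M := by
        intro j
        have h1 : |c j (y - x)| ≤ r := by
          refine (abs_real_inner_le_norm _ _).trans ?_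
          rw [hb, one_mul, ← dist_eq_norm]
          exact (mem_ball.1 hy.1).le
        rw [abs_le] at h1
        rw [Finset.mem_Icc, Int.le_floor]
        constructor
        · rw [le_div_iff₀ hr0]; push_cast; nlinarith
        · have : ((⌊c j (y - x) * M / r⌋ : ℤ) : ℝ) ≤ (M:ℤ) := by
            refine (Int.floor_le _).trans ?_
            rw [div_le_iff₀ hr0]; push_cast; nlinarith
          exact_mod_cast this
      exact mem_iUnion.2 ⟨fun j => ⟨_, hmem j⟩, y, ⟨hy, fun j => rfl⟩, rfl⟩
    have hdiam : ∀ q, Metric.ediam (cell q) ≤ ENNReal.ofReal (C * r / (k + 1)) := by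
      intro q
      refine Metric.ediam_le ?_
      rintro _ ⟨z, ⟨hz, hzq⟩, rfl⟩ _ ⟨y, ⟨hy, hyq⟩, rfl⟩
      rw [edist_dist]
      refine ENNReal.ofReal_le_ofReal (hr y hy z hz ?_)
      have hco : ∀ j, |c j (z - y)| ≤ r / M := by
        intro j
        have h1 := Int.abs_sub_lt_one_of_floor_eq_floor ((hzq j).trans (hyq j).symm)
        have h2 : c j (z - x) * M / r - c j (y - x) * M / r = c j (z - y) * (M / r) := by
          have : c j (z - y) = c j (z - x) - c j (y - x) := by
            simp only [c]; rw [← inner_sub_right]; congr 1; abel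
          rw [this]; ring
        rw [h2, abs_mul, abs_of_pos (div_pos hM0 hr0)] at h1
        rw [le_div_iff₀ hM0]
        rw [← mul_div_assoc, div_lt_iff₀ hr0] at h1
        linarith
      have hsum : W.starProjection (z - y) = ∑ j, c j (z - y) • (b j : EucSp N) := by
        rw [W.starProjection_apply, b.orthogonalProjectionOnto_apply_eq_sum]
        simp [c]
      rw [hsum]
      calc _ ≤ ∑ j, ‖c j (z - y) • (b j : EucSp N)‖ := norm_sum_le _ _
        _ ≤ ∑ j : Fin d, r / M := by
            refine Finset.sum_le_sum fun j _ => ?_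
            rw [norm_smul, hb, mul_one]; exact hco j
        _ = d * (r / M) := by simp
        _ ≤ n * (r / M) := by gcongr
        _ = r / (k + 1) := by
            rw [hM]; push_cast; field_simp
    refine (hContent_le_fintype hn _ cell hcov _ hdiam).trans ?_
    have hcard : Fintype.card ι = (2 * M + 1) ^ d := by
      simp only [ι, Fintype.card_fun, Fintype.card_coe, Int.card_Icc, Fintype.card_fin]
      congr 1
      omega
    rw [hcard]
    have hreal : ((2 * M + 1 : ℕ) ^ d : ℝ) * (C * r / (k + 1)) ^ n ≤ D / (k + 1) * r ^ n := by
      have e1 : ((2 * M + 1 : ℕ) ^ d : ℝ) ≤ (3 * n * (k + 1)) ^ (n - 1) := by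
        have h3 : ((2 * M + 1 : ℕ) : ℝ) ≤ 3 * n * (k + 1) := by
          have : 2 * M + 1 ≤ 3 * M := by omega
          calc ((2 * M + 1 : ℕ) : ℝ) ≤ ((3 * M : ℕ) : ℝ) := by exact_mod_cast this
            _ = _ := by rw [hM]; push_cast; ring
        have h4 : (1:ℝ) ≤ ((2 * M + 1 : ℕ) : ℝ) := by exact_mod_cast (by omega)
        calc ((2 * M + 1 : ℕ) ^ d : ℝ) ≤ ((2 * M + 1 : ℕ) : ℝ) ^ (n - 1) :=
              pow_le_pow_right₀ h4 (by omega)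
          _ ≤ _ := pow_le_pow_left₀ (by positivity) h3 _
      calc _ ≤ (3 * n * (k + 1)) ^ (n - 1) * (C * r / (k + 1)) ^ n := by gcongr
        _ = _ := by
          obtain ⟨n', rfl⟩ := Nat.exists_eq_succ_of_ne_zero hn
          rw [hD, Nat.succ_eq_add_one, Nat.add_sub_cancel, div_pow, mul_pow _ ((k:ℝ)+1),
            pow_succ ((k:ℝ) + 1) n', mul_pow C r]
          field_simp
    calc unitBallVol n / 2 ^ n * (((2 * M + 1) ^ d : ℕ) * ENNReal.ofReal (C * r / (k + 1)) ^ n)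
        ≤ unitBallVol n * (((2 * M + 1) ^ d : ℕ) * ENNReal.ofReal (C * r / (k + 1)) ^ n) := by
          gcongr
          refine ENNReal.div_le_of_le_mul ?_
          exact le_mul_of_one_le_right zero_le (one_le_pow₀ (by norm_num))
      _ = unitBallVol n * ENNReal.ofReal (((2 * M + 1 : ℕ) ^ d : ℝ) * (C * r / (k + 1)) ^ n) := by
          rw [ENNReal.ofReal_mul (by positivity), ENNReal.ofReal_pow (by positivity),
            ENNReal.ofReal_pow (by positivity), ENNReal.ofReal_natCast]
          push_cast; rfl
      _ ≤ unitBallVol n * ENNReal.ofReal (D / (k + 1) * r ^ n) := by gcongr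
      _ = _ := by
          rw [ENNReal.ofReal_mul (by positivity), ENNReal.ofReal_pow hr0.le]; ring
  refine le_antisymm (ge_of_tendsto' (x := atTop) ?_ main) zero_le
  rw [← ENNReal.ofReal_zero]
  refine (ENNReal.continuous_ofReal.tendsto 0).comp ?_
  exact tendsto_const_div_atTop_nhds_zero_nat D |>.comp (tendsto_add_atTop_nat 1) |>.congr
    fun k => by simp


lemma exists_indep {N n : ℕ} {X : Type*} [MetricSpace X]
    (A : Set (EucSp N)) (f : EucSp N → X) {L : ℝ≥0} (hf : LipschitzOnWith L f A)
    (hdens : 0 < volume {x ∈ A | 0 < upperDensity n f A x}) :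
    ∃ (q : Fin n → X) (F : Fin n → EucSp N → ℝ), (∀ j, LipschitzWith L (F j)) ∧
      (∀ j, ∀ y ∈ A, F j y = dist (f y) (q j)) ∧
      0 < volume {x ∈ A | (∀ j, DifferentiableAt ℝ (F j) x) ∧
        LinearIndependent ℝ (fun j => fderiv ℝ (F j) x)} := by
  have hAne : A.Nonempty := by
    by_contra h
    rw [not_nonempty_iff_eq_empty] at h
    simp [h] at hdens
  obtain ⟨c, hc, hcl⟩ := hf.continuousOn.isSeparable_image
    (TopologicalSpace.IsSeparable.of_separableSpace A)
  have hcne : c.Nonempty := by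
    have : (closure c).Nonempty := (hAne.image f).mono hcl
    exact closure_nonempty_iff.1 this
  obtain ⟨p, rfl⟩ := hc.exists_eq_range hcne
  have hpl : ∀ i, LipschitzOnWith L (fun y => dist (f y) (p i)) A := by
    intro i
    have := (LipschitzWith.dist_left (p i)).comp_lipschitzOnWith hf
    rwa [one_mul] at this
  choose h hL hh using fun i => (hpl i).extend_real
  have hdist : ∀ y ∈ A, ∀ z ∈ A, ∀ C : ℝ, (∀ i, |h i z - h i y| ≤ C) → dist (f z) (f y) ≤ C := by
    intro y hy z hz C hC
    refine le_of_forall_pos_le_add fun ε hε => ?_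
    obtain ⟨_, ⟨i, rfl⟩, hi⟩ := Metric.mem_closure_iff.1 (hcl ⟨y, hy, rfl⟩) (ε / 2) (by positivity)
    have h1 := (le_abs_self _).trans (hC i)
    rw [← hh i hy, ← hh i hz] at h1
    simp only at h1
    have h2 := dist_triangle_right (f z) (f y) (p i)
    linarith
  let d := TopologicalSpace.denseSeq (EucSp N)
  have hd : DenseRange d := TopologicalSpace.denseRange_denseSeq _
  have hae1 : ∀ᵐ x : EucSp N, ∀ j k : ℕ, x ∈ smallSet h (d j) (2 * L / (k + 1)) →
      Tendsto (fun r => volume (smallSet h (d j) (2 * L / (k + 1)) ∩ closedBall x r) /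
        volume (closedBall x r)) (𝓝[>] (0:ℝ)) (𝓝 1) := by
    refine ae_all_iff.2 fun j => ae_all_iff.2 fun k => ?_
    exact (ae_restrict_iff' (measurableSet_smallSet _ _ _)).1
      (Besicovitch.ae_tendsto_measure_inter_div volume _)
  have hae2 : ∀ᵐ x : EucSp N, ∀ i, DifferentiableAt ℝ (h i) x :=
    ae_all_iff.2 fun i => (hL i).ae_differentiableAt
  let Bad : (Fin n → ℕ) → Set (EucSp N) := fun I =>
    {x ∈ A | (∀ j, DifferentiableAt ℝ (h (I j)) x) ∧
        LinearIndependent ℝ (fun j => fderiv ℝ (h (I j)) x)}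
  have hsub : ∀ᵐ x : EucSp N, x ∈ {x ∈ A | 0 < upperDensity n f A x} → x ∈ ⋃ I, Bad I := by
    filter_upwards [hae1, hae2] with x hx1 hx2 hxS
    let Φ : ℕ → Module.Dual ℝ (EucSp N) := fun i => (fderiv ℝ (h i) x : EucSp N →ₗ[ℝ] ℝ)
    let S := Submodule.span ℝ (range Φ)
    let V0 := S.dualCoannihilator
    have hV0 : ∀ i, ∀ u ∈ V0, fderiv ℝ (h i) x u = 0 := by
      intro i u hu
      exact (Submodule.mem_dualCoannihilator u).1 hu (Φ i) (Submodule.subset_span ⟨i, rfl⟩)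
    have hrank : Module.finrank ℝ V0ᗮ = Module.finrank ℝ S := by
      have h1 := V0.finrank_add_finrank_orthogonal
      have h2 := Subspace.finrank_add_finrank_dualCoannihilator_eq S
      have h3 : Module.finrank ℝ V0 = Module.finrank ℝ S.dualCoannihilator := rfl
      omega
    by_cases hlt : Module.finrank ℝ V0ᗮ < n
    · exfalso
      have := density_zero f A x V0ᗮ hlt (C := 8 * L) (by positivity) ?_
      · exact hxS.2.ne' this
      · intro k
        have hW : ∀ i, ∀ u ∈ V0ᗮᗮ, fderiv ℝ (h i) x u = 0 := by
          rw [Submodule.orthogonal_orthogonal]; exact hV0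
        filter_upwards [near_kernel hL d hd x hx1 V0ᗮ hW k] with r hr y hy z hz hyz
        exact hdist y hy.2 z hz.2 _ (hr y hy.1 z hz.1 hyz)
    · push Not at hlt
      rw [hrank] at hlt
      obtain ⟨g, hg, -, hgi⟩ := Submodule.exists_fun_fin_finrank_span_eq ℝ (range Φ)
      choose J hJ using hg
      refine mem_iUnion.2 ⟨fun j => J (Fin.castLE hlt j), hxS.1, fun j => hx2 _, ?_⟩
      have hli := hgi.comp (Fin.castLE hlt) (Fin.castLE_injective hlt)
      refine LinearIndependent.of_comp (ContinuousLinearMap.coeLM ℝ) ?_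
      have e : g ∘ Fin.castLE hlt = fun j => Φ (J (Fin.castLE hlt j)) :=
        funext fun j => (hJ _).symm
      rw [e] at hli
      exact hli
  have hpos : volume (⋃ I, Bad I) ≠ 0 := by
    intro h0
    have : volume {x ∈ A | 0 < upperDensity n f A x} ≤ volume (⋃ I, Bad I) := measure_mono_ae hsub
    rw [h0] at this
    exact hdens.ne' (le_antisymm this zero_le)
  obtain ⟨I, hI⟩ : ∃ I, volume (Bad I) ≠ 0 := by
    by_contra hcon
    push Not at hcon
    exact hpos (measure_iUnion_null hcon)
  exact ⟨fun j => p (I j), fun j => h (I j), fun j => hL _, fun j y hy => (hh _ hy).symm,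
    pos_iff_ne_zero.2 hI⟩


lemma mollify_unit (N : ℕ) (R : ℝ) : ∃ C : ℝ, 0 ≤ C ∧
    ∀ (g : EucSp N → ℝ) (δ : ℝ≥0), LipschitzWith δ g →
    ∃ φ : EucSp N → ℝ, ContDiff ℝ 1 φ ∧ LipschitzWith δ φ ∧ (∀ z, |g z - φ z| ≤ δ) ∧
      ∀ (x : EucSp N) (ℓ : EucSp N →L[ℝ] ℝ) (ω : ℝ),
        (∀ v ∈ closedBall (0 : EucSp N) (R + 1), |g (x + v) - g x - ℓ v| ≤ ω) →
        ∀ z ∈ closedBall x R, ∀ z' ∈ closedBall x R,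
          |φ z - φ z' - ℓ (z - z')| ≤ C * ω * ‖z - z'‖ := by
  let b : ContDiffBump (0 : EucSp N) := ⟨1 / 2, 1, by norm_num, by norm_num⟩
  let ψ : EucSp N → ℝ := b.normed volume
  have hψ1 : ContDiff ℝ 1 ψ := b.contDiff_normed (n := 1)
  have hψc : HasCompactSupport ψ := b.hasCompactSupport_normed
  have hψcont : Continuous ψ := b.continuous_normed
  have hψ0 : ∀ s, 0 ≤ ψ s := fun s => b.nonneg_normed s
  have hψi : ∫ s, ψ s = 1 := b.integral_normed
  have hψint : Integrable ψ := b.integrable_normed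
  have hψs : ∀ s, s ∉ ball (0 : EucSp N) 1 → ψ s = 0 := by
    intro s hs
    have : s ∉ Function.support ψ := by
      rw [show Function.support ψ = ball 0 1 from b.support_normed_eq]; exact hs
    simpa using this
  obtain ⟨Λ, hΛ⟩ := ContDiff.lipschitzWith_of_hasCompactSupport hψc hψ1 one_ne_zero
  refine ⟨Λ * volume.real (closedBall (0 : EucSp N) (R + 1)), by positivity, ?_⟩
  intro g δ hg
  have hI : ∀ (e : EucSp N → ℝ), Continuous e → ∀ z, Integrable (fun s => ψ s * e (z - s)) := by
    intro e he z
    exact (hψcont.mul (he.comp (continuous_const.sub continuous_id))).integrable_of_hasCompactSupport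
      hψc.mul_right
  let φ : EucSp N → ℝ := fun z => ∫ s, ψ s * g (z - s)
  have hφ1 : ContDiff ℝ 1 φ :=
    hψc.contDiff_convolution_left (n := 1) (ContinuousLinearMap.lsmul ℝ ℝ) hψ1
      (hg.continuous.locallyIntegrable (μ := volume))
  have hbd : ∀ (k : EucSp N → ℝ) (c : ℝ), (∀ s ∈ ball (0 : EucSp N) 1, |k s| ≤ c) →
      |∫ s, ψ s * k s| ≤ c := by
    intro k c hk
    rw [← Real.norm_eq_abs]
    refine (norm_integral_le_of_norm_le (hψint.mul_const c) (Eventually.of_forall fun s => ?_)).trans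
      (le_of_eq ?_)
    · by_cases hs : s ∈ ball (0 : EucSp N) 1
      · rw [norm_mul, Real.norm_of_nonneg (hψ0 s)]
        exact mul_le_mul_of_nonneg_left (hk s hs) (hψ0 s)
      · simp [hψs s hs]
    · rw [integral_mul_const, hψi, one_mul]
  refine ⟨φ, hφ1, ?_, ?_, ?_⟩
  · refine LipschitzWith.of_dist_le_mul fun z z' => ?_
    rw [Real.dist_eq]
    have : φ z - φ z' = ∫ s, ψ s * (g (z - s) - g (z' - s)) := by
      rw [← integral_sub (hI g hg.continuous z) (hI g hg.continuous z')]
      simp only [mul_sub]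
    rw [this]
    refine hbd _ _ fun s _ => ?_
    have := hg.dist_le_mul (z - s) (z' - s)
    rwa [dist_sub_right, Real.dist_eq] at this
  · intro z
    have : g z - φ z = ∫ s, ψ s * (g z - g (z - s)) := by
      simp only [mul_sub]
      rw [integral_sub (hψint.mul_const _) (hI g hg.continuous z), integral_mul_const, hψi, one_mul]
    rw [this]
    refine hbd _ _ fun s hs => ?_
    have := hg.dist_le_mul z (z - s)
    rw [dist_self_sub_right, Real.dist_eq] at this
    have hs' : ‖s‖ ≤ 1 := by simpa using (mem_ball.1 hs).le
    calc _ ≤ _ := this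
      _ ≤ δ * 1 := mul_le_mul_of_nonneg_left hs' δ.2
      _ = _ := mul_one _
  · intro x ℓ ω hω z hz z' hz'
    let e : EucSp N → ℝ := fun w => g w - g x - ℓ (w - x)
    have he : Continuous e := (hg.continuous.sub continuous_const).sub
      (ℓ.continuous.comp (continuous_id.sub continuous_const))
    have hω0 : ∀ w ∈ closedBall x (R + 1), |e w| ≤ ω := by
      intro w hw
      have := hω (w - x) (by simpa [dist_eq_norm] using hw)
      simpa [e] using this
    have hflip : ∀ z, ∫ s, ψ s * e (z - s) = ∫ w, ψ (z - w) * e w := by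
      intro z
      rw [← integral_sub_left_eq_self (fun s => ψ s * e (z - s)) volume z]
      simp
    have hIf : ∀ z, Integrable (fun w => ψ (z - w) * e w) := by
      intro z
      have := (hI e he z).comp_sub_left z
      simpa using this
    have h1 : φ z - φ z' - ℓ (z - z') = ∫ w, (ψ (z - w) - ψ (z' - w)) * e w := by
      simp only [sub_mul]
      rw [integral_sub (hIf z) (hIf z'), ← hflip, ← hflip, ← integral_sub (hI e he z) (hI e he z')]
      have h2 : ℓ (z - z') = ∫ s, ψ s * ℓ (z - z') := by rw [integral_mul_const, hψi, one_mul]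
      rw [h2]
      change (∫ s, ψ s * g (z - s)) - (∫ s, ψ s * g (z' - s)) - _ = _
      have hsub : Integrable (fun a => ψ a * g (z - a) - ψ a * g (z' - a)) :=
        (hI g hg.continuous z).sub (hI g hg.continuous z')
      rw [← integral_sub (hI g hg.continuous z) (hI g hg.continuous z'),
        ← integral_sub hsub (hψint.mul_const _)]
      congr 1
      ext s
      have h3 : ℓ (z - s - x) - ℓ (z' - s - x) = ℓ (z - z') := by
        rw [← map_sub]; congr 1; abel
      simp only [e]
      rw [← h3]; ring
    rw [h1, ← setIntegral_eq_integral_of_forall_compl_eq_zero (s := closedBall x (R + 1))]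
    · have h4 : ∀ w ∈ closedBall x (R + 1), ‖(ψ (z - w) - ψ (z' - w)) * e w‖ ≤
          Λ * ‖z - z'‖ * ω := by
        intro w hw
        rw [norm_mul]
        refine mul_le_mul ?_ (hω0 w hw) (norm_nonneg _) (by positivity)
        have := hΛ.dist_le_mul (z - w) (z' - w)
        rwa [dist_sub_right, dist_eq_norm, dist_eq_norm] at this
      have h5 := norm_setIntegral_le_of_norm_le_const (μ := volume)
        (s := closedBall x (R + 1)) measure_closedBall_lt_top h4
      rw [Real.norm_eq_abs] at h5
      refine h5.trans (le_of_eq ?_)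
      have : volume.real (closedBall x (R + 1)) = volume.real (closedBall (0 : EucSp N) (R + 1)) := by
        simp only [measureReal_def, Measure.addHaar_closedBall_center]
      rw [this]; ring
    · intro w hw
      have hz0 : ∀ y ∈ closedBall x R, ψ (y - w) = 0 := by
        intro y hy
        refine hψs _ fun hyw => hw ?_
        rw [mem_ball_zero_iff, ← dist_eq_norm] at hyw
        rw [mem_closedBall] at hy ⊢
        have := dist_triangle_left w x y
        linarith
      rw [hz0 z hz, hz0 z' hz', sub_self, zero_mul]

lemma mollify (N : ℕ) (R : ℝ) : ∃ C : ℝ, 0 ≤ C ∧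
    ∀ (g : EucSp N → ℝ) (δ : ℝ≥0), LipschitzWith δ g → ∀ t : ℝ, 0 < t →
    ∃ φ : EucSp N → ℝ, ContDiff ℝ 1 φ ∧ LipschitzWith δ φ ∧ (∀ z, |g z - φ z| ≤ δ * t) ∧
      ∀ (x : EucSp N) (ℓ : EucSp N →L[ℝ] ℝ) (ω : ℝ),
        (∀ v ∈ closedBall (0 : EucSp N) ((R + 1) * t), |g (x + v) - g x - ℓ v| ≤ ω * t) →
        ∀ z ∈ closedBall x (R * t), ∀ z' ∈ closedBall x (R * t),
          |φ z - φ z' - ℓ (z - z')| ≤ C * ω * ‖z - z'‖ := by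
  obtain ⟨C, hC, H⟩ := mollify_unit N R
  refine ⟨C, hC, fun g δ hg t ht => ?_⟩
  have hgt : LipschitzWith δ (fun z => t⁻¹ * g (t • z)) := by
    refine LipschitzWith.of_dist_le_mul fun z z' => ?_
    have := hg.dist_le_mul (t • z) (t • z')
    rw [dist_smul₀, Real.norm_of_nonneg ht.le, Real.dist_eq] at this
    rw [Real.dist_eq, ← mul_sub, abs_mul, abs_of_pos (inv_pos.2 ht), inv_mul_le_iff₀ ht]
    linarith
  obtain ⟨φ, h1, h2, h3, h4⟩ := H _ δ hgt
  have hts : ∀ z : EucSp N, t • t⁻¹ • z = z := fun z => smul_inv_smul₀ ht.ne' z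
  refine ⟨fun z => t * φ (t⁻¹ • z), ?_, ?_, ?_, ?_⟩
  · exact contDiff_const.mul (h1.comp (contDiff_const_smul _))
  · refine LipschitzWith.of_dist_le_mul fun z z' => ?_
    have := h2.dist_le_mul (t⁻¹ • z) (t⁻¹ • z')
    rw [dist_smul₀, Real.norm_of_nonneg (inv_pos.2 ht).le, Real.dist_eq] at this
    rw [Real.dist_eq, ← mul_sub, abs_mul, abs_of_pos ht]
    calc _ ≤ t * (δ * (t⁻¹ * dist z z')) := mul_le_mul_of_nonneg_left this ht.le
      _ = _ := by field_simp
  · intro z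
    have := h3 (t⁻¹ • z)
    simp only [hts] at this
    have e : g z - t * φ (t⁻¹ • z) = t * (t⁻¹ * g z - φ (t⁻¹ • z)) := by field_simp
    rw [e, abs_mul, abs_of_pos ht, mul_comm]
    exact mul_le_mul_of_nonneg_right this ht.le
  · intro x ℓ ω hω z hz z' hz'
    have hb : ∀ y ∈ closedBall x (R * t), t⁻¹ • y ∈ closedBall (t⁻¹ • x) R := by
      intro y hy
      rw [mem_closedBall] at hy ⊢
      rw [dist_smul₀, Real.norm_of_nonneg (inv_pos.2 ht).le, inv_mul_le_iff₀ ht]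
      linarith
    have := h4 (t⁻¹ • x) ℓ ω ?_ _ (hb z hz) _ (hb z' hz')
    · rw [← smul_sub, map_smul, norm_smul, Real.norm_of_nonneg (inv_pos.2 ht).le,
        smul_eq_mul] at this
      have e : t * φ (t⁻¹ • z) - t * φ (t⁻¹ • z') - ℓ (z - z') =
          t * (φ (t⁻¹ • z) - φ (t⁻¹ • z') - t⁻¹ * ℓ (z - z')) := by field_simp
      rw [e, abs_mul, abs_of_pos ht]
      calc _ ≤ t * (C * ω * (t⁻¹ * ‖z - z'‖)) := mul_le_mul_of_nonneg_left this ht.le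
        _ = _ := by field_simp
    · intro v hv
      have h5 := hω (t • v) (by
        rw [mem_closedBall_zero_iff] at hv ⊢
        rw [norm_smul, Real.norm_of_nonneg ht.le]
        nlinarith)
      simp only [smul_add, hts]
      have e : t⁻¹ * g (x + t • v) - t⁻¹ * g x - ℓ v =
          t⁻¹ * (g (x + t • v) - g x - ℓ (t • v)) := by
        rw [map_smul, smul_eq_mul]; field_simp
      rw [e, abs_mul, abs_of_pos (inv_pos.2 ht), inv_mul_le_iff₀ ht]
      linarith


lemma unif_diff {N : ℕ} {h : EucSp N → ℝ} {δ : ℝ≥0} (hh : LipschitzWith δ h)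
    {K : Set (EucSp N)} (hK : MeasurableSet K) (hKf : volume K ≠ ∞) {ω : ℝ} (hω : 0 < ω)
    {η : ℝ≥0∞} (hη : η ≠ 0) :
    ∃ K' ⊆ K, MeasurableSet K' ∧ volume (K \ K') ≤ η ∧ ∃ s > (0 : ℝ), ∀ x ∈ K',
      ∀ v ∈ ball (0 : EucSp N) s, |h (x + v) - h x - fderiv ℝ h x v| ≤ ω * ‖v‖ := by
  let E : ℕ → Set (EucSp N) := fun k => {x | ∀ v ∈ ball (0 : EucSp N) (1 / ((k : ℝ) + 1)),
    |h (x + v) - h x - fderiv ℝ h x v| ≤ ω * ‖v‖}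
  have hEm : ∀ k, MeasurableSet (E k) := by
    intro k
    obtain ⟨D, hDc, hDd⟩ := TopologicalSpace.exists_countable_dense (EucSp N)
    have : E k = ⋂ v ∈ ball (0 : EucSp N) (1 / ((k : ℝ) + 1)) ∩ D,
        {x | |h (x + v) - h x - fderiv ℝ h x v| ≤ ω * ‖v‖} := by
      ext x
      simp only [E, mem_ofPred_eq, mem_iInter]
      constructor
      · exact fun H v hv => H v hv.1
      · intro H v hv
        have hcl : IsClosed {v | |h (x + v) - h x - fderiv ℝ h x v| ≤ ω * ‖v‖} := by
          have hc := hh.continuous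
          exact isClosed_le (by fun_prop) (by fun_prop)
        have h1 := hDd.open_subset_closure_inter (isOpen_ball (x := (0 : EucSp N))
          (ε := 1 / ((k : ℝ) + 1))) hv
        exact closure_minimal (fun w hw => H w hw) hcl h1
    rw [this]
    refine MeasurableSet.biInter (hDc.mono inter_subset_right) fun v _ => ?_
    have hc := hh.continuous
    have h1 : Measurable fun x => fderiv ℝ h x v := measurable_fderiv_apply_const ℝ h v
    have h2 : Measurable fun x => h (x + v) := by fun_prop
    exact measurableSet_le (((h2.sub hc.measurable).sub h1).abs) measurable_const
  have hmono : Antitone fun k => K \ E k := by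
    intro k l hkl x hx
    refine ⟨hx.1, fun hxk => hx.2 fun v hv => hxk v ?_⟩
    refine ball_subset_ball ?_ hv
    apply one_div_le_one_div_of_le (by positivity)
    gcongr
  have hlim := tendsto_measure_iInter_atTop (μ := volume) (s := fun k => K \ E k)
    (fun k => (hK.diff (hEm k)).nullMeasurableSet) hmono
    ⟨0, ((measure_mono sdiff_subset).trans_lt hKf.lt_top).ne⟩
  have hz : volume (⋂ k, K \ E k) = 0 := by
    refine measure_mono_null ?_ (ae_iff.1 (hh.ae_differentiableAt (μ := volume)))
    intro x hx hd
    have h1 := hasFDerivAt_iff_isLittleO_nhds_zero.1 hd.hasFDerivAt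
    have h1 : (fun v => h (x + v) - h x - fderiv ℝ h x v) =o[𝓝 0] fun v => v := h1
    have h2 := h1.def hω
    obtain ⟨s, hs, hs'⟩ := Metric.eventually_nhds_iff_ball.1 h2
    obtain ⟨k, hk⟩ := exists_nat_one_div_lt hs
    refine (mem_iInter.1 hx k).2 fun v hv => ?_
    have := hs' v (ball_subset_ball hk.le hv)
    simpa using this
  rw [hz] at hlim
  obtain ⟨k, hk⟩ := (hlim.eventually_le_const (pos_iff_ne_zero.2 hη)).exists
  refine ⟨K ∩ E k, inter_subset_left, hK.inter (hEm k), ?_, 1 / ((k : ℝ) + 1), by positivity,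
    fun x hx => hx.2⟩
  rwa [sdiff_self_inter]

lemma lusin_step {N : ℕ} {h : EucSp N → ℝ} {δ : ℝ≥0} (hh : LipschitzWith δ h)
    {K : Set (EucSp N)} (hK : MeasurableSet K) (hKf : volume K ≠ ∞) {ε : ℝ≥0} (hε : 0 < ε)
    {η : ℝ≥0∞} (hη : η ≠ 0) :
    ∃ K' ⊆ K, MeasurableSet K' ∧ volume (K \ K') ≤ η ∧ ∃ φ : EucSp N → ℝ,
      ContDiff ℝ 1 φ ∧ LipschitzWith δ φ ∧ (∀ x, |h x - φ x| ≤ ε) ∧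
      LipschitzOnWith ε (fun x => h x - φ x) K' := by
  have hε' : (0 : ℝ) < ε := hε
  have hδ' : (0 : ℝ) ≤ δ := δ.2
  set R : ℝ := 2 * δ / ε with hR
  have hR0 : 0 ≤ R := by positivity
  obtain ⟨C, hC, H⟩ := mollify N R
  set ω : ℝ := ε / (2 * (C + 1) * (R + 1)) with hωd
  have hω : 0 < ω := by positivity
  have hω1 : ω ≤ ε / 2 := by
    rw [hωd]
    apply div_le_div_of_nonneg_left hε'.le (by norm_num)
    nlinarith [mul_nonneg hC hR0]
  have hω2 : C * (ω * (R + 1)) ≤ ε / 2 := by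
    have : ω * (R + 1) = ε / (2 * (C + 1)) := by rw [hωd]; field_simp
    rw [this, mul_div_assoc', div_le_div_iff₀ (by positivity) (by norm_num)]
    nlinarith
  obtain ⟨K', hK'K, hK'm, hvol, s, hs, hunif⟩ := unif_diff hh hK hKf hω hη
  set t : ℝ := min (s / (2 * (R + 1))) (ε / (δ + 1)) with ht
  have ht0 : 0 < t := lt_min (by positivity) (by positivity)
  have ht1 : (R + 1) * t < s := by
    have : t ≤ s / (2 * (R + 1)) := min_le_left _ _
    rw [le_div_iff₀ (by positivity)] at this
    nlinarith [mul_pos (show 0 < R + 1 by positivity) ht0]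
  have ht2 : δ * t ≤ ε := by
    have : t ≤ ε / (δ + 1) := min_le_right _ _
    rw [le_div_iff₀ (by positivity)] at this
    nlinarith
  obtain ⟨φ, h1, h2, h3, h4⟩ := H h δ hh t ht0
  refine ⟨K', hK'K, hK'm, hvol, φ, h1, h2, fun x => (h3 x).trans ht2, ?_⟩
  refine LipschitzOnWith.of_dist_le_mul fun y hy x hx => ?_
  rw [Real.dist_eq, dist_eq_norm]
  by_cases hxy : ‖y - x‖ ≤ R * t
  · have h5 := h4 x (fderiv ℝ h x) (ω * (R + 1)) ?_ y (by simpa [dist_eq_norm] using hxy) x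
      (mem_closedBall_self (by positivity))
    · have h6 := hunif x hx (y - x) (by rw [mem_ball_zero_iff]; nlinarith)
      rw [add_sub_cancel] at h6
      have h7 : h y - φ y - (h x - φ x) = (h y - h x - fderiv ℝ h x (y - x)) -
        (φ y - φ x - fderiv ℝ h x (y - x)) := by ring
      rw [h7]
      refine (abs_sub _ _).trans ?_
      have := norm_nonneg (y - x)
      nlinarith
    · intro v hv
      rw [mem_closedBall_zero_iff] at hv
      refine (hunif x hx v (by rw [mem_ball_zero_iff]; linarith)).trans ?_
      nlinarith
  · push Not at hxy
    have h7 : h y - φ y - (h x - φ x) = (h y - φ y) - (h x - φ x) := by ring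
    rw [h7]
    refine (abs_sub _ _).trans ?_
    have h8 : (ε : ℝ) * (R * t) = 2 * (δ * t) := by rw [hR]; field_simp
    have := h3 x
    have := h3 y
    nlinarith


lemma lusin_next {N : ℕ} {h : EucSp N → ℝ} {δ : ℝ≥0} (hh : LipschitzWith δ h)
    {K : Set (EucSp N)} (hK : MeasurableSet K) (hKf : volume K ≠ ∞) {ε : ℝ≥0} (hε : 0 < ε)
    {η : ℝ≥0∞} (hη : η ≠ 0) :
    ∃ (h' : EucSp N → ℝ) (K' : Set (EucSp N)) (φ : EucSp N → ℝ),
      LipschitzWith ε h' ∧ MeasurableSet K' ∧ volume K' ≠ ∞ ∧ K' ⊆ K ∧ volume (K \ K') ≤ η ∧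
      ContDiff ℝ 1 φ ∧ LipschitzWith δ φ ∧ ∀ x ∈ K', h x - φ x = h' x ∧ |h' x| ≤ ε := by
  obtain ⟨K', h1, h2, h3, φ, h4, h5, h6, h7⟩ := lusin_step hh hK hKf hε hη
  obtain ⟨h', h8, h9⟩ := h7.extend_real
  refine ⟨h', K', φ, h8, h2, ((measure_mono h1).trans_lt hKf.lt_top).ne, h1, h3, h4, h5,
    fun x hx => ⟨h9 hx, ?_⟩⟩
  rw [← h9 hx]; exact h6 x

lemma lusin_c1 {N : ℕ} {h : EucSp N → ℝ} {L : ℝ≥0} (hh : LipschitzWith L h)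
    {E : Set (EucSp N)} (hE : MeasurableSet E) (hEf : volume E ≠ ∞)
    {η : ℝ≥0∞} (hη : η ≠ 0) :
    ∃ K ⊆ E, MeasurableSet K ∧ volume (E \ K) ≤ η ∧ ∃ g : EucSp N → ℝ,
      ContDiff ℝ 1 g ∧ ∀ x ∈ K, g x = h x := by
  obtain ⟨δ, hδ0, hδs⟩ : ∃ δ : ℕ → ℝ≥0, δ 0 = L ∧ ∀ k, δ (k + 1) = (1 / 2) ^ k :=
    ⟨fun k => Nat.casesOn k L (fun j => (1 / 2) ^ j), rfl, fun k => rfl⟩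
  have hδp : ∀ k, 0 < δ (k + 1) := fun k => by rw [hδs]; positivity
  have hδsum : Summable fun k : ℕ => ((δ k : ℝ≥0) : ℝ) := by
    rw [← summable_nat_add_iff 1]
    simp only [hδs]
    push_cast
    exact summable_geometric_two
  obtain ⟨ηs, hη0, hηs⟩ := ENNReal.exists_pos_sum_of_countable' hη ℕ
  let S : ℕ → Type := fun k => {p : (EucSp N → ℝ) × Set (EucSp N) //
    LipschitzWith (δ k) p.1 ∧ MeasurableSet p.2 ∧ volume p.2 ≠ ∞}
  have step : ∀ k (p : S k), ∃ (q : S (k + 1)) (φ : EucSp N → ℝ),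
      q.1.2 ⊆ p.1.2 ∧ volume (p.1.2 \ q.1.2) ≤ ηs k ∧
      ContDiff ℝ 1 φ ∧ LipschitzWith (δ k) φ ∧
      ∀ x ∈ q.1.2, p.1.1 x - φ x = q.1.1 x ∧ |q.1.1 x| ≤ δ (k + 1) := by
    intro k p
    obtain ⟨h', K', φ, h1, h2, h3, h4, h5, h6, h7, h8⟩ :=
      lusin_next p.2.1 p.2.2.1 p.2.2.2 (hδp k) (hη0 k).ne'
    exact ⟨⟨(h', K'), h1, h2, h3⟩, φ, h4, h5, h6, h7, h8⟩
  choose nxt φ' hsub hvol hC1 hLip hval using step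
  let sq : ∀ k, S k := fun k => Nat.rec ⟨(h, E), hδ0 ▸ hh, hE, hEf⟩ (fun k p => nxt k p) k
  have hsq : ∀ k, sq (k + 1) = nxt k (sq k) := fun k => rfl
  let H : ℕ → EucSp N → ℝ := fun k => (sq k).1.1
  let Ks : ℕ → Set (EucSp N) := fun k => (sq k).1.2
  let φ : ℕ → EucSp N → ℝ := fun k => φ' k (sq k)
  have hφC : ∀ k, ContDiff ℝ 1 (φ k) := fun k => hC1 k (sq k)
  have hφL : ∀ k, LipschitzWith (δ k) (φ k) := fun k => hLip k (sq k)
  have hKsub : ∀ k, Ks (k + 1) ⊆ Ks k := fun k => hsub k (sq k)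
  have hKvol : ∀ k, volume (Ks k \ Ks (k + 1)) ≤ ηs k := fun k => hvol k (sq k)
  have hHv : ∀ k, ∀ x ∈ Ks (k + 1), H k x - φ k x = H (k + 1) x ∧ |H (k + 1) x| ≤ δ (k + 1) :=
    fun k => hval k (sq k)
  have hK0 : Ks 0 = E := rfl
  have hH0 : H 0 = h := rfl
  set K : Set (EucSp N) := ⋂ k, Ks k with hKdef
  have hKE : K ⊆ E := iInter_subset Ks 0
  have hKmeas : MeasurableSet K := MeasurableSet.iInter fun k => (sq k).2.2.1
  have hKv : volume (E \ K) ≤ η := by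
    have : E \ K ⊆ ⋃ k, Ks k \ Ks (k + 1) := by
      intro x hx
      by_contra hcon
      refine hx.2 (mem_iInter.2 fun k => ?_)
      induction k with
      | zero => exact hx.1
      | succ k ih =>
        by_contra h1
        exact hcon (mem_iUnion.2 ⟨k, ih, h1⟩)
    calc _ ≤ _ := measure_mono this
      _ ≤ ∑' k, volume (Ks k \ Ks (k + 1)) := measure_iUnion_le _
      _ ≤ ∑' k, ηs k := ENNReal.tsum_le_tsum hKvol
      _ ≤ η := hηs.le
  refine ⟨K, hKE, hKmeas, hKv, ?_⟩
  rcases K.eq_empty_or_nonempty with hemp | ⟨x0, hx0⟩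
  · exact ⟨fun _ => 0, contDiff_const, by simp [hemp]⟩
  have hxK : ∀ x ∈ K, ∀ k, x ∈ Ks k := fun x hx k => mem_iInter.1 hx k
  have hsumm : ∀ x ∈ K, Summable fun k => φ k x := by
    intro x hx
    rw [← summable_nat_add_iff 1]
    refine Summable.of_norm_bounded (g := fun k => (δ (k + 1) : ℝ) + δ (k + 1 + 1))
      (((summable_nat_add_iff 1).2 hδsum).add
        ((summable_nat_add_iff 1).2 ((summable_nat_add_iff 1).2 hδsum))) fun k => ?_
    have h1 := hHv (k + 1) x (hxK x hx (k + 1 + 1))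
    have h2 := hHv k x (hxK x hx (k + 1))
    have : φ (k + 1) x = H (k + 1) x - H (k + 1 + 1) x := by linarith [h1.1]
    rw [this, Real.norm_eq_abs]
    exact (abs_sub _ _).trans (add_le_add h2.2 h1.2)
  have hφd : ∀ k x, HasFDerivAt (φ k) (fderiv ℝ (φ k) x) x := fun k x =>
    ((hφC k).differentiable one_ne_zero x).hasFDerivAt
  have hφb : ∀ k x, ‖fderiv ℝ (φ k) x‖ ≤ δ k := fun k x =>
    norm_fderiv_le_of_lipschitz ℝ (hφL k)
  have hg : ∀ x, HasFDerivAt (fun y => ∑' k, φ k y) (∑' k, fderiv ℝ (φ k) x) x := fun x =>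
    hasFDerivAt_tsum hδsum hφd hφb (hsumm x0 hx0) x
  refine ⟨fun y => ∑' k, φ k y, ?_, ?_⟩
  · rw [contDiff_one_iff_fderiv]
    refine ⟨fun x => (hg x).differentiableAt, ?_⟩
    have : fderiv ℝ (fun y => ∑' k, φ k y) = fun x => ∑' k, fderiv ℝ (φ k) x :=
      funext fun x => (hg x).fderiv
    rw [this]
    exact continuous_tsum (fun k => (hφC k).continuous_fderiv one_ne_zero) hδsum hφb
  · intro x hx
    have hpart : ∀ k, ∑ j ∈ Finset.range k, φ j x = h x - H k x := by
      intro k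
      induction k with
      | zero => simp [hH0]
      | succ k ih =>
        rw [Finset.sum_range_succ, ih]
        linarith [(hHv k x (hxK x hx (k + 1))).1]
    have h1 := (hsumm x hx).hasSum.tendsto_sum_nat
    have h2 : Tendsto (fun k => H (k + 1) x) atTop (𝓝 0) := by
      refine squeeze_zero_norm (fun k => (hHv k x (hxK x hx (k + 1))).2) ?_
      exact ((summable_nat_add_iff 1).2 hδsum).tendsto_atTop_zero
    have h3 : Tendsto (fun k => ∑ j ∈ Finset.range (k + 1), φ j x) atTop (𝓝 (h x)) := by
      simp only [hpart]
      simpa using (tendsto_const_nhds (x := h x)).sub h2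
    exact tendsto_nhds_unique ((tendsto_add_atTop_iff_nat 1).2 h1) h3


lemma local_diffeo {k : ℕ} {G : EucSp k → EucSp k} (hG : ContDiff ℝ 1 G) (x0 : EucSp k)
    (hinj : ∀ v, fderiv ℝ G x0 v = 0 → v = 0) :
    ∃ (U : Set (EucSp k)) (Ginv : EucSp k → EucSp k), x0 ∈ U ∧ IsBiLipC1DiffeoOn G Ginv U := by
  have hinj' : Function.Injective (fderiv ℝ G x0).toLinearMap := by
    rw [← LinearMap.ker_eq_bot, LinearMap.ker_eq_bot']
    exact hinj
  let e : EucSp k ≃L[ℝ] EucSp k :=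
    (LinearEquiv.ofInjectiveEndo (fderiv ℝ G x0).toLinearMap hinj').toContinuousLinearEquiv
  have he : HasFDerivAt G (e : EucSp k →L[ℝ] EucSp k) x0 := by
    have h1 := (hG.differentiable one_ne_zero x0).hasFDerivAt
    have h2 : (e : EucSp k →L[ℝ] EucSp k) = fderiv ℝ G x0 := by
      ext v; rfl
    rwa [h2]
  let P := hG.contDiffAt.toOpenPartialHomeomorph G he one_ne_zero
  have hP : ∀ x, P x = G x := fun x => rfl
  have hx0s : x0 ∈ P.source := hG.contDiffAt.mem_toOpenPartialHomeomorph_source he one_ne_zero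
  have hsx : P.symm (G x0) = x0 := P.left_inv hx0s
  have hx0t : G x0 ∈ P.target := P.map_source hx0s
  have hsymm : ContDiffAt ℝ 1 P.symm (G x0) :=
    P.contDiffAt_symm (f₀' := e) hx0t (by rw [hsx]; exact he) (by rw [hsx]; exact hG.contDiffAt)
  obtain ⟨Λ1, t1, ht1, hL1⟩ := (hG.contDiffAt (x := x0)).exists_lipschitzOnWith
  obtain ⟨Λ2, t2, ht2, hL2⟩ := hsymm.exists_lipschitzOnWith
  have hev := hsymm.eventually (by simp)
  obtain ⟨V, hVsub, hVo, hxV⟩ := _root_.mem_nhds_iff.1 (inter_mem ht2 hev)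
  obtain ⟨W, hWsub, hWo, hxW⟩ := _root_.mem_nhds_iff.1 ht1
  let U : Set (EucSp k) := P.source ∩ (G ⁻¹' V ∩ W)
  have hUo : IsOpen U := P.open_source.inter ((hVo.preimage hG.continuous).inter hWo)
  have hUs : U ⊆ P.source := inter_subset_left
  have hGUV : G '' U ⊆ V := by
    rintro _ ⟨x, hx, rfl⟩
    exact hx.2.1
  have hinv : ∀ x ∈ U, P.symm (G x) = x := fun x hx => P.left_inv (hUs hx)
  refine ⟨U, P.symm, ⟨hx0s, hxV, hxW⟩, hUo, P.isOpen_image_of_subset_source hUo hUs, hinv, ?_,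
    hG.contDiffOn, ?_, max Λ1 Λ2, ?_, ?_⟩
  · rintro _ ⟨x, hx, rfl⟩
    rw [hinv x hx]
  · intro y hy
    exact ContDiffAt.contDiffWithinAt (hVsub (hGUV hy)).2
  · exact (hL1.mono fun x hx => hWsub hx.2.2).weaken (le_max_left _ _)
  · exact (hL2.mono fun y hy => (hVsub (hGUV hy)).1).weaken (le_max_right _ _)

lemma extend_coords {n m : ℕ} (l : Fin n → EucSp (n + m) →L[ℝ] ℝ) (hl : LinearIndependent ℝ l) :
    ∃ p : Fin m → EucSp (n + m) →L[ℝ] ℝ,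
      ∀ v, (∀ i, l i v = 0) → (∀ j, p j v = 0) → v = 0 := by
  let l' : Fin n → Module.Dual ℝ (EucSp (n + m)) := fun i => (l i).toLinearMap
  have hl' : LinearIndependent ℝ l' := by
    rw [Fintype.linearIndependent_iff] at hl ⊢
    intro c hc
    refine hl c ?_
    ext v
    have := LinearMap.congr_fun hc v
    simpa [l'] using this
  let S : Subspace ℝ (Module.Dual ℝ (EucSp (n + m))) := Submodule.span ℝ (range l')
  let W := Submodule.dualCoannihilator S
  have hS : Module.finrank ℝ S = n := by
    have := finrank_span_eq_card hl'
    simpa using this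
  have hW : Module.finrank ℝ W = m := by
    have := Subspace.finrank_add_finrank_dualCoannihilator_eq S
    rw [hS] at this
    simp only [finrank_euclideanSpace, Fintype.card_fin] at this
    exact Nat.add_left_cancel this
  let b := Module.finBasisOfFinrankEq ℝ W hW
  obtain ⟨r, hr⟩ := LinearMap.exists_leftInverse_of_injective W.subtype (by simp)
  refine ⟨fun j => ((b.coord j).comp r).toContinuousLinearMap, fun v hv hp => ?_⟩
  have hvW : v ∈ W := by
    rw [Submodule.mem_dualCoannihilator]
    intro φ hφ
    induction hφ using Submodule.span_induction with
    | mem x hx => obtain ⟨i, rfl⟩ := hx; exact hv i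
    | zero => rfl
    | add x y _ _ hx hy => rw [LinearMap.add_apply, hx, hy, add_zero]
    | smul a x _ hx => rw [LinearMap.smul_apply, hx, smul_zero]
  have hrv : r v = ⟨v, hvW⟩ := LinearMap.congr_fun hr ⟨v, hvW⟩
  have h0 : r v = 0 := b.ext_elem fun j => by
    have := hp j
    simpa using this
  rw [hrv] at h0
  exact congrArg Subtype.val h0

lemma fderiv_ae_eq {N : ℕ} {g h : EucSp N → ℝ} {K : Set (EucSp N)} (hK : MeasurableSet K)
    (hg : ∀ x ∈ K, DifferentiableAt ℝ g x) (hh : ∀ x ∈ K, DifferentiableAt ℝ h x)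
    (heq : ∀ x ∈ K, g x = h x) :
    ∀ᵐ x ∂(volume.restrict K), fderiv ℝ g x = fderiv ℝ h x := by
  rcases Nat.eq_zero_or_pos N with rfl | hN
  · exact Eventually.of_forall fun x => by
      ext v
      rw [Subsingleton.elim v 0, map_zero, map_zero]
  let v : EucSp N := EuclideanSpace.single ⟨0, hN⟩ 1
  have hv : v ≠ 0 := by
    intro h0
    have := congrArg (fun w : EucSp N => w ⟨0, hN⟩) h0
    simp [v] at this
  have happ : ApproximatesLinearOn (fun x => (g x - h x) • v) (0 : EucSp N →L[ℝ] EucSp N) K 0 := by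
    intro x hx y hy
    simp [heq x hx, heq y hy]
  have := happ.norm_fderiv_sub_le volume hK
    (fun x => (fderiv ℝ g x - fderiv ℝ h x).smulRight v) (fun x hx =>
      (((hg x hx).hasFDerivAt.sub (hh x hx).hasFDerivAt).smul_const v).hasFDerivWithinAt)
  filter_upwards [this] with x hx
  rw [sub_zero, nonpos_iff_eq_zero, nnnorm_eq_zero] at hx
  rw [← sub_eq_zero]
  ext w
  have h1 := congrArg (fun T : EucSp N →L[ℝ] EucSp N => T w) hx
  simp only [ContinuousLinearMap.smulRight_apply, _root_.zero_apply,
    smul_eq_zero, hv, or_false] at h1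
  exact h1


lemma euc_apply {k l : ℕ} {G : EucSp k → EucSp l} (hG : Differentiable ℝ G) (x v : EucSp k)
    (i : Fin l) : fderiv ℝ G x v i = fderiv ℝ (fun y => G y i) x v := by
  have h1 := (EuclideanSpace.proj i : EucSp l →L[ℝ] ℝ).hasFDerivAt.comp x
    (hG x).hasFDerivAt
  have h2 : HasFDerivAt (fun y => G y i) _ x := h1
  rw [h2.fderiv]
  rfl

/-- Theorem, part (B): under the density hypothesis there are a set
`K ⊆ A` of positive measure, an open `U ⊇ K`, a bi-Lipschitz `C¹`-diffeomorphism
`G : U → G(U)` and a map `π : X → ℝ^n` which is `√n`-Lipschitz (and `1`-Lipschitz into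
`ℝ^n` with the max norm) such that `π ∘ f ∘ G⁻¹` is the projection onto the first `n`
coordinates on `G(K)`. -/
theorem stmt1 {n m : ℕ} {X : Type*} [MetricSpace X]
    (A : Set (EucSp (n + m))) (hA : MeasurableSet A) (hApos : 0 < volume A)
    (f : EucSp (n + m) → X) (hf : ∃ L : ℝ≥0, LipschitzOnWith L f A)
    (hdens : 0 < volume {x ∈ A | 0 < upperDensity n f A x}) :
    ∃ (K : Set (EucSp (n + m))) (U : Set (EucSp (n + m)))
      (G Ginv : EucSp (n + m) → EucSp (n + m)) (π : X → EucSp n),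
      K ⊆ A ∧ 0 < volume K ∧ K ⊆ U ∧ IsBiLipC1DiffeoOn G Ginv U ∧
      LipschitzWith (NNReal.sqrt n) π ∧
      (∀ a b : X, ∀ i : Fin n, |π a i - π b i| ≤ dist a b) ∧
      ∀ z ∈ G '' K, ∀ i : Fin n, π (f (Ginv z)) i = z (Fin.castAdd m i) := by
  obtain ⟨L, hf⟩ := hf
  obtain ⟨q, F, hFL, hFA, hD⟩ := exists_indep A f hf hdens
  set D : Set (EucSp (n + m)) := {x ∈ A | (∀ j, DifferentiableAt ℝ (F j) x) ∧
    LinearIndependent ℝ (fun j => fderiv ℝ (F j) x)} with hDdef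
  have hDm : MeasurableSet D := by
    have h1 : MeasurableSet {x | ∀ j, DifferentiableAt ℝ (F j) x} := by
      have : {x | ∀ j, DifferentiableAt ℝ (F j) x} = ⋂ j, {x | DifferentiableAt ℝ (F j) x} := by
        ext x; simp
      rw [this]
      exact MeasurableSet.iInter fun j => measurableSet_of_differentiableAt ℝ (F j)
    have h2 : Measurable fun x => (fun j => fderiv ℝ (F j) x) :=
      measurable_pi_lambda _ fun j => measurable_fderiv ℝ (F j)
    have h3 : MeasurableSet {x | LinearIndependent ℝ (fun j => fderiv ℝ (F j) x)} :=
      h2 (isOpen_setOfPred_linearIndependent (𝕜 := ℝ) (ι := Fin n)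
        (E := EucSp (n + m) →L[ℝ] ℝ)).measurableSet
    exact hA.inter (h1.inter h3)
  obtain ⟨x1, hx1, hx1'⟩ := exists_mem_forall_mem_nhdsWithin_pos_measure (μ := volume) hD.ne'
  have hEpos := hx1' _ (inter_mem_nhdsWithin D (ball_mem_nhds x1 one_pos))
  set E : Set (EucSp (n + m)) := D ∩ ball x1 1 with hEdef
  have hEm : MeasurableSet E := hDm.inter measurableSet_ball
  have hEf : volume E ≠ ∞ := ((measure_mono inter_subset_right).trans_lt measure_ball_lt_top).ne
  obtain ⟨η, hη0, hηs⟩ := ENNReal.exists_pos_sum_of_countable' hEpos.ne' (Fin n)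
  have hlus := fun j => lusin_c1 (hFL j) hEm hEf (hη0 j).ne'
  choose Kj hKjE hKjm hKjv g hgC hgF using hlus
  set K : Set (EucSp (n + m)) := E ∩ ⋂ j, Kj j with hKdef
  have hKm : MeasurableSet K := hEm.inter (MeasurableSet.iInter hKjm)
  have hKD : ∀ x ∈ K, x ∈ D := fun x hx => hx.1.1
  have hKj : ∀ x ∈ K, ∀ j, x ∈ Kj j := fun x hx j => mem_iInter.1 hx.2 j
  have hK0 : volume K ≠ 0 := by
    intro h0
    have h1 : E ⊆ K ∪ ⋃ j, E \ Kj j := by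
      intro x hx
      by_cases h : ∀ j, x ∈ Kj j
      · exact Or.inl ⟨hx, mem_iInter.2 h⟩
      · push Not at h
        obtain ⟨j, hj⟩ := h
        exact Or.inr (mem_iUnion.2 ⟨j, hx, hj⟩)
    have h2 : volume E ≤ ∑' j, η j := by
      calc volume E ≤ volume K + volume (⋃ j, E \ Kj j) :=
            (measure_mono h1).trans (measure_union_le _ _)
        _ = volume (⋃ j, E \ Kj j) := by rw [h0, zero_add]
        _ ≤ ∑' j, volume (E \ Kj j) := measure_iUnion_le _
        _ ≤ _ := ENNReal.tsum_le_tsum hKjv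
    exact absurd hηs (not_lt.2 h2)
  have hgd : ∀ j, Differentiable ℝ (g j) := fun j => (hgC j).differentiable one_ne_zero
  have hae : ∀ᵐ x ∂(volume.restrict K), ∀ j, fderiv ℝ (g j) x = fderiv ℝ (F j) x := by
    rw [ae_all_iff]
    intro j
    exact fderiv_ae_eq hKm (fun x _ => hgd j x) (fun x hx => (hKD x hx).2.1 j)
      fun x hx => hgF j x (hKj x hx j)
  rw [ae_restrict_iff' hKm] at hae
  set K2 : Set (EucSp (n + m)) := {x ∈ K | ∀ j, fderiv ℝ (g j) x = fderiv ℝ (F j) x} with hK2def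
  have hK20 : volume K2 ≠ 0 := by
    intro h0
    refine hK0 (measure_mono_null ?_ (measure_union_null h0 (ae_iff.1 hae)))
    intro x hx
    by_cases h : ∀ j, fderiv ℝ (g j) x = fderiv ℝ (F j) x
    · exact Or.inl ⟨hx, h⟩
    · exact Or.inr fun h' => h (h' hx)
  obtain ⟨x0, hx0, hx0'⟩ := exists_mem_forall_mem_nhdsWithin_pos_measure (μ := volume) hK20
  have hli : LinearIndependent ℝ (fun j => fderiv ℝ (g j) x0) := by
    have h1 := (hKD x0 hx0.1).2.2
    have h2 : (fun j => fderiv ℝ (g j) x0) = fun j => fderiv ℝ (F j) x0 := funext hx0.2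
    rw [h2]; exact h1
  obtain ⟨p, hp⟩ := extend_coords _ hli
  let G : EucSp (n + m) → EucSp (n + m) := fun x =>
    WithLp.toLp 2 (Fin.append (fun i => g i x) (fun j => p j x))
  have hGl : ∀ x (i : Fin n), G x (Fin.castAdd m i) = g i x := fun x i => by simp [G]
  have hGr : ∀ x (j : Fin m), G x (Fin.natAdd n j) = p j x := fun x j => by simp [G]
  have hGC : ContDiff ℝ 1 G := by
    rw [contDiff_euclidean]
    intro i
    refine Fin.addCases (fun i => ?_) (fun j => ?_) i
    · simp only [hGl]; exact hgC i
    · simp only [hGr]; exact (p j).contDiff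
  have hGd : Differentiable ℝ G := hGC.differentiable one_ne_zero
  obtain ⟨U, Ginv, hx0U, hU⟩ := local_diffeo hGC x0 (by
    intro v hv
    refine hp v (fun i => ?_) (fun j => ?_)
    · have h1 := euc_apply hGd x0 v (Fin.castAdd m i)
      simp only [hGl] at h1
      rw [← h1, hv]; rfl
    · have h1 := euc_apply hGd x0 v (Fin.natAdd n j)
      simp only [hGr] at h1
      have h2 : fderiv ℝ (fun y => p j y) x0 = p j := (p j).fderiv
      rw [h2] at h1
      rw [← h1, hv]; rfl)
  have hcoord : ∀ a b : X, ∀ i : Fin n, |dist a (q i) - dist b (q i)| ≤ dist a b :=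
    fun a b i => abs_dist_sub_le a b (q i)
  refine ⟨K2 ∩ U, U, G, Ginv, fun a => WithLp.toLp 2 (fun i => dist a (q i)), ?_, ?_,
    inter_subset_right, hU, ?_, ?_, ?_⟩
  · exact fun x hx => (hKD x hx.1.1).1
  · exact hx0' _ (inter_mem_nhdsWithin K2 (hU.1.mem_nhds hx0U))
  · refine LipschitzWith.of_dist_le_mul fun a b => ?_
    rw [EuclideanSpace.dist_eq]
    have h1 : ∑ i : Fin n, dist (dist a (q i)) (dist b (q i)) ^ 2 ≤ n * dist a b ^ 2 := by
      calc _ ≤ ∑ i : Fin n, dist a b ^ 2 := by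
            refine Finset.sum_le_sum fun i _ => ?_
            rw [Real.dist_eq]
            exact pow_le_pow_left₀ (abs_nonneg _) (hcoord a b i) 2
        _ = _ := by simp
    refine (Real.sqrt_le_sqrt h1).trans (le_of_eq ?_)
    rw [Real.sqrt_mul (by positivity), Real.sqrt_sq dist_nonneg]
    simp
  · intro a b i
    exact hcoord a b i
  · rintro _ ⟨x, hx, rfl⟩ i
    rw [hU.2.2.1 x hx.2, hGl]
    change dist (f x) (q i) = _
    rw [hgF i x (hKj x hx.1.1 i), hFA i x (hKD x hx.1.1).1]

end
end

section
/- Let X be a metric space, A ⊂ ℝ^{n+m} a measurable set of positive Lebesgue measure, and f : A → X a Lipschitz map such that Θ^{*n}(f,x) > 0 on a subset of A of positive Lebesgue measure. Then there exist a set K ⊂ A of positive Lebesgue measure, an open set U ⊃ K, and a bi-Lipschitz C¹-diffeomorphism G : U → G(U) ⊂ ℝ^{n+m} such that the map F = f∘G⁻¹ defined on G(K) satisfies: for every y ∈ ℝ^m, the restriction of F to (ℝ^n × {y}) ∩ G(K) is bi-Lipschitz, with the quantitative lower bound max_i |x₁ᵢ − x₂ᵢ| ≤ d(F(x₁,y),F(x₂,y))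 for all (x₁,y),(x₂,y) ∈ (ℝ^n × {y}) ∩ G(K). -/
open MeasureTheory Metric Set Filter
open scoped ENNReal NNReal Topology

noncomputable section

lemma avg_bound {N : ℕ} {g : EucSp N → ℝ} {L : ℝ≥0} (hg : LipschitzWith L g) (v p : EucSp N)
    (ρ r B : ℝ) (hr : 0 ≤ r)
    (hB : ∀ s ∈ Icc (0:ℝ) r, |∫ z in closedBall p ρ, lineDeriv ℝ g (z + s • v) v| ≤ B) :
    |(∫ z in closedBall p ρ, g (z + r • v)) - ∫ z in closedBall p ρ, g z| ≤ B * r := by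
  have hcont : Continuous g := hg.continuous
  have key : ∀ s : ℝ, HasDerivAt (fun s : ℝ => ∫ z in closedBall p ρ, g (z + s • v))
      (∫ z in closedBall p ρ, lineDeriv ℝ g (z + s • v) v) s := by
    intro s
    have hmeas := measurable_lineDeriv (𝕜 := ℝ) (v := v) hcont
    refine (hasDerivAt_integral_of_dominated_loc_of_lip (s := univ)
      (F := fun (s : ℝ) z => g (z + s • v)) (bound := fun _ => (L : ℝ) * ‖v‖)
      (F' := fun z => lineDeriv ℝ g (z + s • v) v) univ_mem ?_ ?_ ?_ ?_ ?_ ?_).2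
    · refine Eventually.of_forall fun s => ?_
      exact (hcont.comp (continuous_id.add continuous_const)).aestronglyMeasurable
    · exact ((hcont.comp (continuous_id.add continuous_const)).continuousOn).integrableOn_compact
        (isCompact_closedBall p ρ)
    · exact (hmeas.comp (measurable_id.add_const _)).aestronglyMeasurable
    · refine Eventually.of_forall fun z => ?_
      refine LipschitzOnWith.of_dist_le_mul fun a _ b _ => ?_
      have h1 := hg.dist_le_mul (z + a • v) (z + b • v)
      refine h1.trans (le_of_eq ?_)
      rw [dist_add_left, dist_eq_norm, ← sub_smul, norm_smul, Real.coe_nnabs,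
        abs_of_nonneg (by positivity), Real.dist_eq, Real.norm_eq_abs]
      ring
    · exact integrableOn_const (by exact (isCompact_closedBall p ρ).measure_lt_top.ne)
    · have h0 : ∀ᵐ z : EucSp N, LineDifferentiableAt ℝ g z v := hg.ae_lineDifferentiableAt v
      have h1 : ∀ᵐ z : EucSp N, LineDifferentiableAt ℝ g (z + s • v) v :=
        (quasiMeasurePreserving_add_right volume (s • v)).ae h0
      refine ae_restrict_of_ae (h1.mono fun z hz => ?_)
      have h2 : HasDerivAt (fun t : ℝ => g (z + s • v + t • v))
        (lineDeriv ℝ g (z + s • v) v) (s - s) := by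
          rw [sub_self]; exact hz.hasLineDerivAt
      have h3 := h2.comp_sub_const s s
      refine h3.congr_of_eventuallyEq (Eventually.of_forall fun t => ?_)
      simp only [sub_smul]
      congr 1
      abel
  have := (convex_Icc (0:ℝ) r).norm_image_sub_le_of_norm_hasDerivWithin_le
    (f := fun s : ℝ => ∫ z in closedBall p ρ, g (z + s • v)) (C := B)
    (fun s _ => (key s).hasDerivWithinAt) (fun s hs => hB s hs)
    (left_mem_Icc.2 hr) (right_mem_Icc.2 hr)
  simpa [abs_of_nonneg hr] using this

/-- The metric derivative in the direction `v`. -/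
def mDer {N : ℕ} (g : ℕ → EucSp N → ℝ) (v x : EucSp N) : ℝ := ⨆ j, |lineDeriv ℝ (g j) x v|

lemma mDer_bdd {N : ℕ} {g : ℕ → EucSp N → ℝ} {L : ℝ≥0} (hg : ∀ j, LipschitzWith L (g j))
    (v x : EucSp N) : BddAbove (range fun j => |lineDeriv ℝ (g j) x v|) := by
  refine ⟨L * ‖v‖, ?_⟩
  rintro _ ⟨j, rfl⟩
  exact norm_lineDeriv_le_of_lipschitz ℝ (hg j)

lemma le_mDer {N : ℕ} {g : ℕ → EucSp N → ℝ} {L : ℝ≥0} (hg : ∀ j, LipschitzWith L (g j))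
    (v x : EucSp N) (j : ℕ) : |lineDeriv ℝ (g j) x v| ≤ mDer g v x :=
  le_ciSup (mDer_bdd hg v x) j

lemma mDer_nonneg {N : ℕ} {g : ℕ → EucSp N → ℝ} {L : ℝ≥0} (hg : ∀ j, LipschitzWith L (g j))
    (v x : EucSp N) : 0 ≤ mDer g v x := (abs_nonneg _).trans (le_mDer hg v x 0)

lemma mDer_le {N : ℕ} {g : ℕ → EucSp N → ℝ} {L : ℝ≥0} (hg : ∀ j, LipschitzWith L (g j))
    (v x : EucSp N) : mDer g v x ≤ L * ‖v‖ :=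
  ciSup_le fun j => norm_lineDeriv_le_of_lipschitz ℝ (hg j)

lemma mDer_meas {N : ℕ} {g : ℕ → EucSp N → ℝ} {L : ℝ≥0} (hg : ∀ j, LipschitzWith L (g j))
    (v : EucSp N) : Measurable (mDer g v) := by
  unfold mDer
  exact Measurable.iSup fun j =>
    (continuous_abs.measurable.comp (measurable_lineDeriv (hg j).continuous))

lemma mDer_int {N : ℕ} {g : ℕ → EucSp N → ℝ} {L : ℝ≥0} (hg : ∀ j, LipschitzWith L (g j))
    (v p : EucSp N) (R : ℝ) (c : ℝ) : IntegrableOn (fun z => mDer g v z - c) (closedBall p R) := by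
  refine Measure.integrableOn_of_bounded (M := L * ‖v‖ + |c|)
    (isCompact_closedBall p R).measure_lt_top.ne
    ((mDer_meas hg v).sub_const c).aestronglyMeasurable (Eventually.of_forall fun z => ?_)
  refine (norm_sub_le _ _).trans ?_
  rw [Real.norm_eq_abs, Real.norm_eq_abs, abs_of_nonneg (mDer_nonneg hg v z)]
  linarith [mDer_le hg v z]

lemma lemA {N : ℕ} {g : ℕ → EucSp N → ℝ} {L : ℝ≥0} (hg : ∀ j, LipschitzWith L (g j))
    (v : EucSp N) : ∀ᵐ x : EucSp N, ∀ ε > (0:ℝ), ∀ᶠ r in 𝓝[>] (0:ℝ), ∀ p ∈ ball x r, ∀ j,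
      |g j (p + r • v) - g j p| ≤ (mDer g v x + ε) * r := by
  have hloc : LocallyIntegrable (mDer g v) volume := by
    rw [locallyIntegrable_iff]
    intro k hk
    obtain ⟨R, hR⟩ := hk.isBounded.subset_closedBall (0 : EucSp N)
    have := mDer_int hg v 0 R 0
    simp only [sub_zero] at this
    exact this.mono_set hR
  filter_upwards [IsUnifLocDoublingMeasure.ae_tendsto_average_norm_sub volume hloc 1] with x hx
  intro ε hε
  -- constants
  obtain ⟨η, hη0, hη1, hηε⟩ : ∃ η : ℝ, 0 < η ∧ η ≤ 1 ∧ 2 * L * η ≤ ε / 2 := by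
    refine ⟨min 1 (ε / (4 * (L + 1))), by positivity, min_le_left _ _, ?_⟩
    have h1 : min 1 (ε / (4 * ((L:ℝ) + 1))) ≤ ε / (4 * (L + 1)) := min_le_right _ _
    have hL : (0:ℝ) ≤ L := L.2
    calc 2 * L * min 1 (ε / (4 * ((L:ℝ) + 1))) ≤ 2 * (L + 1) * (ε / (4 * (L + 1))) := by
          gcongr; linarith
      _ = ε / 2 := by field_simp; norm_num
  set R : ℝ := 2 + ‖v‖ with hRdef
  have hR : 0 < R := by positivity
  have hδ : Tendsto (fun r : ℝ => R * r) (𝓝[>] 0) (𝓝[>] 0) := by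
    refine tendsto_nhdsWithin_iff.2 ⟨?_, ?_⟩
    · have : Tendsto (fun r : ℝ => R * r) (𝓝 0) (𝓝 (R * 0)) := tendsto_id.const_mul R
      rw [mul_zero] at this
      exact this.mono_left nhdsWithin_le_nhds
    · filter_upwards [self_mem_nhdsWithin] with r hr
      exact mul_pos hR hr
  have hlim := hx (fun _ : ℝ => x) (fun r => R * r) hδ (by
    filter_upwards [self_mem_nhdsWithin] with r hr
    have hr : 0 < r := hr
    simp; positivity)
  set κ : ℝ := ε / 2 * (η / R) ^ N with hκ
  have hκ0 : 0 < κ := by positivity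
  filter_upwards [self_mem_nhdsWithin, hlim.eventually (gt_mem_nhds hκ0)] with r hr hav p hp j
  have hr : 0 < r := hr
  set I : ℝ := ∫ z in closedBall x (R * r), ‖mDer g v z - mDer g v x‖ with hI
  set b : ℝ := volume.real (closedBall p (η * r)) with hb
  have hvol : ∀ (q : EucSp N) (s : ℝ), 0 < s → volume.real (closedBall q s)
      = s ^ N * volume.real (closedBall (0 : EucSp N) 1) := by
    intro q s hs
    have := Measure.addHaar_real_closedBall' (μ := volume) q hs.le
    rw [this, finrank_euclideanSpace_fin]
  have hcst : ∀ (c : ℝ) (q : EucSp N) (s : ℝ),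
      Integrable (fun _ : EucSp N => c) (volume.restrict (closedBall q s)) := fun c q s =>
    integrableOn_const (isCompact_closedBall q s).measure_lt_top.ne
  have hc0 : 0 < volume.real (closedBall (0 : EucSp N) 1) :=
    ENNReal.toReal_pos (measure_closedBall_pos _ _ one_pos).ne'
      (isCompact_closedBall _ _).measure_lt_top.ne
  have hb0 : 0 < b := by rw [hb, hvol _ _ (by positivity)]; positivity
  have hI2 : I ≤ ε / 2 * b := by
    rw [setAverage_eq, smul_eq_mul, ← hI, hvol _ _ (by positivity)] at hav
    have h2 : I < κ * ((R * r) ^ N * volume.real (closedBall (0 : EucSp N) 1)) := by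
      rw [inv_mul_lt_iff₀ (by positivity)] at hav
      linarith
    refine h2.le.trans (le_of_eq ?_)
    rw [hb, hvol p (η * r) (by positivity), hκ, div_pow, mul_pow, mul_pow]
    field_simp
  have hder : ∀ s ∈ Icc (0:ℝ) r,
      |∫ z in closedBall p (η * r), lineDeriv ℝ (g j) (z + s • v) v| ≤ mDer g v x * b + I := by
    intro s hs
    have hsub : closedBall (p + s • v) (η * r) ⊆ closedBall x (R * r) := by
      refine closedBall_subset_closedBall' ?_
      have h1 : dist (p + s • v) x ≤ dist p x + ‖s • v‖ := by
        rw [dist_eq_norm, dist_eq_norm, add_sub_right_comm]; exact norm_add_le _ _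
      have h2 : ‖s • v‖ ≤ r * ‖v‖ := by
        rw [norm_smul, Real.norm_eq_abs, abs_of_nonneg hs.1]
        gcongr; exact hs.2
      have h3 := mem_ball.1 hp
      have h4 : η * r ≤ 1 * r := by gcongr
      rw [hRdef]; linarith
    have htr : ∀ h : EucSp N → ℝ, ∫ z in closedBall p (η * r), h (z + s • v)
        = ∫ z in closedBall (p + s • v) (η * r), h z := by
      intro h
      have := (measurePreserving_add_right (volume : Measure (EucSp N)) (s • v)).setIntegral_preimage_emb
        (measurableEmbedding_addRight (s • v)) h (closedBall (p + s • v) (η * r))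
      rw [← this]
      congr 2
      ext z; simp
    rw [htr (fun z => lineDeriv ℝ (g j) z v)]
    have hint1 := mDer_int hg v (p + s • v) (η * r) 0
    simp only [sub_zero] at hint1
    have hint2 := mDer_int hg v x (R * r) (mDer g v x)
    calc |∫ z in closedBall (p + s • v) (η * r), lineDeriv ℝ (g j) z v|
        ≤ ∫ z in closedBall (p + s • v) (η * r), (mDer g v x + ‖mDer g v z - mDer g v x‖) := by
          rw [← Real.norm_eq_abs]
          refine norm_integral_le_of_norm_le ?_ (Eventually.of_forall fun z => ?_)
          · exact (hcst _ _ _).add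
              (hint2.mono_set hsub).norm
          · have h1 := le_mDer hg v z j
            have h2 := le_abs_self (mDer g v z - mDer g v x)
            simp only [Real.norm_eq_abs]
            linarith
      _ = mDer g v x * b + ∫ z in closedBall (p + s • v) (η * r), ‖mDer g v z - mDer g v x‖ := by
          rw [integral_add (hcst _ _ _)
            (hint2.mono_set hsub).norm, setIntegral_const, smul_eq_mul, hb, hvol p _ (by positivity),
            hvol (p + s • v) _ (by positivity)]
          ring
      _ ≤ mDer g v x * b + I := by
          gcongr
          exact setIntegral_mono_set hint2.norm (Eventually.of_forall fun z => norm_nonneg _)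
            hsub.eventuallyLE
  have hmain := avg_bound (hg j) v p (η * r) r _ hr.le hder
  -- compare
  have hcomp : ∀ q : EucSp N, |(∫ z in closedBall p (η * r), g j (z + q)) - b * g j (p + q)|
      ≤ L * (η * r) * b := by
    intro q
    have hi : IntegrableOn (fun z => g j (z + q)) (closedBall p (η * r)) :=
      (((hg j).continuous.comp (continuous_id.add continuous_const)).continuousOn).integrableOn_compact
        (isCompact_closedBall _ _)
    have e : b * g j (p + q) = ∫ z in closedBall p (η * r), g j (p + q) := by
      rw [setIntegral_const, smul_eq_mul]
    rw [e, ← integral_sub hi (hcst _ _ _), ← Real.norm_eq_abs]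
    refine norm_setIntegral_le_of_norm_le_const (isCompact_closedBall _ _).measure_lt_top ?_
    intro z hz
    have := (hg j).dist_le_mul (z + q) (p + q)
    rw [dist_add_right, Real.dist_eq] at this
    refine this.trans ?_
    gcongr
    exact hz
  have c1 := hcomp (r • v)
  have c2 := hcomp 0
  simp only [add_zero] at c2
  have hfin : b * |g j (p + r • v) - g j p| ≤ b * ((mDer g v x + ε) * r) := by
    rw [← abs_of_pos hb0, ← abs_mul, abs_of_pos hb0]
    rw [abs_le] at hmain c1 c2
    have h5 : I * r ≤ ε / 2 * b * r := by gcongr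
    have h6 : 2 * L * η * (r * b) ≤ ε / 2 * (r * b) := by gcongr
    rw [abs_le]
    constructor <;> nlinarith
  exact le_of_mul_le_mul_left hfin hb0

lemma hContent_le {X : Type*} [PseudoEMetricSpace X] {n : ℕ} (hn : n ≠ 0) {ι : Type*} [Fintype ι]
    (E : Set X) (S : ι → Set X) (d : ℝ≥0∞) (hE : E ⊆ ⋃ c, S c) (hd : ∀ c, Metric.ediam (S c) ≤ d) :
    hContent n E ≤ unitBallVol n / 2 ^ n * (Fintype.card ι * d ^ n) := by
  classical
  let _ : Encodable ι := Fintype.toEncodable ι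
  unfold hContent
  refine (iInf₂_le (fun i : ℕ => ⋃ b ∈ Encodable.decode₂ ι i, S b) ?_).trans ?_
  · rw [Encodable.iUnion_decode₂]; exact hE
  · gcongr
    change ∑' i : ℕ, Metric.ediam (⋃ b ∈ Encodable.decode₂ ι i, S b) ^ n ≤ _
    rw [tsum_iUnion_decode₂ (fun s : Set X => Metric.ediam s ^ n) (by simp [hn]) S, tsum_fintype]
    refine (Finset.sum_le_card_nsmul _ _ (d ^ n) fun c _ => ?_).trans ?_
    · exact pow_le_pow_left' (hd c) n
    · rw [nsmul_eq_mul, Finset.card_univ]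

lemma rank_frame {N n : ℕ} (g : ℕ → EucSp N → ℝ) (L : ℝ≥0) (hg : ∀ j, LipschitzWith L (g j))
    (x : EucSp N)
    (hrank : ∀ τ : Fin n → ℕ, ¬ LinearIndependent ℝ (fun i => fderiv ℝ (g (τ i)) x)) :
    ∃ k < n, ∃ b : Fin k → EucSp N, (∀ i, ‖b i‖ = 1) ∧
      ∀ j w, |fderiv ℝ (g j) x w| ≤ L * ∑ i, |inner ℝ (b i) w| := by
  set Gr : ℕ → EucSp N := fun j => (InnerProductSpace.toDual ℝ (EucSp N)).symm (fderiv ℝ (g j) x)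
    with hGr
  have hG : ∀ j w, inner ℝ (Gr j) w = fderiv ℝ (g j) x w := fun j w =>
    InnerProductSpace.toDual_symm_apply
  have hGn : ∀ j, ‖Gr j‖ ≤ L := fun j => by
    rw [hGr]; simp only [LinearIsometryEquiv.norm_map]
    exact norm_fderiv_le_of_lipschitz ℝ (hg j)
  set W := Submodule.span ℝ (range Gr) with hW
  refine ⟨Module.finrank ℝ W, ?_, fun i => (stdOrthonormalBasis ℝ W i : EucSp N), ?_, ?_⟩
  · by_contra hcon
    push Not at hcon
    obtain ⟨F, hF, -, hli⟩ := Submodule.exists_fun_fin_finrank_span_eq ℝ (range Gr)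
    choose τ hτ using hF
    refine hrank (fun i => τ (Fin.castLE hcon i)) ?_
    have hli2 := hli.comp (Fin.castLE hcon) (Fin.castLE_injective hcon)
    rw [Fintype.linearIndependent_iff] at hli2 ⊢
    intro c hc
    apply hli2 c
    refine ext_inner_right ℝ fun w => ?_
    rw [sum_inner, inner_zero_left]
    have := congrArg (fun T : EucSp N →L[ℝ] ℝ => T w) hc
    simp only [_root_.sum_apply, _root_.smul_apply,
      _root_.zero_apply] at this
    rw [← this]
    refine Finset.sum_congr rfl fun i _ => ?_
    rw [Function.comp_apply, ← hτ, inner_smul_left, hG]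
    simp
  · intro i
    have := (stdOrthonormalBasis ℝ W).orthonormal.1 i
    exact this
  · intro j w
    have hmem : Gr j ∈ W := Submodule.subset_span ⟨j, rfl⟩
    have hrep := (stdOrthonormalBasis ℝ W).sum_repr' ⟨Gr j, hmem⟩
    have hrep2 := congrArg (Subtype.val) hrep
    simp only [Submodule.coe_sum, Submodule.coe_smul, Submodule.coe_inner] at hrep2
    rw [← hG, ← hrep2, sum_inner, Finset.mul_sum]
    refine (Finset.abs_sum_le_sum_abs _ _).trans (Finset.sum_le_sum fun i _ => ?_)
    rw [inner_smul_left, abs_mul]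
    gcongr
    have h1 := abs_real_inner_le_norm (stdOrthonormalBasis ℝ W i : EucSp N) (Gr j)
    have h2 : ‖(stdOrthonormalBasis ℝ W i : EucSp N)‖ = 1 :=
      (stdOrthonormalBasis ℝ W).orthonormal.1 i
    rw [h2, one_mul] at h1
    simpa using h1.trans (hGn j)

lemma lemB {N n : ℕ} {X : Type*} [PseudoMetricSpace X] (g : ℕ → EucSp N → ℝ) (L : ℝ≥0)
    (hg : ∀ j, LipschitzWith L (g j)) (f : EucSp N → X) (A : Set (EucSp N))
    (hsep : ∀ p ∈ A, ∀ q ∈ A, ∀ c : ℝ, (∀ j, |g j p - g j q| ≤ c) → dist (f p) (f q) ≤ c)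
    (D : Set (EucSp N)) (hD : Dense D) (x : EucSp N) (hdiff : ∀ j, DifferentiableAt ℝ (g j) x)
    (hx : ∀ v ∈ D, ∀ ε > (0:ℝ), ∀ᶠ r in 𝓝[>] (0:ℝ), ∀ p ∈ ball x r, ∀ j,
      |g j (p + r • v) - g j p| ≤ (mDer g v x + ε) * r)
    (hrank : ∀ τ : Fin n → ℕ, ¬ LinearIndependent ℝ (fun i => fderiv ℝ (g (τ i)) x)) :
    upperDensity n f A x = 0 := by
  obtain ⟨k, hk, b, hb1, hb⟩ := rank_frame g L hg x hrank
  have hn : n ≠ 0 := by omega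
  have hL : (0:ℝ) ≤ L := L.2
  set C : ℝ := k * L + 2 * L + 1 with hC
  have hC0 : 0 < C := by positivity
  have main : ∀ q : ℕ, 0 < q → upperDensity n f A x ≤ ENNReal.ofReal ((3 * C) ^ n / q) := by
    intro q hq
    have hq' : (0:ℝ) < q := by exact_mod_cast hq
    have hq1 : (1:ℝ) ≤ q := by exact_mod_cast hq
    set ε : ℝ := 1 / q with hε
    have hε0 : 0 < ε := by positivity
    obtain ⟨t, htD, htf, ht⟩ := (isCompact_closedBall (0 : EucSp N) 2).elim_finite_subcover_image
      (b := D) (c := fun v => ball v ε) (fun v _ => isOpen_ball) (fun w _ => by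
        obtain ⟨v, hv, hvw⟩ := hD.exists_dist_lt w hε0
        exact mem_biUnion hv (mem_ball.2 hvw))
    have hev := (eventually_all_finite htf).2 fun v hv => hx v (htD hv) ε hε0
    unfold upperDensity
    refine limsup_le_of_le (h := ?_)
    filter_upwards [self_mem_nhdsWithin, hev] with r hr hrv
    have hr : 0 < r := hr
    let S : (Fin k → ↥(Finset.Icc (-(q:ℤ)) q)) → Set X := fun c =>
      f '' {p | p ∈ ball x r ∩ A ∧ ∀ i, ⌊q * inner ℝ (b i) (p - x) / r⌋ = (c i : ℤ)}
    have hcov : f '' (ball x r ∩ A) ⊆ ⋃ c, S c := by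
      rintro _ ⟨p, hp, rfl⟩
      have hin : ∀ i, ⌊q * inner ℝ (b i) (p - x) / r⌋ ∈ Finset.Icc (-(q:ℤ)) q := by
        intro i
        have h1 := abs_real_inner_le_norm (b i) (p - x)
        rw [hb1, one_mul, ← dist_eq_norm] at h1
        have h2 := abs_le.1 (h1.trans (mem_ball.1 hp.1).le)
        rw [Finset.mem_Icc]
        constructor
        · rw [Int.le_floor]
          push_cast
          rw [le_div_iff₀ hr]
          nlinarith
        · have : (⌊q * inner ℝ (b i) (p - x) / r⌋ : ℝ) ≤ q := by
            refine (Int.floor_le _).trans ?_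
            rw [div_le_iff₀ hr]
            nlinarith
          exact_mod_cast this
      exact mem_iUnion.2 ⟨fun i => ⟨_, hin i⟩, p, ⟨hp, fun i => rfl⟩, rfl⟩
    have hdiam : ∀ c, Metric.ediam (S c) ≤ ENNReal.ofReal (C * r / q) := by
      intro c
      refine Metric.ediam_le ?_
      rintro _ ⟨p, ⟨hp, hpc⟩, rfl⟩ _ ⟨p', ⟨hp', hpc'⟩, rfl⟩
      rw [edist_dist]
      refine ENNReal.ofReal_le_ofReal (hsep p hp.2 p' hp'.2 _ fun j => ?_)
      set w := p - p' with hw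
      have hwn : ‖w‖ ≤ 2 * r := by
        rw [hw, ← dist_eq_norm]
        have h1 := mem_ball.1 hp.1
        have h2 := mem_ball.1 hp'.1
        have := dist_triangle_right p p' x
        linarith
      have hbw : ∀ i, |inner ℝ (b i) w| ≤ ε * r := by
        intro i
        have h1 := Int.abs_sub_lt_one_of_floor_eq_floor ((hpc i).trans (hpc' i).symm)
        have h2 : inner ℝ (b i) w = ε * r *
            (q * inner ℝ (b i) (p - x) / r - q * inner ℝ (b i) (p' - x) / r) := by
          have : w = (p - x) - (p' - x) := by rw [hw]; abel
          rw [this, inner_sub_right, hε]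
          field_simp
        rw [h2, abs_mul, abs_of_pos (by positivity : 0 < ε * r)]
        have : 0 < ε * r := by positivity
        nlinarith
      have hw2 : r⁻¹ • w ∈ closedBall (0 : EucSp N) 2 := by
        rw [mem_closedBall_zero_iff, norm_smul, norm_inv, Real.norm_eq_abs, abs_of_pos hr,
          inv_mul_le_iff₀ hr]
        linarith
      obtain ⟨v, hvt, hv⟩ := mem_iUnion₂.1 (ht hw2)
      have hwv : ‖w - r • v‖ ≤ ε * r := by
        have e : w - r • v = r • (r⁻¹ • w - v) := by
          rw [smul_sub, smul_inv_smul₀ hr.ne']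
        rw [e, norm_smul, Real.norm_eq_abs, abs_of_pos hr, ← dist_eq_norm, mul_comm]
        gcongr
        exact (mem_ball.1 hv).le
      have hmd : mDer g v x * r ≤ (k * L + L) * (ε * r) := by
        have : mDer g v x ≤ (k * L + L) * ε := by
          refine ciSup_le fun i => ?_
          rw [(hdiff i).lineDeriv_eq_fderiv]
          have e : fderiv ℝ (g i) x v =
              r⁻¹ * (fderiv ℝ (g i) x w - fderiv ℝ (g i) x (w - r • v)) := by
            rw [(fderiv ℝ (g i) x).map_sub w, map_smul, smul_eq_mul]
            field_simp
            ring
          have h1 : |fderiv ℝ (g i) x w| ≤ L * (k * (ε * r)) := by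
            refine (hb i w).trans ?_
            gcongr
            refine (Finset.sum_le_card_nsmul _ _ (ε * r) fun i _ => hbw i).trans ?_
            simp
          have h2 : |fderiv ℝ (g i) x (w - r • v)| ≤ L * (ε * r) := by
            refine ((fderiv ℝ (g i) x).le_opNorm _).trans ?_
            gcongr
            exact norm_fderiv_le_of_lipschitz ℝ (hg i)
          rw [e, abs_mul, abs_of_pos (inv_pos.2 hr), inv_mul_le_iff₀ hr]
          have h3 := abs_sub (fderiv ℝ (g i) x w) (fderiv ℝ (g i) x (w - r • v))
          nlinarith
        nlinarith
      have h1 := hrv v hvt p' hp'.1 j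
      have h2 := (hg j).dist_le_mul p (p' + r • v)
      have e2 : dist p (p' + r • v) = ‖w - r • v‖ := by
        rw [dist_eq_norm, hw, sub_add_eq_sub_sub]
      rw [Real.dist_eq, e2] at h2
      have h3 : (L:ℝ) * ‖w - r • v‖ ≤ L * (ε * r) := by gcongr
      have h4 : g j p - g j p' = (g j p - g j (p' + r • v)) + (g j (p' + r • v) - g j p') := by ring
      rw [h4]
      refine (abs_add_le _ _).trans ?_
      have h5 : C * r / q = C * (ε * r) := by rw [hε]; field_simp
      rw [h5, hC]
      nlinarith
    have hle := hContent_le hn _ S _ hcov hdiam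
    refine ENNReal.div_le_of_le_mul (hle.trans ?_)
    have hU : unitBallVol n / 2 ^ n ≤ unitBallVol n := by
      refine ENNReal.div_le_of_le_mul ?_
      exact le_mul_of_one_le_right' (one_le_pow₀ (by norm_num))
    have hcard : Fintype.card (Fin k → ↥(Finset.Icc (-(q:ℤ)) q)) = (2 * q + 1) ^ k := by
      rw [Fintype.card_fun, Fintype.card_coe, Int.card_Icc, Fintype.card_fin]
      congr 1
      omega
    have hreal : ((2 * q + 1 : ℕ) : ℝ) ^ k * (C * r / q) ^ n ≤ (3 * C) ^ n / q * r ^ n := by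
      obtain ⟨n', rfl⟩ := Nat.exists_eq_succ_of_ne_zero hn
      have h1 : ((2 * q + 1 : ℕ) : ℝ) ^ k ≤ (3 * q) ^ n' := by
        calc ((2 * q + 1 : ℕ) : ℝ) ^ k ≤ (3 * q) ^ k := by
              gcongr; push_cast; linarith
          _ ≤ (3 * q) ^ n' := pow_le_pow_right₀ (by linarith) (by omega)
      calc ((2 * q + 1 : ℕ) : ℝ) ^ k * (C * r / q) ^ (n' + 1)
          ≤ (3 * q) ^ n' * (C * r / q) ^ (n' + 1) := by gcongr
        _ = 3 ^ n' * (C ^ (n' + 1) / q * r ^ (n' + 1)) := by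
            rw [div_pow, mul_pow, mul_pow]; field_simp; ring
        _ ≤ 3 ^ (n' + 1) * (C ^ (n' + 1) / q * r ^ (n' + 1)) := by
            gcongr
            · norm_num
            · omega
        _ = (3 * C) ^ (n' + 1) / q * r ^ (n' + 1) := by rw [mul_pow]; ring
    have hen : ((Fintype.card (Fin k → ↥(Finset.Icc (-(q:ℤ)) q)) : ℕ) : ℝ≥0∞)
        * ENNReal.ofReal (C * r / q) ^ n ≤ ENNReal.ofReal ((3 * C) ^ n / q) * ENNReal.ofReal r ^ n := by
      rw [hcard, ← ENNReal.ofReal_pow (by positivity), ← ENNReal.ofReal_pow hr.le,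
        ← ENNReal.ofReal_mul (by positivity), ← ENNReal.ofReal_natCast,
        ← ENNReal.ofReal_mul (by positivity)]
      refine ENNReal.ofReal_le_ofReal ?_
      push_cast at hreal ⊢
      exact hreal
    calc _ ≤ unitBallVol n * (ENNReal.ofReal ((3 * C) ^ n / q) * ENNReal.ofReal r ^ n) := by
          gcongr
      _ = _ := by ring
  have hlim : Tendsto (fun q : ℕ => ENNReal.ofReal ((3 * C) ^ n / q)) atTop (𝓝 0) := by
    have := ENNReal.tendsto_ofReal (tendsto_const_div_atTop_nhds_zero_nat ((3 * C) ^ n))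
    simpa using this
  have := ge_of_tendsto hlim ((eventually_gt_atTop 0).mono fun q hq => main q hq)
  exact le_antisymm this (zero_le)

lemma slice_norm {n m : ℕ} (u : EucSp (n + m)) (a : ℝ) (ha : 0 ≤ a)
    (h0 : ∀ i : Fin m, u (Fin.natAdd n i) = 0) (h1 : ∀ i : Fin n, |u (Fin.castAdd m i)| ≤ a) :
    ‖u‖ ≤ n * a := by
  rw [EuclideanSpace.norm_eq, Fin.sum_univ_add]
  refine Real.sqrt_le_iff.2 ⟨by positivity, ?_⟩
  have e : ∑ i : Fin m, ‖u (Fin.natAdd n i)‖ ^ 2 = 0 :=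
    Finset.sum_eq_zero fun i _ => by simp [h0]
  rw [e, add_zero]
  have h2 : ∑ i : Fin n, ‖u (Fin.castAdd m i)‖ ^ 2 ≤ n * a ^ 2 := by
    refine (Finset.sum_le_card_nsmul _ _ (a ^ 2) fun i _ => ?_).trans (by simp)
    exact pow_le_pow_left₀ (norm_nonneg _) (h1 i) 2
  have h3 : (n : ℝ) ≤ n ^ 2 := by exact_mod_cast Nat.le_self_pow two_ne_zero n
  nlinarith [sq_nonneg a]

lemma surj_of_li {n : ℕ} {E : Type*} [NormedAddCommGroup E] [NormedSpace ℝ E]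
    (ℓ : Fin n → E →L[ℝ] ℝ) (hl : LinearIndependent ℝ ℓ) :
    Function.Surjective (ContinuousLinearMap.pi ℓ) := by
  have : LinearMap.range (ContinuousLinearMap.pi ℓ : E →ₗ[ℝ] (Fin n → ℝ)) = ⊤ := by
    by_contra hne
    obtain ⟨φ, hφ0, hφ⟩ := Submodule.exists_le_ker_of_lt_top _ (lt_top_iff_ne_top.2 hne)
    apply hφ0
    rw [Fintype.linearIndependent_iff] at hl
    have h := hl (fun i => φ (Pi.single i 1)) (by
      ext w
      have h1 : φ (ContinuousLinearMap.pi ℓ w) = 0 := hφ ⟨w, rfl⟩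
      rw [pi_eq_sum_univ' (ContinuousLinearMap.pi ℓ w), map_sum] at h1
      simp only [_root_.sum_apply, _root_.smul_apply, _root_.zero_apply]
      rw [← h1]
      refine Finset.sum_congr rfl fun i _ => ?_
      rw [map_smul, smul_eq_mul, smul_eq_mul, mul_comm]
      rfl)
    refine LinearMap.pi_ext' fun i => LinearMap.ext_ring ?_
    simpa using h i
  exact LinearMap.range_eq_top.1 this

lemma lin_ext {n m : ℕ} (T : EucSp (n + m) →L[ℝ] (Fin n → ℝ)) (hT : Function.Surjective T) :
    ∃ Φ : EucSp (n + m) ≃L[ℝ] EucSp (n + m), ∀ w i, Φ w (Fin.castAdd m i) = T w i := by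
  set K := LinearMap.ker (T : EucSp (n + m) →ₗ[ℝ] (Fin n → ℝ)) with hK
  have hfr : Module.finrank ℝ K = Module.finrank ℝ (Fin m → ℝ) := by
    have h1 := LinearMap.finrank_range_add_finrank_ker (T : EucSp (n + m) →ₗ[ℝ] (Fin n → ℝ))
    have h2 : Module.finrank ℝ (LinearMap.range (T : EucSp (n + m) →ₗ[ℝ] (Fin n → ℝ))) = n := by
      rw [LinearMap.range_eq_top.2 hT, finrank_top, Module.finrank_fin_fun]
    have h3 : Module.finrank ℝ (EucSp (n + m)) = n + m := finrank_euclideanSpace_fin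
    rw [h2, h3, ← hK] at h1
    rw [Module.finrank_fin_fun]
    omega
  let e : K ≃ₗ[ℝ] (Fin m → ℝ) := LinearEquiv.ofFinrankEq _ _ hfr
  obtain ⟨P, hP⟩ := LinearMap.exists_leftInverse_of_injective K.subtype (Submodule.ker_subtype K)
  let Φ₀ : EucSp (n + m) →ₗ[ℝ] EucSp (n + m) :=
    { toFun := fun w => WithLp.toLp 2 (Fin.append (T w) (e (P w)))
      map_add' := fun a b => by
        ext i
        refine Fin.addCases (fun i => ?_) (fun i => ?_) i <;> simp
      map_smul' := fun c a => by
        ext i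
        refine Fin.addCases (fun i => ?_) (fun i => ?_) i <;> simp }
  have hl : ∀ w i, Φ₀ w (Fin.castAdd m i) = T w i := fun w i => by simp [Φ₀]
  have hr : ∀ w i, Φ₀ w (Fin.natAdd n i) = e (P w) i := fun w i => by simp [Φ₀]
  have hinj : Function.Injective Φ₀ := by
    rw [← LinearMap.ker_eq_bot, LinearMap.ker_eq_bot']
    intro w hw
    have h1 : T w = 0 := by ext i; rw [← hl, hw]; rfl
    have h2 : e (P w) = 0 := by ext i; rw [← hr, hw]; rfl
    have h3 : P w = 0 := by simpa using h2
    have h4 : w ∈ K := h1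
    have h5 := LinearMap.congr_fun hP ⟨w, h4⟩
    simp only [LinearMap.comp_apply, Submodule.subtype_apply, LinearMap.id_apply] at h5
    rw [h3] at h5
    exact (congrArg Subtype.val h5).symm
  refine ⟨(LinearEquiv.ofInjectiveEndo Φ₀ hinj).toContinuousLinearEquiv, fun w i => ?_⟩
  rw [← hl]
  rfl

lemma lin_const {n m : ℕ} (T : EucSp (n + m) →L[ℝ] (Fin n → ℝ)) :
    ∃ c : ℝ≥0, c ≠ 0 ∧ (Function.Surjective T →
      ∃ Φ : EucSp (n + m) ≃L[ℝ] EucSp (n + m), (∀ w i, Φ w (Fin.castAdd m i) = T w i) ∧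
        ∀ w, (∀ i : Fin m, Φ w (Fin.natAdd n i) = 0) →
          ‖Φ w‖ ≤ n * ‖T w‖ ∧ c * ‖w‖ ≤ ‖T w‖ / 2) := by
  by_cases hT : Function.Surjective T
  · obtain ⟨Φ, hΦ⟩ := lin_ext T hT
    set M : ℝ≥0 := ‖(Φ.symm : EucSp (n + m) →L[ℝ] EucSp (n + m))‖₊ with hM
    refine ⟨1 / (2 * (M * n + 1)), by positivity, fun _ => ⟨Φ, hΦ, fun w hw => ?_⟩⟩
    have h1 : ‖Φ w‖ ≤ n * ‖T w‖ := slice_norm _ _ (norm_nonneg _) hw fun i => by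
      rw [hΦ]; exact norm_le_pi_norm (T w) i
    refine ⟨h1, ?_⟩
    have h2 : ‖w‖ ≤ M * ‖Φ w‖ := by
      have := (Φ.symm : EucSp (n + m) →L[ℝ] EucSp (n + m)).le_opNorm (Φ w)
      rw [ContinuousLinearEquiv.coe_coe, Φ.symm_apply_apply] at this
      exact this
    have hM0 : (0:ℝ) ≤ M := M.2
    have h3 : ‖w‖ ≤ (M * n + 1) * ‖T w‖ := by
      have : (M:ℝ) * ‖Φ w‖ ≤ M * (n * ‖T w‖) := by gcongr
      nlinarith [norm_nonneg (T w)]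
    push_cast
    rw [div_mul_eq_mul_div, one_mul, div_le_iff₀ (by positivity)]
    linarith
  · exact ⟨1, one_ne_zero, fun h => absurd h hT⟩

/-- Theorem, part (D): under the density hypothesis there are a set
`K ⊆ A` of positive measure, an open `U ⊇ K` and a bi-Lipschitz `C¹`-diffeomorphism
`G : U → G(U)` such that `F = f ∘ G⁻¹` restricted to each horizontal slice
`(ℝ^n × {y}) ∩ G(K)` is bi-Lipschitz, with quantitative lower bound
`max_i |x₁ᵢ − x₂ᵢ| ≤ d(F(x₁,y), F(x₂,y))`. -/
theorem stmt3 {n m : ℕ} {X : Type*} [MetricSpace X]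
    (A : Set (EucSp (n + m))) (hA : MeasurableSet A) (hApos : 0 < volume A)
    (f : EucSp (n + m) → X) (hf : ∃ L : ℝ≥0, LipschitzOnWith L f A)
    (hdens : 0 < volume {x ∈ A | 0 < upperDensity n f A x}) :
    ∃ (K : Set (EucSp (n + m))) (U : Set (EucSp (n + m)))
      (G Ginv : EucSp (n + m) → EucSp (n + m)) (Λ : ℝ),
      K ⊆ A ∧ 0 < volume K ∧ K ⊆ U ∧ IsBiLipC1DiffeoOn G Ginv U ∧ 0 < Λ ∧
      ∀ z ∈ G '' K, ∀ w ∈ G '' K,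
        (∀ i : Fin m, z (Fin.natAdd n i) = w (Fin.natAdd n i)) →
          (Λ⁻¹ * dist z w ≤ dist (f (Ginv z)) (f (Ginv w)) ∧
            dist (f (Ginv z)) (f (Ginv w)) ≤ Λ * dist z w ∧
            ∀ i : Fin n, |z (Fin.castAdd m i) - w (Fin.castAdd m i)| ≤
              dist (f (Ginv z)) (f (Ginv w))) := by
  classical
  obtain ⟨L, hL⟩ := hf
  have hAne : A.Nonempty := nonempty_of_measure_ne_zero hApos.ne'
  have : Nonempty A := hAne.to_subtype
  let a : ℕ → A := TopologicalSpace.denseSeq A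
  have ha : DenseRange a := TopologicalSpace.denseRange_denseSeq A
  -- the coordinate functions
  have hex : ∀ j, ∃ g : EucSp (n + m) → ℝ, LipschitzWith L g ∧
      EqOn (fun x => dist (f (a j)) (f x)) g A := by
    intro j
    refine LipschitzOnWith.extend_real (LipschitzOnWith.of_dist_le_mul fun x hx y hy => ?_)
    refine le_trans ?_ (hL.dist_le_mul x hx y hy)
    rw [Real.dist_eq, dist_comm (f (a j)), dist_comm (f (a j))]
    exact abs_dist_sub_le _ _ _
  choose g hg hgA using hex
  have hgd : ∀ p ∈ A, ∀ q ∈ A, ∀ j, |g j p - g j q| ≤ dist (f p) (f q) := by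
    intro p hp q hq j
    rw [← hgA j hp, ← hgA j hq]
    simp only
    rw [dist_comm (f (a j)), dist_comm (f (a j))]
    exact abs_dist_sub_le _ _ _
  have hsep : ∀ p ∈ A, ∀ q ∈ A, ∀ c : ℝ, (∀ j, |g j p - g j q| ≤ c) → dist (f p) (f q) ≤ c := by
    intro p hp q hq c hc
    refine le_of_forall_pos_le_add fun ε hε => ?_
    have hL0 : (0:ℝ) ≤ L := L.2
    obtain ⟨j, hj⟩ := ha.exists_dist_lt ⟨p, hp⟩ (ε := ε / (2 * (L + 1))) (by positivity)
    have hj' : dist p (a j : EucSp (n + m)) < ε / (2 * (L + 1)) := hj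
    have h1 := hL.dist_le_mul p hp (a j) (a j).2
    have h2 : dist (f p) (f (a j)) ≤ ε / 2 := by
      refine h1.trans ?_
      calc (L:ℝ) * dist p (a j : EucSp (n + m)) ≤ (L + 1) * (ε / (2 * (L + 1))) := by
            gcongr; linarith
        _ = ε / 2 := by field_simp
    have h3 := hc j
    rw [← hgA j hp, ← hgA j hq] at h3
    simp only at h3
    have h4 := (abs_le.1 h3).1
    have h5 := dist_triangle (f p) (f (a j)) (f q)
    rw [dist_comm (f (a j)) (f p)] at h4
    linarith
  -- almost everywhere properties
  obtain ⟨D, hDc, hD⟩ := TopologicalSpace.exists_countable_dense (EucSp (n + m))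
  have hae1 : ∀ᵐ x : EucSp (n + m), ∀ j, DifferentiableAt ℝ (g j) x :=
    ae_all_iff.2 fun j => (hg j).ae_differentiableAt
  have hae2 : ∀ᵐ x : EucSp (n + m), ∀ v ∈ D, ∀ ε > (0:ℝ), ∀ᶠ r in 𝓝[>] (0:ℝ), ∀ p ∈ ball x r, ∀ j,
      |g j (p + r • v) - g j p| ≤ (mDer g v x + ε) * r :=
    (ae_ball_iff hDc).2 fun v _ => lemA hg v
  let S : (Fin n → ℕ) → Set (EucSp (n + m)) := fun τ =>
    {x | x ∈ A ∧ (∀ j, DifferentiableAt ℝ (g j) x) ∧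
      LinearIndependent ℝ (fun i => fderiv ℝ (g (τ i)) x)}
  obtain ⟨τ, hτ⟩ : ∃ τ, 0 < volume (S τ) := by
    by_contra hcon
    push Not at hcon
    have hnull : volume (⋃ τ, S τ) = 0 :=
      measure_iUnion_null fun τ => le_antisymm (hcon τ) (zero_le)
    have hae3 : ∀ᵐ x : EucSp (n + m), x ∉ ⋃ τ, S τ := measure_eq_zero_iff_ae_notMem.1 hnull
    refine hdens.ne' (measure_eq_zero_iff_ae_notMem.2 ?_)
    filter_upwards [hae1, hae2, hae3] with x h1 h2 h3 hx
    refine hx.2.ne' (lemB g L hg f A hsep D hD x h1 h2 fun τ hτ => h3 ?_)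
    exact mem_iUnion.2 ⟨τ, hx.1, h1, hτ⟩
  have hSne : (S τ).Nonempty := nonempty_of_measure_ne_zero hτ.ne'
  choose c hc0 hc using (lin_const (n := n) (m := m))
  obtain ⟨t, T, -, -, htS, hTa, hTy⟩ := exists_partition_approximatesLinearOn_of_hasFDerivWithinAt
    (fun x (i : Fin n) => g (τ i) x) (S τ)
    (fun x => ContinuousLinearMap.pi fun i => fderiv ℝ (g (τ i)) x)
    (fun x hx => (hasFDerivAt_pi.2 fun i => (hx.2.1 (τ i)).hasFDerivAt).hasFDerivWithinAt) c hc0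
  obtain ⟨l, hl⟩ : ∃ l, 0 < volume (S τ ∩ t l) := by
    by_contra hcon
    push Not at hcon
    have hnull : volume (⋃ l, S τ ∩ t l) = 0 :=
      measure_iUnion_null fun l => le_antisymm (hcon l) (zero_le)
    rw [← inter_iUnion, inter_eq_left.2 htS] at hnull
    exact hτ.ne' hnull
  obtain ⟨y, hy, hTl⟩ := hTy hSne l
  have hsurj : Function.Surjective (T l) := by
    rw [hTl]; exact surj_of_li _ hy.2.2
  obtain ⟨Φ, hΦ, hΦw⟩ := hc (T l) hsurj
  set M : ℝ := ‖(Φ.symm : EucSp (n + m) →L[ℝ] EucSp (n + m))‖ with hM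
  have hM0 : 0 ≤ M := norm_nonneg _
  have hL0 : (0:ℝ) ≤ L := L.2
  let Gm : EucSp (n + m) →L[ℝ] EucSp (n + m) :=
    (1 / 2 : ℝ) • (Φ : EucSp (n + m) →L[ℝ] EucSp (n + m))
  let Gi : EucSp (n + m) →L[ℝ] EucSp (n + m) :=
    (2 : ℝ) • (Φ.symm : EucSp (n + m) →L[ℝ] EucSp (n + m))
  have hGm : ∀ x, Gm x = (1 / 2 : ℝ) • Φ x := fun x => rfl
  have hGi : ∀ x, Gi x = (2 : ℝ) • Φ.symm x := fun x => rfl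
  have hGiGm : ∀ x, Gi (Gm x) = x := fun x => by
    rw [hGm, hGi, map_smul, Φ.symm_apply_apply, smul_smul]; norm_num
  have hGmGi : ∀ x, Gm (Gi x) = x := fun x => by
    rw [hGm, hGi, map_smul, Φ.apply_symm_apply, smul_smul]; norm_num
  have himg : Gm '' univ = univ := by
    rw [image_univ]; exact range_eq_univ.2 fun y => ⟨Gi y, hGmGi y⟩
  refine ⟨S τ ∩ t l, univ, Gm, Gi, n + 2 * L * M + 1, fun x hx => hx.1.1, hl, subset_univ _,
    ⟨isOpen_univ, ?_, fun x _ => hGiGm x, fun x _ => hGmGi x, Gm.contDiff.contDiffOn,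
      Gi.contDiff.contDiffOn, max ‖Gm‖₊ ‖Gi‖₊, ?_, ?_⟩, by positivity, ?_⟩
  · rw [himg]; exact isOpen_univ
  · exact (Gm.lipschitz.weaken (le_max_left _ _)).lipschitzOnWith
  · exact (Gi.lipschitz.weaken (le_max_right _ _)).lipschitzOnWith
  rintro _ ⟨p, hp, rfl⟩ _ ⟨q, hq, rfl⟩ hpq
  rw [hGiGm, hGiGm]
  set d : ℝ := dist (f p) (f q) with hd
  have hd0 : 0 ≤ d := dist_nonneg
  have hdiff : Gm p - Gm q = (1 / 2 : ℝ) • Φ (p - q) := by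
    rw [hGm, hGm, map_sub, smul_sub]
  have hnat : ∀ i : Fin m, Φ (p - q) (Fin.natAdd n i) = 0 := by
    intro i
    have h1 := hpq i
    rw [← sub_eq_zero] at h1
    have h2 : (Gm p - Gm q) (Fin.natAdd n i) = 0 := h1
    rw [hdiff] at h2
    simpa using h2
  obtain ⟨hw1, hw2⟩ := hΦw (p - q) hnat
  have hTd : ‖T l (p - q)‖ ≤ 2 * d := by
    have h1 := hTa l p hp q hq
    have h2 : ‖(fun i : Fin n => g (τ i) p) - fun i : Fin n => g (τ i) q‖ ≤ d :=
      (pi_norm_le_iff_of_nonneg hd0).2 fun i => hgd p hp.1.1 q hq.1.1 (τ i)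
    have h3 := norm_le_norm_add_norm_sub
      ((fun i : Fin n => g (τ i) p) - fun i : Fin n => g (τ i) q) (T l (p - q))
    linarith
  have hdist : dist (Gm p) (Gm q) = 1 / 2 * ‖Φ (p - q)‖ := by
    rw [dist_eq_norm, hdiff, norm_smul]; norm_num
  refine ⟨?_, ?_, ?_⟩
  · rw [inv_mul_le_iff₀ (by positivity), hdist]
    have h1 : (n:ℝ) * ‖T l (p - q)‖ ≤ n * (2 * d) := by gcongr
    have h2 : 0 ≤ 2 * L * M * d := by positivity
    nlinarith
  · have h1 : d ≤ L * ‖p - q‖ := by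
      rw [← dist_eq_norm]; exact hL.dist_le_mul p hp.1.1 q hq.1.1
    have h2 : ‖p - q‖ ≤ M * ‖Φ (p - q)‖ := by
      have := (Φ.symm : EucSp (n + m) →L[ℝ] EucSp (n + m)).le_opNorm (Φ (p - q))
      simpa using this
    have h3 : (L:ℝ) * ‖p - q‖ ≤ L * (M * ‖Φ (p - q)‖) := by gcongr
    rw [hdist]
    have h4 : 0 ≤ (n:ℝ) * ‖Φ (p - q)‖ := by positivity
    nlinarith [norm_nonneg (Φ (p - q))]
  · intro i
    have h1 : Gm p (Fin.castAdd m i) - Gm q (Fin.castAdd m i) = 1 / 2 * T l (p - q) i := by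
      have : (Gm p - Gm q) (Fin.castAdd m i) = 1 / 2 * T l (p - q) i := by
        rw [hdiff, ← hΦ]; simp
      exact this
    rw [h1, abs_mul, abs_of_pos (by norm_num : (0:ℝ) < 1 / 2)]
    have h2 := norm_le_pi_norm (T l (p - q)) i
    rw [Real.norm_eq_abs] at h2
    linarith

end
end

section
/- Let X be a metric space, A ⊂ ℝ^{n+m} a measurable set of positive Lebesgue measure, and f : A → X a Lipschitz map. If Θ^{*n}(f,x) > 0 for almost every x ∈ A, then for ℋ^n-almost every z ∈ X the fiber f⁻¹(z) is countably ℋ^m-rectifiable. -/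
open MeasureTheory Metric Set Filter
open scoped ENNReal NNReal Topology

noncomputable section

/-- A set `E ⊆ ℝ^N` is countably `ℋ^m`-rectifiable: there are Lipschitz maps
`gᵢ : Eᵢ → ℝ^N` with `Eᵢ ⊆ ℝ^m` such that `ℋ^m(E \ ⋃ᵢ gᵢ(Eᵢ)) = 0`. -/
def CountablyHmRectifiable (m N : ℕ) (E : Set (EucSp N)) : Prop :=
  ∃ (g : ℕ → EucSp m → EucSp N) (S : ℕ → Set (EucSp m)),
    (∀ i, ∃ L : ℝ≥0, LipschitzOnWith L (g i) (S i)) ∧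
    μH[(m : ℝ)] (E \ ⋃ i, g i '' S i) = 0

/-- Normalisation-free Hausdorff content, as an outer measure. -/
def hcont {X : Type*} [PseudoEMetricSpace X] (n : ℕ) (hn : n ≠ 0) : OuterMeasure X :=
  OuterMeasure.ofFunction (fun s => ediam s ^ n) (by simp [hn])

lemma hcont_le {X : Type*} [PseudoEMetricSpace X] (n : ℕ) (hn : n ≠ 0) (E : Set X)
    (C : ℕ → Set X) (h : E ⊆ ⋃ i, C i) : hcont n hn E ≤ ∑' i, ediam (C i) ^ n := by
  unfold hcont
  rw [OuterMeasure.ofFunction_apply]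
  exact iInf₂_le C h

lemma hcont_le_diam {X : Type*} [PseudoEMetricSpace X] (n : ℕ) (hn : n ≠ 0) (E : Set X) :
    hcont n hn E ≤ ediam E ^ n :=
  OuterMeasure.ofFunction_le E

lemma hcont_exists {X : Type*} [PseudoEMetricSpace X] (n : ℕ) (hn : n ≠ 0) (E : Set X)
    (ε : ℝ≥0∞) (h : hcont n hn E < ε) :
    ∃ C : ℕ → Set X, E ⊆ (⋃ i, C i) ∧ ∑' i, ediam (C i) ^ n < ε := by
  unfold hcont at h
  rw [OuterMeasure.ofFunction_apply] at h
  simp only [iInf_lt_iff] at h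
  obtain ⟨C, hC, h⟩ := h
  exact ⟨C, hC, h⟩

lemma hausdorff_zero_of_hcont {X : Type*} [MetricSpace X] [MeasurableSpace X] [BorelSpace X]
    (n : ℕ) (hn : n ≠ 0) (E : Set X) (h : hcont n hn E = 0) : μH[(n : ℝ)] E = 0 := by
  have H : ∀ k : ℕ, ∃ C : ℕ → Set X, E ⊆ (⋃ i, C i) ∧
      ∑' i, ediam (C i) ^ n < ((k : ℝ≥0∞) + 1)⁻¹ ^ n := by
    intro k
    apply hcont_exists n hn
    rw [h]
    apply ENNReal.pow_pos
    simp
  choose C hC hsum using H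
  have hlim : Tendsto (fun k : ℕ => ((k : ℝ≥0∞) + 1)⁻¹) atTop (𝓝 0) := by
    have := (tendsto_add_atTop_iff_nat 1).2 ENNReal.tendsto_inv_nat_nhds_zero
    simpa using this
  have h2 := Measure.hausdorffMeasure_le_liminf_tsum (ι := fun _ : ℕ => ℕ) (n : ℝ) E (l := atTop)
    (fun k : ℕ => ((k : ℝ≥0∞) + 1)⁻¹) hlim C (by
      refine Eventually.of_forall fun k i => ?_
      have : ediam (C k i) ^ n ≤ ((k : ℝ≥0∞) + 1)⁻¹ ^ n :=
        (ENNReal.le_tsum i).trans (hsum k).le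
      exact (ENNReal.pow_le_pow_left_iff hn).1 this) (Eventually.of_forall hC)
  refine le_antisymm (h2.trans ?_) (zero_le)
  have hl2 : Tendsto (fun k : ℕ => ((k : ℝ≥0∞) + 1)⁻¹ ^ n) atTop (𝓝 0) := by
    have := ENNReal.Tendsto.pow (n := n) hlim
    simpa [hn] using this
  rw [← hl2.liminf_eq]
  refine liminf_le_liminf (Eventually.of_forall fun k => ?_)
  simpa using (hsum k).le

lemma hcont_zero_of_hausdorff {X : Type*} [MetricSpace X] [MeasurableSpace X] [BorelSpace X]
    (n : ℕ) (hn : n ≠ 0) (E : Set X) (h : μH[(n : ℝ)] E = 0) : hcont n hn E = 0 := by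
  rw [Measure.hausdorffMeasure_apply] at h
  simp only [ENNReal.iSup_eq_zero] at h
  have := h 1 (by simp)
  refine le_antisymm ?_ (zero_le)
  rw [← this]
  refine le_iInf fun t => le_iInf fun ht => le_iInf fun _ => ?_
  refine (hcont_le n hn E t ht).trans (ENNReal.tsum_le_tsum fun i => ?_)
  rcases (t i).eq_empty_or_nonempty with h0 | h0
  · simp [h0, hn]
  · simp [h0]

lemma weighted_finite {X : Type*} [MetricSpace X] (n : ℕ) (hn : n ≠ 0) (B : ℕ → Set X)
    (hB : ∀ i, ediam (B i) ≠ ∞) (E : Set X) (s : Finset ℕ) :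
    ∀ (w : ℕ → ℝ≥0) (c : ℝ≥0),
    (∀ z ∈ E, c ≤ ∑ i ∈ s, (B i).indicator (fun _ => w i) z) →
    (c : ℝ≥0∞) * hcont n hn E ≤ 5 ^ n * ∑ i ∈ s, (w i : ℝ≥0∞) * ediam (B i) ^ n := by
  classical
  induction s using Finset.strongInduction with
  | H s ih =>
  intro w c hw
  rcases E.eq_empty_or_nonempty with rfl | ⟨z0, hz0⟩
  · simp
  rcases eq_or_ne c 0 with rfl | hc
  · simp
  set t : Set ℕ := {i | i ∈ s ∧ (B i).Nonempty} with ht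
  have htfin : t.Finite := s.finite_toSet.subset fun i hi => hi.1
  obtain ⟨R, hR⟩ : ∃ R : ℝ, ∀ a ∈ t, (ediam (B a)).toReal ≤ R := by
    obtain ⟨R, hR⟩ := (htfin.image (fun a => (ediam (B a)).toReal)).bddAbove
    exact ⟨R, fun a ha => hR ⟨a, ha, rfl⟩⟩
  obtain ⟨u, hut, hdisj, hu⟩ := Vitali.exists_disjoint_subfamily_covering_enlargement B t
    (fun a => (ediam (B a)).toReal) 2 (by norm_num) (fun a _ => ENNReal.toReal_nonneg) R hR
    (fun a ha => ha.2)
  set U : Finset ℕ := s.filter (· ∈ u) with hU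
  have hUu : ∀ i, i ∈ U ↔ i ∈ u := fun i => by
    simp only [hU, Finset.mem_filter, and_iff_right_iff_imp]
    exact fun hi => (hut hi).1
  have hmem : ∀ z ∈ E, ∃ i ∈ t, z ∈ B i := by
    intro z hz
    by_contra! hcon
    have := hw z hz
    rw [Finset.sum_eq_zero] at this
    · exact hc (le_antisymm this (zero_le))
    · intro i hi
      apply indicator_of_notMem
      intro hzi
      exact hcon i ⟨hi, ⟨z, hzi⟩⟩ hzi
  have hcov : hcont n hn E ≤ ∑ b ∈ U, 5 ^ n * ediam (B b) ^ n := by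
    let S : ℕ → Set X := fun b => ⋃ a ∈ {a | (B a ∩ B b).Nonempty ∧ ediam (B a) ≤ 2 * ediam (B b)}, B a
    have hES : E ⊆ ⋃ b ∈ U, S b := by
      intro z hz
      obtain ⟨a, ha, hza⟩ := hmem z hz
      obtain ⟨b, hb, hab, hd⟩ := hu a ha
      refine mem_biUnion (show b ∈ (U : Set ℕ) from (hUu b).2 hb) ?_
      refine mem_biUnion (show a ∈ {a | (B a ∩ B b).Nonempty ∧ ediam (B a) ≤ 2 * ediam (B b)} from ⟨hab, ?_⟩) hza
      rw [← ENNReal.toReal_le_toReal (hB a) (ENNReal.mul_ne_top (by simp) (hB b))]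
      simpa using hd
    refine (measure_mono hES).trans ((measure_biUnion_finset_le U S).trans ?_)
    refine Finset.sum_le_sum fun b _ => (hcont_le_diam n hn _).trans ?_
    rw [← mul_pow]
    gcongr
    refine ediam_le ?_
    intro p hp q hq
    simp only [S, mem_iUnion, mem_ofPred_eq, exists_prop] at hp hq
    obtain ⟨a, ⟨⟨p', hp'a, hp'b⟩, hda⟩, hpa⟩ := hp
    obtain ⟨a', ⟨⟨q', hq'a, hq'b⟩, hda'⟩, hqa⟩ := hq
    calc edist p q ≤ edist p p' + edist p' q' + edist q' q := edist_triangle4 _ _ _ _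
      _ ≤ 2 * ediam (B b) + ediam (B b) + 2 * ediam (B b) := by
        gcongr
        · exact (edist_le_ediam_of_mem hpa hp'a).trans hda
        · exact edist_le_ediam_of_mem hp'b hq'b
        · exact (edist_le_ediam_of_mem hq'a hqa).trans hda'
      _ = 5 * ediam (B b) := by ring
  have hUne : U.Nonempty := by
    obtain ⟨a, ha, _⟩ := hmem z0 hz0
    obtain ⟨b, hb, _⟩ := hu a ha
    exact ⟨b, (hUu b).2 hb⟩
  obtain ⟨i0, hi0, hmin⟩ := Finset.exists_min_image U w hUne
  have hUs : U ⊆ s := Finset.filter_subset _ _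
  rcases le_or_gt c (w i0) with hcw | hcw
  · calc (c : ℝ≥0∞) * hcont n hn E ≤ c * ∑ b ∈ U, 5 ^ n * ediam (B b) ^ n := by gcongr
      _ = 5 ^ n * ∑ b ∈ U, c * ediam (B b) ^ n := by
        rw [Finset.mul_sum, Finset.mul_sum]; refine Finset.sum_congr rfl fun _ _ => by ring
      _ ≤ 5 ^ n * ∑ b ∈ U, w b * ediam (B b) ^ n := by
        gcongr with b hb
        exact hcw.trans (hmin b hb)
      _ ≤ _ := by gcongr
  · set T := w i0 with hT
    let w' : ℕ → ℝ≥0 := fun i => if i ∈ U then w i - T else w i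
    have hw'0 : w' i0 = 0 := by simp [w', hi0, hT]
    have hsplit : ∀ i, w i = (if i ∈ U then T else 0) + w' i := by
      intro i
      by_cases hi : i ∈ U
      · simp only [w', hi, if_true]; rw [add_tsub_cancel_of_le (hmin i hi)]
      · simp [w', hi]
    have key := ih (s.erase i0) (Finset.erase_ssubset (hUs hi0)) w' (c - T) (by
      intro z hz
      rw [tsub_le_iff_left]
      refine (hw z hz).trans ?_
      rw [Finset.sum_erase]
      · have h1 : ∑ i ∈ s, (B i).indicator (fun _ => w i) z =
          ∑ i ∈ s, (if z ∈ B i ∧ i ∈ U then T else 0) + ∑ i ∈ s, (B i).indicator (fun _ => w' i) z := by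
          rw [← Finset.sum_add_distrib]
          refine Finset.sum_congr rfl fun i _ => ?_
          by_cases hz : z ∈ B i
          · simp only [indicator_of_mem hz, hz, true_and]; exact hsplit i
          · simp [hz]
        rw [h1]
        gcongr
        rw [← Finset.sum_filter, Finset.sum_const, nsmul_eq_mul]
        have : (s.filter (fun i => z ∈ B i ∧ i ∈ U)).card ≤ 1 := by
          rw [Finset.card_le_one]
          intro a ha b hb
          simp only [Finset.mem_filter] at ha hb
          by_contra hne
          exact (Set.disjoint_left.1 (hdisj ((hUu a).1 ha.2.2) ((hUu b).1 hb.2.2) hne)) ha.2.1 hb.2.1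
        calc _ ≤ (1 : ℝ≥0) * T := by gcongr; exact_mod_cast this
          _ = T := one_mul _
      · simp [hw'0, indicator])
    have hcT : (c : ℝ≥0∞) = T + ((c - T : ℝ≥0) : ℝ≥0∞) := by
      rw [← ENNReal.coe_add, add_tsub_cancel_of_le hcw.le]
    rw [hcT, add_mul]
    calc _ ≤ (T : ℝ≥0∞) * (∑ b ∈ U, 5 ^ n * ediam (B b) ^ n) +
          5 ^ n * ∑ i ∈ s.erase i0, (w' i : ℝ≥0∞) * ediam (B i) ^ n := by gcongr
      _ = 5 ^ n * (∑ i ∈ s, ((if i ∈ U then T else 0 : ℝ≥0) : ℝ≥0∞) * ediam (B i) ^ n +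
          ∑ i ∈ s, (w' i : ℝ≥0∞) * ediam (B i) ^ n) := by
        rw [mul_add]
        congr 1
        · rw [Finset.mul_sum, Finset.mul_sum]
          rw [← Finset.sum_subset hUs]
          · refine Finset.sum_congr rfl fun i hi => ?_
            simp only [hi, if_true]; ring
          · intro i _ hi; simp [hi]
        · rw [Finset.sum_erase]; simp [hw'0]
      _ = _ := by
        rw [← Finset.sum_add_distrib]
        congr 1
        refine Finset.sum_congr rfl fun i _ => ?_
        rw [← add_mul, ← ENNReal.coe_add, ← hsplit]

lemma weighted_infinite {X : Type*} [MetricSpace X] (n : ℕ) (hn : n ≠ 0) (B : ℕ → Set X)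
    (hB : ∀ i, ediam (B i) ≠ ∞) (E : Set X) (w : ℕ → ℝ≥0) (c : ℝ≥0) (hc : c ≠ 0) (ε : ℝ≥0)
    (hε : ε ≠ 0)
    (hsum : ∑' i, (w i : ℝ≥0∞) * ediam (B i) ^ n ≤ ε)
    (hw : ∀ z ∈ E, (c : ℝ≥0∞) < ∑' i, (((B i).indicator (fun _ => w i) z : ℝ≥0) : ℝ≥0∞)) :
    hcont n hn E ≤ (5 ^ n * 4 / c) * ε := by
  set a : ℕ → ℝ≥0∞ := fun i => (w i : ℝ≥0∞) * ediam (B i) ^ n with ha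
  have hfin : ∑' i, a i ≠ ∞ := ne_top_of_le_ne_top (by simp) hsum
  have htail : Tendsto (fun k => ∑' i, a (i + k)) atTop (𝓝 0) := ENNReal.tendsto_sum_nat_add a hfin
  obtain ⟨φ, hφ, hφ2⟩ := Filter.extraction_forall_of_eventually
    (P := fun l k => ∑' i, a (i + k) ≤ ε * (4⁻¹) ^ l) (fun l => by
      refine htail.eventually_le_const ?_
      have : (0 : ℝ≥0∞) < ε := by simpa [pos_iff_ne_zero] using hε
      refine ENNReal.mul_pos this.ne' ?_
      exact (ENNReal.pow_pos (by simp) _).ne')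
  let J : ℕ → ℕ := fun l => if l = 0 then 0 else φ l
  have hJmono : Monotone J := by
    refine monotone_nat_of_le_succ fun l => ?_
    by_cases hl : l = 0
    · simp [J, hl]
    · simp only [J, hl, if_false, Nat.succ_ne_zero]
      exact (hφ (Nat.lt_succ_self l)).le
  have hJ2 : ∀ l, ∑' i, a (i + J l) ≤ ε * (4⁻¹) ^ l := by
    intro l
    by_cases hl : l = 0
    · simpa [J, hl] using hsum
    · simp only [J, hl, if_false]; exact hφ2 l
  have hJge : ∀ l, l ≤ J l := by
    intro l
    by_cases hl : l = 0
    · simp [hl]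
    · simp only [J, hl, if_false]; exact hφ.le_apply
  let El : ℕ → Set X := fun l => {z | c * (2⁻¹) ^ (l + 1) ≤
    ∑ i ∈ Finset.Ico (J l) (J (l + 1)), (B i).indicator (fun _ => w i) z}
  have hcov : E ⊆ ⋃ l, El l := by
    intro z hz
    by_contra hcon
    simp only [El, mem_iUnion, mem_ofPred_eq, not_exists, not_le] at hcon
    have hpart : ∀ L, ∑ i ∈ Finset.range (J L), (B i).indicator (fun _ => w i) z +
        c * (2⁻¹) ^ L ≤ c := by
      intro L
      induction L with
      | zero => simp [J]
      | succ L ih =>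
        rw [Finset.range_eq_Ico, ← Finset.sum_Ico_consecutive _ (Nat.zero_le _) (hJmono (Nat.le_succ L)),
          ← Finset.range_eq_Ico]
        refine le_trans ?_ ih
        have h2 : c * (2⁻¹) ^ L = c * (2⁻¹) ^ (L + 1) + c * (2⁻¹) ^ (L + 1) := by
          rw [pow_succ, ← mul_assoc, ← mul_add]
          have : (2⁻¹ : ℝ≥0) + 2⁻¹ = 1 := by
            rw [← NNReal.coe_inj]; push_cast; norm_num
          rw [this, mul_one]
        rw [h2, add_assoc]
        gcongr
        exact (hcon L).le
    have h3 := hw z hz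
    rw [ENNReal.tsum_eq_iSup_nat, lt_iSup_iff] at h3
    obtain ⟨k, hk⟩ := h3
    have h4 : ∑ i ∈ Finset.range k, (B i).indicator (fun _ => w i) z ≤ c := by
      refine le_trans ?_ ((le_add_of_nonneg_right (zero_le)).trans (hpart k))
      refine Finset.sum_le_sum_of_subset ?_
      exact Finset.range_mono (hJge k)
    rw [← ENNReal.ofNNReal_finsetSum] at hk
    exact absurd hk (not_lt.2 (by exact_mod_cast h4))
  have hEl : ∀ l, hcont n hn (El l) ≤ (5 ^ n * 2 / c * ε) * (2⁻¹) ^ l := by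
    intro l
    have h1 := weighted_finite n hn B hB (El l) (Finset.Ico (J l) (J (l + 1))) w
      (c * (2⁻¹) ^ (l + 1)) (fun z hz => hz)
    have h2 : ∑ i ∈ Finset.Ico (J l) (J (l + 1)), (w i : ℝ≥0∞) * ediam (B i) ^ n
        ≤ ε * (4⁻¹) ^ l := by
      refine le_trans ?_ (hJ2 l)
      rw [Finset.sum_Ico_eq_sum_range]
      simp_rw [add_comm (J l)]
      exact ENNReal.sum_le_tsum (f := fun i => a (i + J l)) _
    have h3 := h1.trans (mul_le_mul_right h2 _)
    set q : ℝ≥0∞ := hcont n hn (El l)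
    have hc' : (c : ℝ≥0∞) ≠ 0 := by simpa using hc
    have h2l : ((2:ℝ≥0∞)⁻¹) ^ (l+1) ≠ 0 := (ENNReal.pow_pos (by simp) _).ne'
    have h2l' : ((2:ℝ≥0∞)⁻¹) ^ (l+1) ≠ ∞ := ENNReal.pow_ne_top (by simp)
    push_cast at h3
    rw [← ENNReal.mul_le_mul_iff_right (a := (c : ℝ≥0∞) * 2⁻¹ ^ (l+1)) (mul_ne_zero hc' h2l)
      (ENNReal.mul_ne_top (by simp) h2l')]
    refine h3.trans (le_of_eq ?_)
    have h4 : (4:ℝ≥0∞)⁻¹ = 2⁻¹ * 2⁻¹ := by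
      rw [← ENNReal.mul_inv (by simp) (by simp)]; norm_num
    rw [h4, mul_pow, pow_succ, div_eq_mul_inv]
    have e1 : (c:ℝ≥0∞) * (c:ℝ≥0∞)⁻¹ = 1 := ENNReal.mul_inv_cancel hc' (by simp)
    have e2 : (2:ℝ≥0∞) * 2⁻¹ = 1 := ENNReal.mul_inv_cancel (by simp) (by simp)
    calc _ = (5 : ℝ≥0∞) ^ n * (ε * (2⁻¹ ^ l * 2⁻¹ ^ l)) * 1 * 1 := by ring
      _ = (5 : ℝ≥0∞) ^ n * (ε * (2⁻¹ ^ l * 2⁻¹ ^ l)) * ((c:ℝ≥0∞) * (c:ℝ≥0∞)⁻¹) * ((2:ℝ≥0∞) * 2⁻¹) := by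
        rw [e1, e2]
      _ = _ := by ring
  calc hcont n hn E ≤ hcont n hn (⋃ l, El l) := measure_mono hcov
    _ ≤ ∑' l, hcont n hn (El l) := measure_iUnion_le _
    _ ≤ ∑' l : ℕ, ((5 : ℝ≥0∞) ^ n * 2 / c * ε) * (2⁻¹) ^ l := ENNReal.tsum_le_tsum hEl
    _ = (5 ^ n * 2 / c * ε) * 2 := by
      rw [ENNReal.tsum_mul_left, ENNReal.tsum_geometric]
      congr 1
      rw [ENNReal.one_sub_inv_two, inv_inv]
    _ = _ := by
      rw [div_eq_mul_inv, div_eq_mul_inv]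
      ring

lemma volume_null_hausdorff (N : ℕ) (Z : Set (EucSp N)) (hZ : volume Z = 0) :
    μH[(N : ℝ)] Z = 0 := by
  have h := isAddHaarMeasure_hausdorffMeasure (E := EucSp N)
  have hr : Module.finrank ℝ (EucSp N) = N := by simp
  rw [hr] at h
  have := Measure.isAddLeftInvariant_eq_smul (μH[(N : ℝ)] : Measure (EucSp N)) volume
  rw [this]
  simp [hZ]

/-- Eilenberg inequality, null set version. -/
lemma eilenberg_null {n m : ℕ} (hn : n ≠ 0) {X : Type*} [MetricSpace X] [MeasurableSpace X]
    [BorelSpace X] (Z : Set (EucSp (n + m))) (hZ : volume Z = 0) (f : EucSp (n + m) → X)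
    (L : ℝ≥0) (hf : LipschitzOnWith L f Z) :
    ∀ᵐ z ∂(μH[(n : ℝ)] : Measure X), μH[(m : ℝ)] (f ⁻¹' {z} ∩ Z) = 0 := by
  have hH := volume_null_hausdorff _ Z hZ
  rcases Nat.eq_zero_or_pos m with rfl | hm
  · have h1 : μH[(n : ℝ)] (f '' Z) = 0 := by
      have := hf.hausdorffMeasure_image_le (d := (n : ℝ)) (by positivity)
      simp only [add_zero] at hH this
      rw [hH, mul_zero] at this
      exact le_antisymm this (zero_le)
    rw [ae_iff]
    refine measure_mono_null ?_ h1
    intro z hz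
    by_contra hcon
    apply hz
    have : f ⁻¹' {z} ∩ Z = ∅ := by
      ext x
      simp only [mem_inter_iff, mem_preimage, mem_singleton_iff, mem_empty_iff_false, iff_false]
      rintro ⟨hx, hxZ⟩
      exact hcon ⟨x, hxZ, hx⟩
    rw [this]; simp
  have hm' : m ≠ 0 := hm.ne'
  have hNm : n + m ≠ 0 := by omega
  have hcontZ := hcont_zero_of_hausdorff (n + m) hNm Z (by exact_mod_cast hH)
  let Ec : ℕ → Set X := fun k => {z | (((k : ℝ≥0) + 1)⁻¹ : ℝ≥0) < hcont m hm' (f ⁻¹' {z} ∩ Z)}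
  have hEc : ∀ k, hcont n hn (Ec k) = 0 := by
    intro k
    set c : ℝ≥0 := ((k : ℝ≥0) + 1)⁻¹ with hc
    have hc0 : c ≠ 0 := by positivity
    have main : ∀ ε : ℝ≥0, ε ≠ 0 →
        hcont n hn (Ec k) ≤ (5 ^ n * 4 / c) * (((L + 1) ^ n * ε : ℝ≥0) : ℝ≥0∞) := by
      intro ε hε
      obtain ⟨C, hC, hsum⟩ := hcont_exists (n + m) hNm Z ε (by
        rw [hcontZ]; simpa [pos_iff_ne_zero] using hε)
      have hfin : ∀ i, ediam (C i) ≠ ∞ := by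
        intro i hi
        have h1 : ediam (C i) ^ (n + m) < ε := (ENNReal.le_tsum i).trans_lt hsum
        rw [hi, ENNReal.top_pow hNm] at h1
        exact not_top_lt h1
      have hdB : ∀ i, ediam (f '' (C i ∩ Z)) ≤ (L + 1 : ℝ≥0) * ediam (C i) := by
        intro i
        rw [ediam_image_le_iff]
        intro x hx y hy
        refine (hf hx.2 hy.2).trans ?_
        gcongr
        · simp
        · exact edist_le_ediam_of_mem hx.1 hy.1
      refine weighted_infinite n hn (fun i => f '' (C i ∩ Z)) ?_ (Ec k)
        (fun i => (ediam (C i)).toNNReal ^ m) c hc0 _ (by positivity) ?_ ?_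
      · intro i
        exact ne_top_of_le_ne_top (ENNReal.mul_ne_top (by simp) (hfin i)) (hdB i)
      · calc _ ≤ ∑' i, (((L + 1 : ℝ≥0) : ℝ≥0∞)) ^ n * ediam (C i) ^ (n + m) := by
              refine ENNReal.tsum_le_tsum fun i => ?_
              rw [ENNReal.coe_pow, ENNReal.coe_toNNReal (hfin i)]
              calc _ ≤ ediam (C i) ^ m * ((L + 1 : ℝ≥0) * ediam (C i)) ^ n := by
                    gcongr; exact hdB i
                _ = _ := by ring
          _ ≤ _ := by
              rw [ENNReal.tsum_mul_left, ENNReal.coe_mul, ENNReal.coe_pow]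
              gcongr
      · intro z hz
        refine lt_of_lt_of_le hz ?_
        classical
        refine (hcont_le m hm' _ (fun i => if z ∈ f '' (C i ∩ Z) then C i else ∅) ?_).trans ?_
        · rintro x ⟨hx, hxZ⟩
          obtain ⟨i, hi⟩ := mem_iUnion.1 (hC hxZ)
          refine mem_iUnion.2 ⟨i, ?_⟩
          have : z ∈ f '' (C i ∩ Z) := ⟨x, ⟨hi, hxZ⟩, hx⟩
          simp only [this, if_true]; exact hi
        · refine ENNReal.tsum_le_tsum fun i => ?_
          by_cases hzi : z ∈ f '' (C i ∩ Z)
          · rw [indicator_of_mem hzi, if_pos hzi, ENNReal.coe_pow, ENNReal.coe_toNNReal (hfin i)]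
          · rw [if_neg hzi]; simp [hm']
    refine le_antisymm ?_ (zero_le)
    have hlim : Tendsto (fun j : ℕ => ((5 : ℝ≥0∞) ^ n * 4 / c) *
        (((L + 1) ^ n * ((j : ℝ≥0) + 1)⁻¹ : ℝ≥0) : ℝ≥0∞)) atTop (𝓝 0) := by
      have h1 : Tendsto (fun j : ℕ => (L + 1) ^ n * ((j : ℝ≥0) + 1)⁻¹) atTop (𝓝 0) := by
        have h2 : Tendsto (fun j : ℕ => ((j : ℝ≥0) + 1)⁻¹) atTop (𝓝 0) := by
          rw [← NNReal.tendsto_coe]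
          have := tendsto_one_div_add_atTop_nhds_zero_nat (𝕜 := ℝ)
          simpa using this
        simpa using h2.const_mul ((L + 1) ^ n)
      have h3 := ENNReal.tendsto_coe.2 h1
      have h4 := ENNReal.Tendsto.const_mul (a := (5 : ℝ≥0∞) ^ n * 4 / c) h3 (Or.inr (by
        refine ENNReal.div_ne_top ?_ (by simpa using hc0)
        exact ENNReal.mul_ne_top (ENNReal.pow_ne_top (by simp)) (by simp)))
      simpa using h4
    exact ge_of_tendsto' hlim fun j => main _ (by positivity)
  rw [ae_iff]
  have hsub : {z | ¬ μH[(m : ℝ)] (f ⁻¹' {z} ∩ Z) = 0} ⊆ ⋃ k, Ec k := by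
    intro z hz
    have h0 : hcont m hm' (f ⁻¹' {z} ∩ Z) ≠ 0 := fun h => hz (hausdorff_zero_of_hcont m hm' _ h)
    obtain ⟨j, hj⟩ := ENNReal.exists_inv_nat_lt h0
    refine mem_iUnion.2 ⟨j, lt_of_le_of_lt ?_ hj⟩
    rw [ENNReal.coe_inv (by positivity)]
    push_cast
    exact ENNReal.inv_le_inv.2 (by simp)
  refine measure_mono_null hsub ?_
  rw [measure_iUnion_null_iff]
  exact fun k => hausdorff_zero_of_hcont n hn _ (hEc k)

/-- Supremum of the directional derivatives. -/
def gsup {N : ℕ} (F : ℕ → EucSp N → ℝ) (q x : EucSp N) : ℝ := ⨆ i, |fderiv ℝ (F i) x q|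

lemma abs_fderiv_le {N : ℕ} {F : EucSp N → ℝ} {K : ℝ≥0} (hF : LipschitzWith K F)
    (q x : EucSp N) : |fderiv ℝ F x q| ≤ K * ‖q‖ := by
  have h := (fderiv ℝ F x).le_opNorm q
  have h2 : ‖fderiv ℝ F x‖ ≤ K := norm_fderiv_le_of_lipschitz ℝ hF
  rw [Real.norm_eq_abs] at h
  exact h.trans (by gcongr)

lemma gsup_bdd {N : ℕ} {F : ℕ → EucSp N → ℝ} {K : ℝ≥0} (hF : ∀ i, LipschitzWith K (F i))
    (q x : EucSp N) : BddAbove (range fun i => |fderiv ℝ (F i) x q|) :=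
  ⟨K * ‖q‖, by rintro _ ⟨i, rfl⟩; exact abs_fderiv_le (hF i) q x⟩

lemma le_gsup {N : ℕ} {F : ℕ → EucSp N → ℝ} {K : ℝ≥0} (hF : ∀ i, LipschitzWith K (F i))
    (q x : EucSp N) (i : ℕ) : |fderiv ℝ (F i) x q| ≤ gsup F q x :=
  le_ciSup (gsup_bdd hF q x) i

lemma gsup_le {N : ℕ} {F : ℕ → EucSp N → ℝ} {K : ℝ≥0} (hF : ∀ i, LipschitzWith K (F i))
    (q x : EucSp N) : gsup F q x ≤ K * ‖q‖ :=
  ciSup_le fun i => abs_fderiv_le (hF i) q x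

lemma gsup_nonneg {N : ℕ} {F : ℕ → EucSp N → ℝ} {K : ℝ≥0} (hF : ∀ i, LipschitzWith K (F i))
    (q x : EucSp N) : 0 ≤ gsup F q x :=
  (abs_nonneg _).trans (le_gsup hF q x 0)

lemma measurable_gsup {N : ℕ} {F : ℕ → EucSp N → ℝ} {K : ℝ≥0}
    (hF : ∀ i, LipschitzWith K (F i)) (q : EucSp N) : Measurable (gsup F q) := by
  unfold gsup
  refine Measurable.iSup fun i => ?_
  exact (measurable_fderiv_apply_const ℝ (F i) q).abs

lemma locint_gsup {N : ℕ} {F : ℕ → EucSp N → ℝ} {K : ℝ≥0}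
    (hF : ∀ i, LipschitzWith K (F i)) (q : EucSp N) : LocallyIntegrable (gsup F q) volume := by
  refine (locallyIntegrable_const (K * ‖q‖ : ℝ)).mono
    (measurable_gsup hF q).aestronglyMeasurable (Eventually.of_forall fun x => ?_)
  rw [Real.norm_eq_abs, Real.norm_eq_abs, abs_of_nonneg (gsup_nonneg hF q x),
    abs_of_nonneg (by positivity)]
  exact gsup_le hF q x

lemma setIntegral_closedBall_translate {N : ℕ} (g : EucSp N → ℝ) (c : EucSp N) (δ : ℝ) :
    ∫ u in closedBall (0 : EucSp N) δ, g (c + u) = ∫ y in closedBall c δ, g y := by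
  have h := (measurePreserving_add_left (volume : Measure (EucSp N)) c).setIntegral_preimage_emb
    (measurableEmbedding_addLeft c) g (closedBall c δ)
  rw [← h]
  congr 2
  ext u
  simp

/-- Increment estimate through averages. -/
lemma increment_le {N : ℕ} {F : ℕ → EucSp N → ℝ} {K : ℝ≥0} (hF : ∀ i, LipschitzWith K (F i))
    (p q : EucSp N) (δ : ℝ) (hδ : 0 < δ) (r : ℝ) (hr : 0 ≤ r) (b : ℝ)
    (hb : ∀ s ∈ Icc (0 : ℝ) 1, ⨍ y in closedBall (p + (s * r) • q) δ, gsup F q y ≤ b) (i : ℕ) :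
    |F i (p + r • q) - F i p| ≤ r * b + 2 * K * δ := by
  set μ : Measure (EucSp N) := volume.restrict (closedBall (0 : EucSp N) δ) with hμ
  set M : ℝ := volume.real (closedBall (0 : EucSp N) δ) with hM
  have hMpos : 0 < M := by
    rw [hM]
    exact ENNReal.toReal_pos (measure_closedBall_pos _ _ hδ).ne' measure_closedBall_lt_top.ne
  have : IsFiniteMeasure μ := ⟨by
    rw [hμ, Measure.restrict_apply_univ]; exact measure_closedBall_lt_top⟩
  let G : ℝ → EucSp N → ℝ := fun s u => F i (p + (s * r) • q + u)
  let G' : ℝ → EucSp N → ℝ := fun s u => r * fderiv ℝ (F i) (p + (s * r) • q + u) q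
  have hGcont : ∀ s, Continuous (G s) := fun s => by
    have := (hF i).continuous
    fun_prop
  have hGint : ∀ s, Integrable (G s) μ := fun s =>
    ((hGcont s).continuousOn.integrableOn_compact (isCompact_closedBall 0 δ))
  have hMv : ∀ c : EucSp N, volume.real (closedBall c δ) = M := by
    intro c
    rw [hM, Measure.real, Measure.real, Measure.addHaar_closedBall_center]
  have hderiv : ∀ s, Integrable (G' s) μ ∧ HasDerivAt (fun s => ∫ u, G s u ∂μ) (∫ u, G' s u ∂μ) s := by
    intro s
    refine hasDerivAt_integral_of_dominated_loc_of_lip (bound := fun _ => (K * (r * ‖q‖) : ℝ))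
      (s := univ) univ_mem (Eventually.of_forall fun s => (hGcont s).aestronglyMeasurable)
      (hGint s) ?_ ?_ (integrable_const _) ?_
    · refine Measurable.aestronglyMeasurable ?_
      refine Measurable.const_mul ?_ _
      exact (measurable_fderiv_apply_const ℝ (F i) q).comp (measurable_const_add _)
    · refine Eventually.of_forall fun u => ?_
      refine LipschitzWith.lipschitzOnWith ?_
      refine LipschitzWith.of_dist_le_mul fun a b => ?_
      refine ((hF i).dist_le_mul _ _).trans ?_
      rw [Real.coe_nnabs, abs_of_nonneg (by positivity), dist_eq_norm, Real.dist_eq]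
      have : p + (a * r) • q + u - (p + (b * r) • q + u) = ((a - b) * r) • q := by
        module
      rw [this, norm_smul, Real.norm_eq_abs, abs_mul, abs_of_nonneg hr]
      apply le_of_eq; ring
    · have hae : ∀ᵐ u : EucSp N, DifferentiableAt ℝ (F i) (p + (s * r) • q + u) := by
        have h1 := (hF i).ae_differentiableAt (μ := (volume : Measure (EucSp N)))
        exact (measurePreserving_add_left (volume : Measure (EucSp N)) (p + (s * r) • q)).quasiMeasurePreserving.ae h1
      refine ae_restrict_of_ae ?_
      filter_upwards [hae] with u hu
      have h2 : HasDerivAt (fun s : ℝ => p + (s * r) • q + u) (r • q) s := by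
        have h3 : HasDerivAt (fun s : ℝ => s * r) r s := by
          simpa using (hasDerivAt_id s).mul_const r
        exact ((h3.smul_const q).const_add p).add_const u
      have h4 := hu.hasFDerivAt.comp_hasDerivAt s h2
      simpa [G, G', Function.comp_def] using h4
  have hbound : ∀ s ∈ Icc (0 : ℝ) 1, ‖∫ u, G' s u ∂μ‖ ≤ r * b * M := by
    intro s hs
    have h1 : ‖∫ u, G' s u ∂μ‖ ≤ ∫ u, r * gsup F q (p + (s * r) • q + u) ∂μ := by
      refine norm_integral_le_of_norm_le ?_ (Eventually.of_forall fun u => ?_)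
      · refine Integrable.const_mul ?_ _
        refine Integrable.of_bound (C := K * ‖q‖) ?_ (Eventually.of_forall fun u => ?_)
        · exact ((measurable_gsup hF q).comp (measurable_const_add _)).aestronglyMeasurable
        · rw [Real.norm_eq_abs, abs_of_nonneg (gsup_nonneg hF _ _)]
          exact gsup_le hF _ _
      · simp only [G']
        rw [Real.norm_eq_abs, abs_mul, abs_of_nonneg hr]
        gcongr
        exact le_gsup hF _ _ i
    refine h1.trans ?_
    rw [integral_const_mul, hμ, setIntegral_closedBall_translate (gsup F q)]
    have h2 := hb s hs
    rw [setAverage_eq, hMv, smul_eq_mul, inv_mul_le_iff₀ hMpos] at h2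
    calc _ ≤ r * (M * b) := by gcongr
      _ = _ := by ring
  have hmv := norm_image_sub_le_of_norm_deriv_le_segment_01' (f := fun s => ∫ u, G s u ∂μ)
    (f' := fun s => ∫ u, G' s u ∂μ) (C := r * b * M)
    (fun s _ => (hderiv s).2.hasDerivWithinAt) (fun s hs => hbound s ⟨hs.1, hs.2.le⟩)
  have hclose : ∀ s, |∫ u, G s u ∂μ - M * F i (p + (s * r) • q)| ≤ K * δ * M := by
    intro s
    have h1 : M * F i (p + (s * r) • q) = ∫ u, F i (p + (s * r) • q) ∂μ := by
      rw [integral_const, smul_eq_mul, hμ, measureReal_restrict_apply_univ]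
    rw [h1, ← integral_sub (hGint s) (integrable_const _)]
    have h2 := norm_setIntegral_le_of_norm_le_const (μ := (volume : Measure (EucSp N)))
      (s := closedBall 0 δ) (C := K * δ) (f := fun u => G s u - F i (p + (s * r) • q))
      measure_closedBall_lt_top (by
        intro u hu
        rw [Real.norm_eq_abs, ← Real.dist_eq]
        refine ((hF i).dist_le_mul _ _).trans ?_
        gcongr
        rw [dist_eq_norm]
        simpa using hu)
    simpa using h2
  have h0 := hclose 0
  have h1 := hclose 1
  simp only [zero_mul, zero_smul, add_zero, one_mul, Real.norm_eq_abs] at h0 h1 hmv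
  have : M * |F i (p + r • q) - F i p| ≤ M * (r * b + 2 * K * δ) := by
    rw [← abs_of_pos hMpos, ← abs_mul, abs_of_pos hMpos]
    rw [abs_le] at *
    constructor <;> nlinarith
  exact le_of_mul_le_mul_left this hMpos

lemma increment_dir {N : ℕ} {F : ℕ → EucSp N → ℝ} {K : ℝ≥0} (hF : ∀ i, LipschitzWith K (F i))
    (q : EucSp N) : ∀ᵐ x : EucSp N, ∀ w : EucSp N, ∀ η > (0 : ℝ), ∀ᶠ r in 𝓝[>] (0 : ℝ), ∀ i,
      |F i (x + r • w + r • q) - F i (x + r • w)| ≤ (gsup F q x + η) * r := by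
  have hae : ∀ᵐ x : EucSp N, ∀ k : ℕ, ∀ (w : ℝ × ℝ → EucSp N) (δ : ℝ × ℝ → ℝ)
      (l : Filter (ℝ × ℝ)) (_ : Tendsto δ l (𝓝[>] 0))
      (_ : ∀ᶠ j in l, x ∈ closedBall (w j) (k * δ j)),
      Tendsto (fun j => ⨍ y in closedBall (w j) (δ j), gsup F q y) l (𝓝 (gsup F q x)) := by
    rw [ae_all_iff]
    intro k
    filter_upwards [IsUnifLocDoublingMeasure.ae_tendsto_average (μ := volume) (locint_gsup hF q) k]
      with x hx w δ l h1 h2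
    exact hx w δ h1 h2
  filter_upwards [hae] with x hx w η hη
  obtain ⟨θ, hθ, hθ2⟩ : ∃ θ > (0 : ℝ), 2 * K * θ ≤ η / 2 := by
    refine ⟨η / (4 * (K + 1)), by positivity, ?_⟩
    have hK : (0 : ℝ) ≤ K := K.2
    rw [← sub_nonneg]
    have : η / 2 - 2 * K * (η / (4 * (K + 1))) = η / (2 * (K + 1)) := by
      field_simp; ring
    rw [this]; positivity
  obtain ⟨k, hk⟩ := exists_nat_ge ((‖w‖ + ‖q‖) / θ)
  have hk' : ‖w‖ + ‖q‖ ≤ k * θ := by rwa [div_le_iff₀ hθ] at hk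
  have hδ : Tendsto (fun j : ℝ × ℝ => θ * j.1) (𝓝[>] (0 : ℝ) ×ˢ 𝓟 (Icc (0 : ℝ) 1)) (𝓝[>] 0) := by
    have h1 : Tendsto (fun r : ℝ => θ * r) (𝓝[>] (0 : ℝ)) (𝓝[>] 0) := by
      refine tendsto_nhdsWithin_iff.2 ⟨?_, ?_⟩
      · have : Tendsto (fun r : ℝ => θ * r) (𝓝 0) (𝓝 (θ * 0)) := tendsto_id.const_mul θ
        rw [mul_zero] at this
        exact this.mono_left nhdsWithin_le_nhds
      · filter_upwards [self_mem_nhdsWithin] with r hr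
        exact mul_pos hθ hr
    exact h1.comp tendsto_fst
  have hT := hx k (fun j => x + j.1 • w + (j.2 * j.1) • q) (fun j => θ * j.1) _ hδ (by
    rw [eventually_prod_principal_iff]
    filter_upwards [self_mem_nhdsWithin] with r hr s hs
    have hr : 0 < r := hr
    rw [mem_closedBall, dist_eq_norm]
    have : x - (x + r • w + (s * r) • q) = - (r • (w + s • q)) := by module
    rw [this, norm_neg, norm_smul, Real.norm_eq_abs, abs_of_pos hr]
    have h2 : ‖w + s • q‖ ≤ ‖w‖ + ‖q‖ := by
      refine (norm_add_le _ _).trans ?_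
      gcongr
      rw [norm_smul, Real.norm_eq_abs, abs_of_nonneg hs.1]
      exact mul_le_of_le_one_left (norm_nonneg _) hs.2
    calc r * ‖w + s • q‖ ≤ r * (k * θ) := by gcongr; exact h2.trans hk'
      _ = _ := by ring)
  have hev := hT.eventually_le_const (show gsup F q x < gsup F q x + η / 2 by linarith)
  rw [eventually_prod_principal_iff] at hev
  filter_upwards [hev, self_mem_nhdsWithin] with r hr hr0 i
  have hr0 : 0 < r := hr0
  have := increment_le hF (x + r • w) q (θ * r) (mul_pos hθ hr0) r hr0.le _ hr i
  refine this.trans ?_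
  nlinarith

lemma increment_ker {N : ℕ} {F : ℕ → EucSp N → ℝ} {K : ℝ≥0} (hF : ∀ i, LipschitzWith K (F i)) :
    ∀ᵐ x : EucSp N, (∀ i, DifferentiableAt ℝ (F i) x) ∧
      ∀ w v : EucSp N, (∀ i, fderiv ℝ (F i) x v = 0) → ∀ η > (0 : ℝ), ∀ᶠ r in 𝓝[>] (0 : ℝ), ∀ i,
      |F i (x + r • w + r • v) - F i (x + r • w)| ≤ η * r := by
  have h1 : ∀ᵐ x : EucSp N, ∀ i, DifferentiableAt ℝ (F i) x :=
    ae_all_iff.2 fun i => (hF i).ae_differentiableAt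
  have h2 := ae_all_iff.2 fun j : ℕ => increment_dir hF (TopologicalSpace.denseSeq (EucSp N) j)
  filter_upwards [h1, h2] with x hx1 hx2
  refine ⟨hx1, fun w v hv η hη => ?_⟩
  have hK : (0 : ℝ) ≤ K := K.2
  set ε : ℝ := η / (4 * (K + 1)) with hε
  have hε0 : 0 < ε := by positivity
  have hKε : K * ε ≤ η / 4 := by
    rw [hε, ← sub_nonneg]
    have : η / 4 - K * (η / (4 * (K + 1))) = η / (4 * (K + 1)) := by
      field_simp; ring
    rw [this]; positivity
  obtain ⟨j, hj⟩ := (TopologicalSpace.denseRange_denseSeq (EucSp N)).exists_dist_lt v hε0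
  set q := TopologicalSpace.denseSeq (EucSp N) j
  rw [dist_eq_norm] at hj
  have hgq : gsup F q x ≤ K * ε := by
    refine ciSup_le fun i => ?_
    have h3 : fderiv ℝ (F i) x q = - fderiv ℝ (F i) x (v - q) := by rw [map_sub, hv i]; simp
    rw [h3, abs_neg]
    exact (abs_fderiv_le (hF i) _ _).trans (by gcongr)
  filter_upwards [hx2 j w (η / 4) (by positivity), self_mem_nhdsWithin] with r hr hr0 i
  have hr0 : 0 < r := hr0
  have h4 : |F i (x + r • w + r • v) - F i (x + r • w + r • q)| ≤ K * (r * ε) := by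
    rw [← Real.dist_eq]
    refine ((hF i).dist_le_mul _ _).trans ?_
    gcongr
    rw [dist_eq_norm]
    have : x + r • w + r • v - (x + r • w + r • q) = r • (v - q) := by module
    rw [this, norm_smul, Real.norm_eq_abs, abs_of_pos hr0]
    gcongr
  have h5 := hr i
  have h6 : (gsup F q x + η / 4) * r ≤ (η / 2) * r := by gcongr; linarith
  have h7 : K * (r * ε) ≤ η / 4 * r := by nlinarith
  calc _ ≤ |F i (x + r • w + r • v) - F i (x + r • w + r • q)| +
        |F i (x + r • w + r • q) - F i (x + r • w)| := abs_sub_le _ _ _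
    _ ≤ η / 4 * r + η / 2 * r := by gcongr; exacts [h4.trans h7, h5.trans h6]
    _ ≤ η * r := by nlinarith

lemma hContent_eq_hcont {X : Type*} [PseudoEMetricSpace X] (n : ℕ) (hn : n ≠ 0) (E : Set X)
    (hE : hcont n hn E ≠ ⊤) :
    hContent n E ≤ unitBallVol n * hcont n hn E := by
  have hone : unitBallVol n / 2 ^ n ≤ unitBallVol n := by
    refine ENNReal.div_le_of_le_mul ?_
    exact le_mul_of_one_le_right zero_le (one_le_pow₀ (by norm_num))
  have hfin : unitBallVol n ≠ ⊤ := measure_ball_lt_top.ne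
  refine ENNReal.le_of_forall_pos_le_add fun ε hε _ => ?_
  have hpos : unitBallVol n ≠ 0 := (measure_ball_pos _ _ one_pos).ne'
  have hlt : hcont n hn E < hcont n hn E + ε / unitBallVol n :=
    ENNReal.lt_add_right hE (ENNReal.div_pos (by exact_mod_cast hε.ne') hfin).ne'
  obtain ⟨C, hC, hs⟩ := hcont_exists n hn E _ hlt
  calc hContent n E ≤ unitBallVol n / 2 ^ n * ∑' i, ediam (C i) ^ n := iInf₂_le C hC
    _ ≤ unitBallVol n * (hcont n hn E + ε / unitBallVol n) := mul_le_mul' hone hs.le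
    _ = unitBallVol n * hcont n hn E + ε := by
      rw [mul_add, ENNReal.mul_div_cancel hpos hfin]

lemma exists_grid {N d : ℕ} (V : Submodule ℝ (EucSp N)) (hd : Module.finrank ℝ Vᗮ = d)
    (k : ℕ) (hk : 0 < k) :
    ∃ P : Finset (EucSp N), P.card ≤ (2 * k + 1) ^ d ∧
      ∀ w ∈ Vᗮ, ‖w‖ ≤ 1 → ∃ q ∈ P, ‖w - q‖ ≤ d / k := by
  classical
  let e : OrthonormalBasis (Fin d) ℝ Vᗮ := (stdOrthonormalBasis ℝ Vᗮ).reindex (finCongr hd)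
  let ww : (Fin d → ℤ) → EucSp N := fun j => ∑ a, ((j a : ℝ) / k) • (e a : EucSp N)
  refine ⟨(Fintype.piFinset (fun _ : Fin d => Finset.Icc (-(k:ℤ)) k)).image ww, ?_, ?_⟩
  · refine Finset.card_image_le.trans ?_
    rw [Fintype.card_piFinset]
    simp only [Int.card_Icc, Finset.prod_const, Finset.card_univ, Fintype.card_fin]
    refine Nat.pow_le_pow_left ?_ d
    omega
  · intro w hw hw1
    have hk0 : (0 : ℝ) < k := by exact_mod_cast hk
    let c : Fin d → ℝ := fun a => inner ℝ (e a) (⟨w, hw⟩ : Vᗮ)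
    have hc : ∀ a, |c a| ≤ 1 := by
      intro a
      have h1 := abs_real_inner_le_norm (e a) (⟨w, hw⟩ : Vᗮ)
      rw [e.norm_eq_one, one_mul] at h1
      exact h1.trans hw1
    have hsum : w = ∑ a, c a • (e a : EucSp N) := by
      have h1 := congrArg Subtype.val (e.sum_repr' (⟨w, hw⟩ : Vᗮ))
      simp only [Submodule.coe_sum, Submodule.coe_smul] at h1
      exact h1.symm
    let j : Fin d → ℤ := fun a => ⌊(k : ℝ) * c a⌋
    refine ⟨ww j, Finset.mem_image_of_mem _ ?_, ?_⟩
    · rw [Fintype.mem_piFinset]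
      intro a
      have h1 := abs_le.1 (hc a)
      rw [Finset.mem_Icc]
      constructor
      · rw [Int.le_floor]
        push_cast
        nlinarith
      · rw [Int.floor_le_iff]
        push_cast
        nlinarith
    · have : w - ww j = ∑ a, (c a - (j a : ℝ) / k) • (e a : EucSp N) := by
        simp only [ww, sub_smul, Finset.sum_sub_distrib]
        rw [← hsum]
      rw [this]
      refine (norm_sum_le _ _).trans ?_
      calc _ ≤ ∑ _a : Fin d, (1 : ℝ) / k := by
            refine Finset.sum_le_sum fun a _ => ?_
            have h2 : ‖(e a : EucSp N)‖ = 1 := e.norm_eq_one a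
            rw [norm_smul, h2, mul_one, Real.norm_eq_abs, abs_le]
            have h3 := Int.floor_le ((k : ℝ) * c a)
            have h4 := Int.lt_floor_add_one ((k : ℝ) * c a)
            have h5 : c a - (j a : ℝ) / k = (k * c a - j a) / k := by field_simp
            have h6 : (0 : ℝ) ≤ k * c a - j a := by simp only [j]; linarith
            have h7 : k * c a - j a ≤ (1 : ℝ) := by simp only [j]; linarith
            rw [h5]
            constructor
            · have : (0 : ℝ) ≤ (k * c a - j a) / k := by positivity
              have : (0 : ℝ) ≤ 1 / k := by positivity
              linarith
            · gcongr
        _ = d / k := by simp [div_eq_mul_inv]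

lemma density_bound {n m : ℕ} (hn : n ≠ 0) {X : Type*} [MetricSpace X]
    (A : Set (EucSp (n + m))) (f : EucSp (n + m) → X) (p : ℕ → X)
    (F : ℕ → EucSp (n + m) → ℝ) (K : ℝ≥0) (hF : ∀ i, LipschitzWith K (F i))
    (hFA : ∀ x ∈ A, ∀ i, F i x = dist (f x) (p i))
    (hp : ∀ x ∈ A, ∀ ε > 0, ∃ i, dist (f x) (p i) < ε)
    (x0 : EucSp (n + m)) (V : Submodule ℝ (EucSp (n + m))) (hV : m < Module.finrank ℝ V)
    (hker : ∀ w, ∀ v ∈ V, ∀ η > 0, ∀ᶠ r in 𝓝[>] (0 : ℝ), ∀ i,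
      |F i (x0 + r • w + r • v) - F i (x0 + r • w)| ≤ η * r) (k : ℕ) (hk : 0 < k) :
    ∀ᶠ r in 𝓝[>] (0 : ℝ), hContent n (f '' (Metric.ball x0 r ∩ A)) /
      (unitBallVol n * ENNReal.ofReal r ^ n) ≤
        ENNReal.ofReal (3 ^ n * (2 * (K * (n + m + 1) + 1)) ^ n / k) := by
  classical
  have hk0 : (0 : ℝ) < k := by exact_mod_cast hk
  obtain ⟨d, hd⟩ : ∃ d, Module.finrank ℝ Vᗮ = d := ⟨_, rfl⟩
  have hdn : d + 1 ≤ n := by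
    have := Submodule.finrank_add_finrank_orthogonal V
    rw [hd] at this
    simp at this
    omega
  obtain ⟨P, hPc, hP⟩ := exists_grid V hd k hk
  obtain ⟨T, hTV, hTfin, hT⟩ : ∃ T ⊆ (V : Set (EucSp (n + m))) ∩ closedBall 0 1, T.Finite ∧
      (V : Set (EucSp (n + m))) ∩ closedBall 0 1 ⊆ ⋃ x ∈ T, ball x (1 / (k : ℝ)) :=
    finite_cover_balls_of_compact
      ((isCompact_closedBall _ _).inter_left V.closed_of_finiteDimensional) (by positivity)
  have hev : ∀ᶠ r in 𝓝[>] (0 : ℝ), ∀ q ∈ P, ∀ v ∈ T, ∀ i,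
      |F i (x0 + r • q + r • v) - F i (x0 + r • q)| ≤ 1 / k * r := by
    rw [Filter.eventually_all_finset]
    intro q _
    rw [Filter.eventually_all_finite hTfin]
    intro v hv
    exact hker q v (hTV hv).1 _ (by positivity)
  filter_upwards [hev, self_mem_nhdsWithin] with r hr hr0
  rw [mem_Ioi] at hr0
  set M : ℝ := K * (n + m + 1) + 1 with hM
  have hM0 : 0 < M := by positivity
  let S : EucSp (n + m) → Set X := fun q =>
    {z | ∃ x ∈ A, f x = z ∧ ∀ i, |F i x - F i (x0 + r • q)| ≤ M * r / k}
  have hcov : f '' (ball x0 r ∩ A) ⊆ ⋃ q ∈ P, S q := by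
    rintro z ⟨x, ⟨hxr, hxA⟩, rfl⟩
    let u : EucSp (n + m) := r⁻¹ • (x - x0)
    have hu : ‖u‖ ≤ 1 := by
      rw [mem_ball, dist_eq_norm] at hxr
      simp only [u, norm_smul, norm_inv, Real.norm_eq_abs, abs_of_pos hr0]
      rw [inv_mul_le_iff₀ hr0, mul_one]
      exact hxr.le
    have hx : x = x0 + r • u := by
      simp [u, smul_smul, hr0.ne']
    have hv : V.starProjection u ∈ V := V.starProjection_apply_mem u
    have hw : u - V.starProjection u ∈ Vᗮ := V.sub_starProjection_mem_orthogonal u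
    have hv1 : ‖V.starProjection u‖ ≤ 1 := (V.norm_starProjection_apply_le u).trans hu
    have hw1 : ‖u - V.starProjection u‖ ≤ 1 := by
      rw [← Submodule.starProjection_orthogonal_val]
      exact (Vᗮ.norm_starProjection_apply_le u).trans hu
    set v := V.starProjection u
    set w := u - v with hwdef
    obtain ⟨q, hq, hwq⟩ := hP w hw hw1
    obtain ⟨t, ht, hvt⟩ := mem_iUnion₂.1 (hT ⟨hv, by simpa using hv1⟩)
    refine mem_iUnion₂.2 ⟨q, hq, x, hxA, rfl, fun i => ?_⟩
    have h1 := hr q hq t ht i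
    have h2 : |F i x - F i (x0 + r • q + r • t)| ≤ K * (r * (d / k + 1 / k)) := by
      have h3 := (hF i).dist_le_mul x (x0 + r • q + r • t)
      rw [Real.dist_eq] at h3
      refine h3.trans ?_
      gcongr
      have h4 : x - (x0 + r • q + r • t) = r • ((w - q) + (v - t)) := by
        rw [hx, hwdef]
        module
      rw [dist_eq_norm, h4, norm_smul, Real.norm_eq_abs, abs_of_pos hr0]
      gcongr
      refine (norm_add_le _ _).trans ?_
      rw [mem_ball, dist_eq_norm] at hvt
      gcongr
    have hdn' : (d : ℝ) ≤ n + m := by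
      have : d ≤ n + m := by omega
      exact_mod_cast this
    calc |F i x - F i (x0 + r • q)| ≤ |F i x - F i (x0 + r • q + r • t)| +
          |F i (x0 + r • q + r • t) - F i (x0 + r • q)| := abs_sub_le _ _ _
      _ ≤ K * (r * ((n + m : ℝ) / k + 1 / k)) + 1 / k * r := by
          refine add_le_add (h2.trans ?_) h1
          gcongr
      _ = M * r / k := by rw [hM]; field_simp
  have hS : ∀ q, ediam (S q) ≤ ENNReal.ofReal (2 * M * r / k) := by
    intro q
    refine ediam_le ?_
    rintro _ ⟨x, hxA, rfl, hx⟩ _ ⟨y, hyA, rfl, hy⟩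
    rw [edist_dist]
    refine ENNReal.ofReal_le_ofReal (le_of_forall_pos_le_add fun ε hε => ?_)
    obtain ⟨i, hi⟩ := hp y hyA (ε / 2) (half_pos hε)
    have h1 := abs_le.1 (hx i)
    have h2 := abs_le.1 (hy i)
    rw [hFA x hxA i] at h1
    rw [hFA y hyA i] at h2
    have h3 := dist_triangle_right (f x) (f y) (p i)
    have h4 : 2 * M * r / k = 2 * (M * r / k) := by ring
    linarith [h1.1, h1.2, h2.1, h2.2]
  have hreal : ((2 * k + 1 : ℝ)) ^ d * (2 * M * r / k) ^ n ≤ 3 ^ n * (2 * M) ^ n / k * r ^ n := by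
    have hk1 : (1 : ℝ) ≤ k := by exact_mod_cast hk
    have h1 : (2 * k + 1 : ℝ) ^ d * k ≤ 3 ^ n * k ^ n := by
      calc (2 * k + 1 : ℝ) ^ d * k ≤ (3 * k) ^ d * (3 * k) := by
            gcongr <;> linarith
        _ = (3 * k) ^ (d + 1) := by ring
        _ ≤ (3 * k) ^ n := pow_le_pow_right₀ (by linarith) hdn
        _ = 3 ^ n * k ^ n := by rw [mul_pow]
    have h2 : (2 * M * r / k) ^ n = (2 * M) ^ n * r ^ n / k ^ n := by
      rw [div_pow, mul_pow]
    rw [h2, mul_div_assoc', div_le_iff₀ (by positivity)]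
    have h3 : 3 ^ n * (2 * M) ^ n / k * r ^ n * (k : ℝ) ^ n
        = (3 ^ n * k ^ n) / k * ((2 * M) ^ n * r ^ n) := by ring
    rw [h3]
    gcongr
    rwa [le_div_iff₀ hk0]
  have hcont1 : hcont n hn (f '' (ball x0 r ∩ A)) ≤
      ENNReal.ofReal (3 ^ n * (2 * M) ^ n / k) * ENNReal.ofReal r ^ n := by
    calc hcont n hn (f '' (ball x0 r ∩ A)) ≤ hcont n hn (⋃ q ∈ P, S q) := measure_mono hcov
      _ ≤ ∑ q ∈ P, hcont n hn (S q) := measure_biUnion_finset_le _ _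
      _ ≤ ∑ _q ∈ P, ENNReal.ofReal (2 * M * r / k) ^ n := by
          refine Finset.sum_le_sum fun q _ => (hcont_le_diam n hn _).trans ?_
          gcongr
          exact hS q
      _ = P.card * ENNReal.ofReal ((2 * M * r / k) ^ n) := by
          rw [Finset.sum_const, nsmul_eq_mul, ENNReal.ofReal_pow (by positivity)]
      _ ≤ ENNReal.ofReal ((2 * k + 1 : ℝ) ^ d) * ENNReal.ofReal ((2 * M * r / k) ^ n) := by
          gcongr
          rw [← ENNReal.ofReal_natCast]
          refine ENNReal.ofReal_le_ofReal ?_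
          exact_mod_cast hPc
      _ = ENNReal.ofReal ((2 * k + 1 : ℝ) ^ d * (2 * M * r / k) ^ n) := by
          rw [ENNReal.ofReal_mul (by positivity)]
      _ ≤ ENNReal.ofReal (3 ^ n * (2 * M) ^ n / k * r ^ n) := ENNReal.ofReal_le_ofReal hreal
      _ = _ := by
          rw [ENNReal.ofReal_mul (by positivity), ENNReal.ofReal_pow hr0.le]
  have htop : hcont n hn (f '' (ball x0 r ∩ A)) ≠ ⊤ :=
    (hcont1.trans_lt (ENNReal.mul_lt_top ENNReal.ofReal_lt_top
      (ENNReal.pow_lt_top ENNReal.ofReal_lt_top))).ne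
  refine ENNReal.div_le_of_le_mul ((hContent_eq_hcont n hn _ htop).trans ?_)
  calc _ ≤ unitBallVol n * (ENNReal.ofReal (3 ^ n * (2 * M) ^ n / k) * ENNReal.ofReal r ^ n) := by
        gcongr
    _ = _ := by ring

lemma density_zero_s4 {n m : ℕ} (hn : n ≠ 0) {X : Type*} [MetricSpace X]
    (A : Set (EucSp (n + m))) (f : EucSp (n + m) → X) (p : ℕ → X)
    (F : ℕ → EucSp (n + m) → ℝ) (K : ℝ≥0) (hF : ∀ i, LipschitzWith K (F i))
    (hFA : ∀ x ∈ A, ∀ i, F i x = dist (f x) (p i))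
    (hp : ∀ x ∈ A, ∀ ε > 0, ∃ i, dist (f x) (p i) < ε)
    (x0 : EucSp (n + m)) (V : Submodule ℝ (EucSp (n + m))) (hV : m < Module.finrank ℝ V)
    (hker : ∀ w, ∀ v ∈ V, ∀ η > 0, ∀ᶠ r in 𝓝[>] (0 : ℝ), ∀ i,
      |F i (x0 + r • w + r • v) - F i (x0 + r • w)| ≤ η * r) :
    upperDensity n f A x0 = 0 := by
  refine le_antisymm ?_ zero_le
  have h1 : ∀ k : ℕ, upperDensity n f A x0 ≤
      ENNReal.ofReal (3 ^ n * (2 * (K * (n + m + 1) + 1)) ^ n / ((k + 1 : ℕ) : ℝ)) := fun k =>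
    limsup_le_of_le (by isBoundedDefault)
      (density_bound hn A f p F K hF hFA hp x0 V hV hker (k + 1) k.succ_pos)
  refine ge_of_tendsto' (x := atTop) ?_ h1
  rw [← ENNReal.ofReal_zero]
  refine ENNReal.tendsto_ofReal ?_
  exact (tendsto_const_div_atTop_nhds_zero_nat _).comp (tendsto_add_atTop_nat 1)

lemma exists_injOn_clm {m N : ℕ} (V : Submodule ℝ (EucSp N)) (hdim : Module.finrank ℝ V ≤ m) :
    ∃ Q : EucSp N →L[ℝ] EucSp m, ∀ v ∈ V, Q v = 0 → v = 0 := by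
  obtain ⟨T, hT⟩ : ∃ T : V →ₗ[ℝ] EucSp m, Function.Injective T := by
    refine finrank_le_iff_exists_linearMap.1 ?_
    simpa using hdim
  refine ⟨(LinearMap.toContinuousLinearMap T).comp V.orthogonalProjectionOnto, fun v hv h => ?_⟩
  have h1 : V.orthogonalProjectionOnto v = ⟨v, hv⟩ :=
    Submodule.orthogonalProjectionOnto_mem_subspace_eq_self ⟨v, hv⟩
  simp only [ContinuousLinearMap.comp_apply, h1] at h
  have h2 : (⟨v, hv⟩ : V) = 0 := hT (by simpa using h)
  simpa using congrArg Subtype.val h2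

lemma local_antilip {m N : ℕ} (E : Set (EucSp N)) (F : ℕ → EucSp N → ℝ) (x : EucSp N)
    (hdiff : ∀ i, DifferentiableAt ℝ (F i) x) (hconst : ∀ y ∈ E, ∀ i, F i y = F i x)
    (V : Submodule ℝ (EucSp N)) (hV : ∀ v, (∀ i, fderiv ℝ (F i) x v = 0) → v ∈ V)
    (hdim : Module.finrank ℝ V ≤ m) :
    ∃ Q : EucSp N →L[ℝ] EucSp m, ∃ c > (0 : ℝ), ∀ᶠ y in 𝓝[E] x, c * ‖y - x‖ ≤ ‖Q (y - x)‖ := by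
  obtain ⟨Q, hQ⟩ := exists_injOn_clm (m := m) V hdim
  refine ⟨Q, ?_⟩
  by_contra! hcon
  have H : ∀ k : ℕ, ∃ y, (y ∈ E ∧ dist y x < 1 / ((k : ℝ) + 1)) ∧
      ‖Q (y - x)‖ < (1 / ((k : ℝ) + 1)) * ‖y - x‖ := by
    intro k
    have hk : (0 : ℝ) < 1 / ((k : ℝ) + 1) := by positivity
    have h1 := hcon _ hk
    have h2 : ∀ᶠ y in 𝓝[E] x, y ∈ E ∧ dist y x < 1 / ((k : ℝ) + 1) := by
      filter_upwards [self_mem_nhdsWithin, nhdsWithin_le_nhds (ball_mem_nhds x hk)] with y h3 h4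
      exact ⟨h3, h4⟩
    obtain ⟨y, hy1, hy2⟩ := (h1.and_eventually h2).exists
    exact ⟨y, hy2, hy1⟩
  choose y hy hyQ using H
  have hyne : ∀ k, 0 < ‖y k - x‖ := by
    intro k
    rcases (norm_nonneg (y k - x)).eq_or_lt with h | h
    · have := hyQ k
      rw [← h, mul_zero] at this
      exact absurd this (not_lt.2 (norm_nonneg _))
    · exact h
  have hlim0 : Tendsto (fun k : ℕ => 1 / ((k : ℝ) + 1)) atTop (𝓝 0) :=
    tendsto_one_div_add_atTop_nhds_zero_nat
  have hylim : Tendsto y atTop (𝓝 x) := by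
    rw [tendsto_iff_dist_tendsto_zero]
    exact squeeze_zero (fun _ => dist_nonneg) (fun k => (hy k).2.le) hlim0
  let u : ℕ → EucSp N := fun k => ‖y k - x‖⁻¹ • (y k - x)
  have hu : ∀ k, u k ∈ sphere (0 : EucSp N) 1 := by
    intro k
    simp [u, norm_smul, (hyne k).ne']
  obtain ⟨a, ha, φ, hφ, hlim⟩ := (isCompact_sphere (0 : EucSp N) 1).tendsto_subseq hu
  have hQa : Q a = 0 := by
    have h1 : Tendsto (fun k => ‖Q (u (φ k))‖) atTop (𝓝 ‖Q a‖) :=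
      ((Q.continuous.tendsto a).comp hlim).norm
    have h2 : Tendsto (fun k => ‖Q (u (φ k))‖) atTop (𝓝 0) := by
      refine squeeze_zero (fun _ => norm_nonneg _) (fun k => ?_) (hlim0.comp hφ.tendsto_atTop)
      simp only [u, map_smul, norm_smul, norm_inv, norm_norm, Function.comp]
      rw [inv_mul_le_iff₀ (hyne _), mul_comm]
      exact (hyQ _).le
    exact norm_eq_zero.1 (tendsto_nhds_unique h1 h2)
  have hDa : ∀ i, fderiv ℝ (F i) x a = 0 := by
    intro i
    have h1 : Tendsto (fun k => ‖fderiv ℝ (F i) x (u (φ k))‖) atTop (𝓝 ‖fderiv ℝ (F i) x a‖) :=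
      (((fderiv ℝ (F i) x).continuous.tendsto a).comp hlim).norm
    have h3 := (hasFDerivAt_iff_tendsto.1 (hdiff i).hasFDerivAt).comp
      (hylim.comp hφ.tendsto_atTop)
    have h2 : Tendsto (fun k => ‖fderiv ℝ (F i) x (u (φ k))‖) atTop (𝓝 0) := by
      refine h3.congr fun k => ?_
      simp only [Function.comp, hconst _ (hy (φ k)).1 i, sub_self, zero_sub, norm_neg, u, map_smul,
        norm_smul, norm_inv, norm_norm]
    exact norm_eq_zero.1 (tendsto_nhds_unique h1 h2)
  have h0 := hQ a (hV a hDa) hQa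
  rw [h0] at ha
  simp at ha

lemma rect_of_local {m N : ℕ} (E : Set (EucSp N))
    (h : ∀ x ∈ E, ∃ Q : EucSp N →L[ℝ] EucSp m, ∃ c > (0 : ℝ),
      ∀ᶠ y in 𝓝[E] x, c * ‖y - x‖ ≤ ‖Q (y - x)‖) :
    ∃ (g : ℕ → EucSp m → EucSp N) (S : ℕ → Set (EucSp m)),
      (∀ i, ∃ L : ℝ≥0, LipschitzOnWith L (g i) (S i)) ∧ E ⊆ ⋃ i, g i '' S i := by
  let Qs : ℕ → (EucSp N →L[ℝ] EucSp m) := TopologicalSpace.denseSeq _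
  let ps : ℕ → EucSp N := TopologicalSpace.denseSeq _
  let P : ℕ × ℕ × ℕ → Set (EucSp N) := fun t =>
    {x | x ∈ E ∧ (∀ y ∈ E, dist y x < 1 / ((t.2.1 : ℝ) + 1) →
      ‖y - x‖ ≤ ((t.2.1 : ℝ) + 1) * ‖Qs t.1 (y - x)‖) ∧
      dist x (ps t.2.2) < 1 / ((t.2.1 : ℝ) + 1) / 2}
  have hP : ∀ t, ∀ x ∈ P t, ∀ y ∈ P t, ‖y - x‖ ≤ ((t.2.1 : ℝ) + 1) * ‖Qs t.1 y - Qs t.1 x‖ := by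
    intro t x hx y hy
    rw [← map_sub]
    refine hx.2.1 y hy.1 ?_
    have h1 := dist_triangle_right y x (ps t.2.2)
    have h2 := hx.2.2
    have h3 := hy.2.2
    linarith
  have hcov : E ⊆ ⋃ t, P t := by
    intro x hx
    obtain ⟨Q, c, hc, hev⟩ := h x hx
    obtain ⟨a, ha⟩ := (TopologicalSpace.denseRange_denseSeq (EucSp N →L[ℝ] EucSp m)).exists_dist_lt
      Q (half_pos hc)
    rw [eventually_nhdsWithin_iff, Metric.eventually_nhds_iff] at hev
    obtain ⟨ε, hε, hev⟩ := hev
    obtain ⟨j1, hj1⟩ := exists_nat_one_div_lt hε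
    obtain ⟨j2, hj2⟩ := exists_nat_ge (2 / c)
    set j := max j1 j2
    have hj : (0 : ℝ) < 1 / ((j : ℝ) + 1) / 2 := by positivity
    obtain ⟨b, hb⟩ := (TopologicalSpace.denseRange_denseSeq (EucSp N)).exists_dist_lt x hj
    refine mem_iUnion.2 ⟨(a, j, b), hx, fun y hy hyx => ?_, hb⟩
    have hyε : dist y x < ε := by
      refine hyx.trans_le (le_trans ?_ hj1.le)
      have : (j1 : ℝ) ≤ j := by exact_mod_cast le_max_left _ _
      simp only
      gcongr
    have h1 := hev hyε hy
    have h2 : ‖Q (y - x) - Qs a (y - x)‖ ≤ c / 2 * ‖y - x‖ := by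
      rw [← sub_apply]
      refine ((Q - Qs a).le_opNorm _).trans ?_
      gcongr
      rw [dist_eq_norm] at ha
      exact ha.le
    have h3 := norm_sub_norm_le (Q (y - x)) (Qs a (y - x))
    have h4 : c / 2 * ‖y - x‖ ≤ ‖Qs a (y - x)‖ := by linarith
    have h5 : 2 / c ≤ (j : ℝ) + 1 := by
      have : (j2 : ℝ) ≤ j := by exact_mod_cast le_max_right _ _
      linarith
    calc ‖y - x‖ = 2 / c * (c / 2 * ‖y - x‖) := by field_simp
      _ ≤ ((j : ℝ) + 1) * ‖Qs a (y - x)‖ := by gcongr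
  obtain ⟨e, he⟩ := exists_surjective_nat (ℕ × ℕ × ℕ)
  refine ⟨fun i => Function.invFunOn (Qs (e i).1) (P (e i)), fun i => Qs (e i).1 '' P (e i),
    fun i => ⟨⟨((e i).2.1 : ℝ) + 1, by positivity⟩, ?_⟩, ?_⟩
  · refine LipschitzOnWith.of_dist_le_mul fun p hp q hq => ?_
    have hp1 := Function.invFunOn_mem hp
    have hp2 := Function.invFunOn_eq hp
    have hq1 := Function.invFunOn_mem hq
    have hq2 := Function.invFunOn_eq hq
    have h1 := hP (e i) _ hq1 _ hp1
    rw [hp2, hq2] at h1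
    rw [dist_eq_norm, dist_eq_norm]
    exact h1
  · intro x hx
    obtain ⟨t, ht⟩ := mem_iUnion.1 (hcov hx)
    obtain ⟨i, rfl⟩ := he t
    refine mem_iUnion.2 ⟨i, Qs (e i).1 x, mem_image_of_mem _ ht, ?_⟩
    have hmem : Qs (e i).1 x ∈ Qs (e i).1 '' P (e i) := mem_image_of_mem _ ht
    have h1 := hP (e i) _ ht _ (Function.invFunOn_mem hmem)
    rw [Function.invFunOn_eq hmem, sub_self, norm_zero, mul_zero] at h1
    exact sub_eq_zero.1 (norm_le_zero_iff.1 h1)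

lemma rect_zero {m : ℕ} (E : Set (EucSp (0 + m))) : CountablyHmRectifiable m (0 + m) E := by
  obtain ⟨g, S, hg, hE⟩ := rect_of_local (m := m) E (fun x _ => by
    obtain ⟨Q, c, hc, h⟩ := local_antilip (m := m) {x} (fun _ _ => 0) x
      (fun i => differentiableAt_const _) (fun _ _ _ => rfl) ⊤ (fun _ _ => Submodule.mem_top)
      (by simp)
    obtain ⟨Q, hQ⟩ := exists_injOn_clm (m := m) (⊤ : Submodule ℝ (EucSp (0 + m))) (by simp)
    obtain ⟨K, hK, hKQ⟩ := Q.toLinearMap.exists_antilipschitzWith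
      (LinearMap.ker_eq_bot'.2 fun v hv => hQ v Submodule.mem_top hv)
    refine ⟨Q, (K : ℝ)⁻¹, by positivity, Eventually.of_forall fun y => ?_⟩
    rw [inv_mul_le_iff₀ (by exact_mod_cast hK)]
    have h1 := hKQ.le_mul_dist y x
    simpa [dist_eq_norm, ← map_sub] using h1)
  refine ⟨g, S, hg, ?_⟩
  rw [diff_eq_empty.2 hE]
  exact measure_empty

/-- Corollary: if `f : A → X` is Lipschitz on a measurable
`A ⊆ ℝ^{n+m}` of positive measure and `Θ^{*n}(f,x) > 0` for a.e. `x ∈ A`, then for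
`ℋ^n`-a.e. `z ∈ X` the fiber `f⁻¹(z)` is countably `ℋ^m`-rectifiable. -/
theorem stmt4 {n m : ℕ} {X : Type*} [MetricSpace X] [MeasurableSpace X] [BorelSpace X]
    (A : Set (EucSp (n + m))) (hA : MeasurableSet A) (hApos : 0 < volume A)
    (f : EucSp (n + m) → X) (hf : ∃ L : ℝ≥0, LipschitzOnWith L f A)
    (hdens : ∀ᵐ x ∂(volume.restrict A), 0 < upperDensity n f A x) :
    ∀ᵐ z ∂(μH[(n : ℝ)] : Measure X),
      CountablyHmRectifiable m (n + m) (f ⁻¹' {z} ∩ A) := by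
  rcases eq_or_ne n 0 with rfl | hn
  · exact Eventually.of_forall fun z => rect_zero _
  obtain ⟨K, hK⟩ := hf
  have hne : A.Nonempty := by
    rcases A.eq_empty_or_nonempty with h | h
    · simp [h] at hApos
    · exact h
  haveI : Nonempty A := hne.to_subtype
  let a : ℕ → A := TopologicalSpace.denseSeq A
  let p : ℕ → X := fun i => f (a i)
  have hext : ∀ i, ∃ G : EucSp (n + m) → ℝ, LipschitzWith K G ∧
      EqOn (fun x => dist (f x) (p i)) G A := by
    intro i
    refine LipschitzOnWith.extend_real (LipschitzOnWith.of_dist_le_mul fun x hx y hy => ?_)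
    rw [Real.dist_eq]
    exact (abs_dist_sub_le _ _ _).trans (hK.dist_le_mul x hx y hy)
  choose F hF hFA' using hext
  have hFA : ∀ x ∈ A, ∀ i, F i x = dist (f x) (p i) := fun x hx i => (hFA' i hx).symm
  have hp : ∀ x ∈ A, ∀ ε > 0, ∃ i, dist (f x) (p i) < ε := by
    intro x hx ε hε
    obtain ⟨i, hi⟩ := (TopologicalSpace.denseRange_denseSeq A).exists_dist_lt
      (⟨x, hx⟩ : A) (show (0 : ℝ) < ε / (K + 1) by positivity)
    refine ⟨i, (hK.dist_le_mul x hx (a i) (a i).2).trans_lt ?_⟩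
    have hi2 : dist x (a i : EucSp (n + m)) < ε / (K + 1) := hi
    rw [lt_div_iff₀ (by positivity)] at hi2
    have : (0 : ℝ) ≤ dist x (a i : EucSp (n + m)) := dist_nonneg
    nlinarith
  let V : EucSp (n + m) → Submodule ℝ (EucSp (n + m)) := fun x =>
    ⨅ i, LinearMap.ker (fderiv ℝ (F i) x).toLinearMap
  have hVmem : ∀ x v, v ∈ V x ↔ ∀ i, fderiv ℝ (F i) x v = 0 := by
    intro x v
    simp [V, Submodule.mem_iInf]
  let good : EucSp (n + m) → Prop := fun x =>
    (∀ i, DifferentiableAt ℝ (F i) x) ∧ Module.finrank ℝ (V x) ≤ m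
  have hgood : ∀ᵐ x, x ∈ A → good x := by
    filter_upwards [increment_ker hF, (ae_restrict_iff' hA).1 hdens] with x hx hx2 hxA
    refine ⟨hx.1, ?_⟩
    by_contra! hcon
    have h0 := density_zero_s4 hn A f p F K hF hFA hp x (V x) hcon
      (fun w v hv => hx.2 w v ((hVmem x v).1 hv))
    exact (hx2 hxA).ne' h0
  let Z : Set (EucSp (n + m)) := {x | x ∈ A ∧ ¬ good x}
  have hZ : volume Z = 0 := by
    rw [ae_iff] at hgood
    simpa [Z] using hgood
  filter_upwards [eilenberg_null hn Z hZ f K (hK.mono fun x hx => hx.1)] with z hz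
  let E : Set (EucSp (n + m)) := {x | x ∈ A ∧ f x = z ∧ good x}
  obtain ⟨g, S, hg, hE⟩ := rect_of_local (m := m) E (fun x hx => by
    refine local_antilip E F x hx.2.2.1 (fun y hy i => ?_) (V x) (fun v => (hVmem x v).2) hx.2.2.2
    rw [hFA y hy.1, hFA x hx.1, hy.2.1, hx.2.1])
  refine ⟨g, S, hg, measure_mono_null ?_ hz⟩
  rintro x ⟨⟨hxz, hxA⟩, hx⟩
  refine ⟨hxz, hxA, fun hgx => hx (hE ⟨hxA, hxz, hgx⟩)⟩

end
end
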